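/- Let Ω ⊂ ℝ^d be a bounded domain with C³ boundary. Then there exist C > 0 and T > 0 such that for every u₀ ∈ C_c^∞(Ω), the solution u(t) := S(t)u₀ of the heat equation with Dirichlet boundary condition satisfies sup_{0 < t < T} ‖N[u](t)‖_{L^∞(Ω)} ≤ C ‖u₀‖_{L^∞(Ω)}. In particular, ‖u(t)‖_{L^∞} ≤ C‖u₀‖_{L^∞}, ‖∇u(t)‖_{L^∞} ≤ C t^{−1/2}‖u₀‖_{L^∞}, and ‖∇²u(t)‖_{L^∞} ≤ C t^{−1}‖u₀‖_{L^∞} for 0 < t < T. -/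

import Mathlib

open MeasureTheory Filter Topology
open scoped ENNReal NNReal

noncomputable section

/-- Euclidean space `ℝ^d`. -/
abbrev Euc (d : ℕ) := EuclideanSpace ℝ (Fin d)

variable {d : ℕ}

/-- `φ` is a test function on `Ω`, i.e. `φ ∈ C_c^∞(Ω)`. -/
def IsTestFun (Ω : Set (Euc d)) (φ : Euc d → ℝ) : Prop :=
  ContDiff ℝ (⊤ : ℕ∞) φ ∧ HasCompactSupport φ ∧ tsupport φ ⊆ Ω

/-- Classical partial derivative in the `i`-th coordinate direction. -/
def pd (i : Fin d) (f : Euc d → ℝ) (x : Euc d) : ℝ :=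
  fderiv ℝ f x (EuclideanSpace.single i 1)

/-- Classical Laplacian. -/
def lap (f : Euc d → ℝ) (x : Euc d) : ℝ := ∑ i, pd i (pd i f) x

/-- Iterated classical partial derivatives along a multi-index. -/
def iterPD : {m : ℕ} → (Fin m → Fin d) → (Euc d → ℝ) → Euc d → ℝ
  | 0, _, f => f
  | _ + 1, a, f => iterPD (fun i => a i.succ) (pd (a 0) f)

/-- `v` is the family of `m`-th order weak partial derivatives of `u` on `Ω`. -/
def HasWeakDerivs (Ω : Set (Euc d)) (m : ℕ) (u : Euc d → ℝ)
    (v : (Fin m → Fin d) → Euc d → ℝ) : Prop :=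
  ∀ a : Fin m → Fin d, ∀ φ : Euc d → ℝ, IsTestFun Ω φ →
    ∫ x in Ω, u x * iterPD a φ x = (-1 : ℝ) ^ m * ∫ x in Ω, v a x * φ x

/-- Membership in the Sobolev space `W^{k,p}(Ω)`. -/
def MemW (Ω : Set (Euc d)) (p : ℝ≥0∞) (k : ℕ) (u : Euc d → ℝ) : Prop :=
  ∀ m : ℕ, m ≤ k → ∃ v, HasWeakDerivs Ω m u v ∧
    ∀ a, MemLp (v a) p (volume.restrict Ω)

/-- Pointwise magnitude of a family of `m`-th order derivatives. -/
def Dmag {m : ℕ} (v : (Fin m → Fin d) → Euc d → ℝ) (x : Euc d) : ℝ :=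
  ∑ a : Fin m → Fin d, |v a x|

/-- `L^p(Ω)` norm of a family of `m`-th order derivatives. -/
def DkNorm (Ω : Set (Euc d)) (p : ℝ≥0∞) {m : ℕ}
    (v : (Fin m → Fin d) → Euc d → ℝ) : ℝ≥0∞ :=
  eLpNorm (Dmag v) p (volume.restrict Ω)

/-- Membership in `W^{1,p}_0(Ω)`: there is a weak gradient, and `u` is approximated
together with its gradient by test functions in the `L^p` norm. -/
def MemW10 (Ω : Set (Euc d)) (p : ℝ≥0∞) (u : Euc d → ℝ) : Prop :=
  ∃ v : Fin d → Euc d → ℝ,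
    HasWeakDerivs Ω 1 u (fun a => v (a 0)) ∧
    (∀ i, MemLp (v i) p (volume.restrict Ω)) ∧
    ∃ φ : ℕ → Euc d → ℝ, (∀ n, IsTestFun Ω (φ n)) ∧
      Tendsto (fun n =>
        eLpNorm (fun x => u x - φ n x) p (volume.restrict Ω) +
        ∑ i : Fin d, eLpNorm (fun x => v i x - pd i (φ n) x) p (volume.restrict Ω))
        atTop (𝓝 0)

/-- `Δu = f` holds weakly (in the distributional sense) in `Ω`. -/
def IsWeakLap (Ω : Set (Euc d)) (u f : Euc d → ℝ) : Prop :=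
  ∀ φ : Euc d → ℝ, IsTestFun Ω φ →
    ∫ x in Ω, u x * lap φ x = ∫ x in Ω, f x * φ x

/-- `Ω` is a bounded domain. -/
def IsBoundedDomain (Ω : Set (Euc d)) : Prop :=
  IsOpen Ω ∧ IsConnected Ω ∧ Bornology.IsBounded Ω

/-- `Ω` has a `C^k` boundary, described by local level sets of `C^k` defining
functions with nonvanishing gradient. -/
def HasCkBoundary (Ω : Set (Euc d)) (k : ℕ∞) : Prop :=
  ∀ x ∈ frontier Ω, ∃ (U : Set (Euc d)) (ρ : Euc d → ℝ),
    IsOpen U ∧ x ∈ U ∧ ContDiffOn ℝ k ρ U ∧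
    (∀ y ∈ U, fderiv ℝ ρ y ≠ 0) ∧
    Ω ∩ U = {y ∈ U | ρ y < 0} ∧ frontier Ω ∩ U = {y ∈ U | ρ y = 0}

/-- `L^p(Ω)` norm of the (classical) `m`-th order derivatives of `f`. -/
def cDNorm (Ω : Set (Euc d)) (p : ℝ≥0∞) (m : ℕ) (f : Euc d → ℝ) : ℝ≥0∞ :=
  eLpNorm (fun x => ‖iteratedFDeriv ℝ m f x‖) p (volume.restrict Ω)

/-- `u` is the solution of the heat equation on `Ω` with Dirichlet boundary
condition and initial data `u₀`: it is continuous up to the parabolic boundary,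
smooth in space for positive times, satisfies `∂ₜ u = Δu` in `Ω`, vanishes on
`∂Ω`, and starts from `u₀`. -/
def IsHeatSol (Ω : Set (Euc d)) (u₀ : Euc d → ℝ) (u : ℝ → Euc d → ℝ) : Prop :=
  ContinuousOn (fun q : ℝ × Euc d => u q.1 q.2) (Set.Ici 0 ×ˢ closure Ω) ∧
  (∀ t, 0 < t → ContDiffOn ℝ (⊤ : ℕ∞) (u t) Ω) ∧
  (∀ t, 0 < t → ∀ x ∈ Ω, HasDerivAt (fun s => u s x) (lap (u t) x) t) ∧
  (∀ t, 0 < t → ∀ x ∈ frontier Ω, u t x = 0) ∧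
  (∀ x, u 0 x = u₀ x)

/-- The quantity `N[u](t,x) = |u| + t^{1/2}|∇u| + t|∇²u| + t|∂ₜ u|`. -/
def Nfun (u : ℝ → Euc d → ℝ) (t : ℝ) (x : Euc d) : ℝ :=
  |u t x| + Real.sqrt t * ‖fderiv ℝ (u t) x‖ + t * ‖iteratedFDeriv ℝ 2 (u t) x‖ +
    t * |deriv (fun s => u s x) t|

/-- The upper half space `ℝ^{d+1}_+`. -/
def halfSpace (d : ℕ) : Set (Euc (d+1)) := {x | 0 < x (Fin.last d)}

/-- The cube of side length `t^{1/2}` centered at `t^{1/2} n`, `n ∈ ℤ^d`. -/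
def cube (t : ℝ) (n : Fin d → ℤ) : Set (Euc d) :=
  {x | ∀ i, |x i - Real.sqrt t * (n i : ℝ)| ≤ Real.sqrt t / 2}

end

/-- Second-order jet at `0` of a curve. -/
def Jet {F : Type*} [NormedAddCommGroup F] [NormedSpace ℝ F] (g : ℝ → F) (a b : F) : Prop :=
  ∃ g' : ℝ → F, (∀ᶠ s in 𝓝 (0:ℝ), HasDerivAt g (g' s) s) ∧ g' 0 = a ∧ HasDerivAt g' b 0

section jets
variable {F : Type*} [NormedAddCommGroup F] [NormedSpace ℝ F]
variable {G : Type*} [NormedAddCommGroup G] [NormedSpace ℝ G]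

theorem Jet.hasDerivAt {g : ℝ → F} {a b : F} (h : Jet g a b) : HasDerivAt g a 0 := by
  obtain ⟨g', h1, h2, h3⟩ := h
  rw [← h2]; exact h1.self_of_nhds

theorem Jet.const (c : F) : Jet (fun _ => c) 0 0 :=
  ⟨fun _ => 0, Eventually.of_forall fun s => hasDerivAt_const s c, rfl, hasDerivAt_const _ _⟩

theorem Jet.line (x v : F) : Jet (fun s : ℝ => x + s • v) v 0 := by
  refine ⟨fun _ => v, Eventually.of_forall fun s => ?_, rfl, hasDerivAt_const _ _⟩
  simpa using ((hasDerivAt_id s).smul_const v).const_add x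

theorem Jet.add {g h : ℝ → F} {a b c e : F} (hg : Jet g a b) (hh : Jet h c e) :
    Jet (fun s => g s + h s) (a + c) (b + e) := by
  obtain ⟨g', h1, h2, h3⟩ := hg
  obtain ⟨k', k1, k2, k3⟩ := hh
  refine ⟨fun s => g' s + k' s, ?_, by simp [h2, k2], h3.add k3⟩
  filter_upwards [h1, k1] with s p q using p.add q

theorem Jet.neg {g : ℝ → F} {a b : F} (hg : Jet g a b) :
    Jet (fun s => - g s) (-a) (-b) := by
  obtain ⟨g', h1, h2, h3⟩ := hg
  refine ⟨fun s => - g' s, ?_, by simp [h2], h3.neg⟩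
  filter_upwards [h1] with s p using p.neg

theorem Jet.sub {g h : ℝ → F} {a b c e : F} (hg : Jet g a b) (hh : Jet h c e) :
    Jet (fun s => g s - h s) (a - c) (b - e) := by
  simpa [sub_eq_add_neg] using hg.add hh.neg

theorem Jet.sum {ι : Type*} (s : Finset ι) {g : ι → ℝ → F} {a b : ι → F}
    (h : ∀ i ∈ s, Jet (g i) (a i) (b i)) :
    Jet (fun r => ∑ i ∈ s, g i r) (∑ i ∈ s, a i) (∑ i ∈ s, b i) := by
  classical
  induction s using Finset.induction_on with
  | empty => simpa using Jet.const (0:F)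
  | insert i s hi ih =>
    simp only [Finset.sum_insert hi]
    exact (h i (Finset.mem_insert_self _ _)).add
      (ih fun j hj => h j (Finset.mem_insert_of_mem hj))

theorem Jet.mul {g h : ℝ → ℝ} {a b c e : ℝ} (hg : Jet g a b) (hh : Jet h c e) :
    Jet (fun s => g s * h s) (a * h 0 + g 0 * c) (b * h 0 + 2 * (a * c) + g 0 * e) := by
  have hg0 := hg.hasDerivAt
  have hh0 := hh.hasDerivAt
  obtain ⟨g', h1, h2, h3⟩ := hg
  obtain ⟨k', k1, k2, k3⟩ := hh
  refine ⟨fun s => g' s * h s + g s * k' s, ?_, by simp [h2, k2], ?_⟩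
  · filter_upwards [h1, k1] with s p q using p.mul q
  · refine ((h3.mul hh0).add (hg0.mul k3)).congr_deriv ?_
    rw [h2, k2]; ring

theorem Jet.smul {g : ℝ → ℝ} {a b : ℝ} (hg : Jet g a b) (v : F) :
    Jet (fun s => g s • v) (a • v) (b • v) := by
  obtain ⟨g', h1, h2, h3⟩ := hg
  refine ⟨fun s => g' s • v, ?_, by simp [h2], h3.smul_const v⟩
  filter_upwards [h1] with s p using p.smul_const v

theorem Jet.const_mul {g : ℝ → ℝ} {a b : ℝ} (c : ℝ) (hg : Jet g a b) :
    Jet (fun s => c * g s) (c * a) (c * b) := by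
  simpa using (Jet.const c).mul hg

theorem Jet.congr {g h : ℝ → F} {a b : F} (hg : Jet g a b) (e : g =ᶠ[𝓝 0] h) : Jet h a b := by
  obtain ⟨g', h1, h2, h3⟩ := hg
  refine ⟨g', ?_, h2, h3⟩
  filter_upwards [h1, e.eventuallyEq_nhds] with s p q
  exact p.congr_of_eventuallyEq q.symm

theorem Jet.unique {g : ℝ → F} {a b c e : F} (h : Jet g a b) (k : Jet g c e) :
    a = c ∧ b = e := by
  obtain ⟨g', h1, h2, h3⟩ := h
  obtain ⟨k', k1, k2, k3⟩ := k
  have : g' =ᶠ[𝓝 0] k' := by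
    filter_upwards [h1, k1] with s p q using p.unique q
  refine ⟨by rw [← h2, ← k2]; exact this.self_of_nhds, h3.unique (k3.congr_of_eventuallyEq this)⟩

theorem Jet.comp {f : F → G} {γ : ℝ → F} {a b : F} (hf : ContDiffAt ℝ 2 f (γ 0))
    (hγ : Jet γ a b) :
    Jet (fun s => f (γ s)) (fderiv ℝ f (γ 0) a)
      (fderiv ℝ (fderiv ℝ f) (γ 0) a a + fderiv ℝ f (γ 0) b) := by
  have hc := hγ.hasDerivAt
  obtain ⟨g', h1, h2, h3⟩ := hγ
  have hev : ∀ᶠ y in 𝓝 (γ 0), DifferentiableAt ℝ f y := by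
    filter_upwards [hf.eventually (by simp)] with y hy
    exact hy.differentiableAt (by simp)
  have hd : DifferentiableAt ℝ (fderiv ℝ f) (γ 0) :=
    (hf.fderiv_right (m := 1) (by norm_num)).differentiableAt (by simp)
  refine ⟨fun s => fderiv ℝ f (γ s) (g' s), ?_, by simp only [h2], ?_⟩
  · filter_upwards [h1, hc.continuousAt.eventually hev] with s p q
    exact q.hasFDerivAt.comp_hasDerivAt s p
  · have := (hd.hasFDerivAt.comp_hasDerivAt (0:ℝ) hc).clm_apply h3
    simpa [h2] using this

theorem Jet.of_contDiffAt {f : F → G} {x : F} (hf : ContDiffAt ℝ 2 f x) (v : F) :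
    Jet (fun s : ℝ => f (x + s • v)) (fderiv ℝ f x v) (fderiv ℝ (fderiv ℝ f) x v v) := by
  have := Jet.comp (f := f) (γ := fun s : ℝ => x + s • v) (by simpa using hf) (Jet.line x v)
  simpa using this

theorem Jet.isLocalMax {g : ℝ → ℝ} {a b : ℝ} (h : Jet g a b) (hm : IsLocalMax g 0) :
    a = 0 ∧ b ≤ 0 := by
  have ha : a = 0 := hm.hasDerivAt_eq_zero h.hasDerivAt
  refine ⟨ha, ?_⟩
  by_contra hb
  push Not at hb
  have hcont := h.hasDerivAt.continuousAt
  have h' := h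
  obtain ⟨g', h1, h2, h3⟩ := h
  have e : deriv g =ᶠ[𝓝 0] g' := by
    filter_upwards [h1] with s p using p.deriv
  have hmin : IsLocalMin g 0 := by
    refine isLocalMin_of_deriv_deriv_pos ?_ ?_ hcont
    · rw [e.deriv_eq, h3.deriv]; exact hb
    · rw [e.self_of_nhds, h2, ha]
  have : (fun _ => g 0) =ᶠ[𝓝 0] g := by
    filter_upwards [hmin, hm] with s p q using le_antisymm p q
  have := ((Jet.const (g 0)).congr this).unique h'
  linarith [this.2]

end jets

section lapl
variable {d : ℕ}

/-- Standard basis vector. -/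
noncomputable abbrev bv (i : Fin d) : Euc d := EuclideanSpace.single i 1

theorem lap_eq {f : Euc d → ℝ} {x : Euc d} (hf : ContDiffAt ℝ 2 f x) :
    lap f x = ∑ i, fderiv ℝ (fderiv ℝ f) x (bv i) (bv i) := by
  have hd : DifferentiableAt ℝ (fderiv ℝ f) x :=
    (hf.fderiv_right (m := 1) (by norm_num)).differentiableAt (by simp)
  unfold lap
  refine Finset.sum_congr rfl fun i _ => ?_
  have : HasFDerivAt (pd i f) _ x := hd.hasFDerivAt.clm_apply (hasFDerivAt_const (bv i) x)
  unfold pd at this ⊢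
  rw [this.fderiv]
  simp

theorem abs_lap_le {f : Euc d → ℝ} {x : Euc d} (hf : ContDiffAt ℝ 2 f x) :
    |lap f x| ≤ d * ‖fderiv ℝ (fderiv ℝ f) x‖ := by
  rw [lap_eq hf]
  refine (Finset.abs_sum_le_sum_abs _ _).trans ?_
  refine (Finset.sum_le_card_nsmul _ _ (‖fderiv ℝ (fderiv ℝ f) x‖) fun i _ => ?_).trans ?_
  · have := (fderiv ℝ (fderiv ℝ f) x).le_opNorm₂ (bv i) (bv i)
    simpa using this
  · simp

theorem sum_bv (v : Euc d) : ∑ i, v i • bv i = v := by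
  ext j
  simp [bv, Pi.single_apply]

/-- Laplacian at a local maximum. -/
theorem lap_nonpos_of_max {f : Euc d → ℝ} {x : Euc d} (hf : ContDiffAt ℝ 2 f x)
    (hm : IsLocalMax f x) : lap f x ≤ 0 := by
  rw [lap_eq hf]
  refine Finset.sum_nonpos fun i _ => ?_
  refine ((Jet.of_contDiffAt hf (bv i)).isLocalMax ?_).2
  have hc : ContinuousAt (fun s : ℝ => x + s • bv i) 0 := by fun_prop
  have : Tendsto (fun s : ℝ => x + s • bv i) (𝓝 0) (𝓝 x) := by simpa using hc.tendsto
  simpa [IsLocalMax, IsMaxFilter] using this.eventually hm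

/-- Reflection -/
noncomputable def rfle (e v : Euc d) : Euc d := v - (2 * inner ℝ e v) • e

theorem sum_refl (B : Euc d →L[ℝ] Euc d →L[ℝ] ℝ) (e : Euc d) (he : ‖e‖ = 1) :
    ∑ i, B (rfle e (bv i)) (rfle e (bv i)) = ∑ i, B (bv i) (bv i) := by
  have h1 : ∑ i, e i * B (bv i) e = B e e := by
    have : B e e = B (∑ i, e i • bv i) e := by rw [sum_bv]
    rw [this, map_sum]
    simp
  have h2 : ∑ i, e i * B e (bv i) = B e e := by
    have : B e e = B e (∑ i, e i • bv i) := by rw [sum_bv]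
    rw [this, map_sum]
    simp
  have h3 : ∑ i, e i * e i = 1 := by
    have := EuclideanSpace.real_norm_sq_eq e
    rw [he] at this
    simp only [← pow_two]
    linarith
  have h4 : ∀ i, B (rfle e (bv i)) (rfle e (bv i)) = B (bv i) (bv i)
      - 2 * (e i * B (bv i) e) - 2 * (e i * B e (bv i)) + 4 * (e i * e i * B e e) := by
    intro i
    have : inner ℝ e (bv i) = e i := by simp [bv, EuclideanSpace.inner_single_right]
    simp only [rfle, this]
    simp
    ring
  simp only [h4, Finset.sum_add_distrib, Finset.sum_sub_distrib, ← Finset.mul_sum, ← Finset.sum_mul,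
    h1, h2, h3]
  ring

end lapl

section coupling
variable {d : ℕ}

theorem coupling_line {f1 f2 : Euc d → ℝ} {x y : Euc d} {P : Euc d → Euc d → ℝ}
    (hm : ∀ᶠ z : Euc d × Euc d in 𝓝 (x, y),
      f1 z.1 - f2 z.2 - P z.1 z.2 ≤ f1 x - f2 y - P x y) (v1 v2 : Euc d) :
    IsLocalMax (fun s : ℝ => f1 (x + s • v1) - f2 (y + s • v2) - P (x + s • v1) (y + s • v2)) 0 := by
  have hc : ContinuousAt (fun s : ℝ => ((x + s • v1, y + s • v2) : Euc d × Euc d)) 0 := by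
    fun_prop
  have : Tendsto (fun s : ℝ => ((x + s • v1, y + s • v2) : Euc d × Euc d)) (𝓝 0) (𝓝 (x, y)) := by
    simpa using hc.tendsto
  simpa [IsLocalMax, IsMaxFilter] using this.eventually hm

theorem coupling_lap {f1 f2 : Euc d → ℝ} {x y : Euc d} {P : Euc d → Euc d → ℝ}
    (h1 : ContDiffAt ℝ 2 f1 x) (h2 : ContDiffAt ℝ 2 f2 y)
    (hm : ∀ᶠ z : Euc d × Euc d in 𝓝 (x, y),
      f1 z.1 - f2 z.2 - P z.1 z.2 ≤ f1 x - f2 y - P x y)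
    (e : Euc d) (he : ‖e‖ = 1) (A S : Fin d → ℝ)
    (hP : ∀ i, Jet (fun s : ℝ => P (x + s • bv i) (y + s • rfle e (bv i))) (A i) (S i)) :
    lap f1 x - lap f2 y ≤ ∑ i, S i := by
  rw [lap_eq h1, lap_eq h2, ← sum_refl (fderiv ℝ (fderiv ℝ f2) y) e he, ← Finset.sum_sub_distrib]
  refine Finset.sum_le_sum fun i _ => ?_
  have := ((((Jet.of_contDiffAt h1 (bv i)).sub
    (Jet.of_contDiffAt h2 (rfle e (bv i)))).sub (hP i)).isLocalMax
      (coupling_line hm _ _)).2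
  linarith

theorem coupling_grad {f1 f2 : Euc d → ℝ} {x y : Euc d} {P : Euc d → Euc d → ℝ}
    (h1 : ContDiffAt ℝ 2 f1 x) (h2 : ContDiffAt ℝ 2 f2 y)
    (hm : ∀ᶠ z : Euc d × Euc d in 𝓝 (x, y),
      f1 z.1 - f2 z.2 - P z.1 z.2 ≤ f1 x - f2 y - P x y) (v1 v2 : Euc d) (D : ℝ)
    (hP : HasDerivAt (fun s : ℝ => P (x + s • v1) (y + s • v2)) D 0) :
    fderiv ℝ f1 x v1 - fderiv ℝ f2 y v2 = D := by
  have := (coupling_line hm v1 v2).hasDerivAt_eq_zero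
    (((Jet.of_contDiffAt h1 v1).hasDerivAt.sub (Jet.of_contDiffAt h2 v2).hasDerivAt).sub hP)
  linarith

/-- the unscaled penalty -/
noncomputable def Gp (K κ : ℝ) (x0 x y : Euc d) : ℝ :=
  K * (κ * ‖x - y‖ - κ ^ 2 * ‖x - y‖ ^ 2) + 5 * κ ^ 2 * ‖x - x0‖ ^ 2

/-- the multiplier -/
noncomputable def mp (φ : Euc d → ℝ) (N : ℝ) (x y : Euc d) : ℝ := 1 - N * (φ x + φ y)

theorem inner_rfle {e : Euc d} (v : Euc d) : v - rfle e v = (2 * inner ℝ e v) • e := by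
  simp [rfle]

theorem jet_norm {x y e : Euc d} (hxy : x ≠ y) (he : x - y = ‖x - y‖ • e) (hen : ‖e‖ = 1)
    (v : Euc d) :
    Jet (fun s : ℝ => ‖(x + s • v) - (y + s • rfle e v)‖) (2 * inner ℝ e v) 0 := by
  have hr : 0 < ‖x - y‖ := norm_pos_iff.2 (sub_ne_zero.2 hxy)
  have hj := Jet.line (‖x - y‖) (2 * inner ℝ e v)
  refine hj.congr ?_
  have hc : ContinuousAt (fun s : ℝ => ‖x - y‖ + s • (2 * inner ℝ e v)) 0 := by fun_prop
  have : ∀ᶠ s : ℝ in 𝓝 0, 0 < ‖x - y‖ + s • (2 * inner ℝ e v) := by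
    apply hc.eventually_const_lt
    simpa using hr
  filter_upwards [this] with s hs
  have : (x + s • v) - (y + s • rfle e v) = (‖x - y‖ + s • (2 * inner ℝ e v)) • e := by
    have h1 : (x + s • v) - (y + s • rfle e v) = (x - y) + s • (v - rfle e v) := by
      rw [smul_sub]; abel
    rw [h1, inner_rfle, add_smul, ← he, smul_assoc]
  rw [this, norm_smul, hen, mul_one, Real.norm_of_nonneg hs.le]

theorem jet_normsq (x x0 v : Euc d) :
    Jet (fun s : ℝ => ‖(x + s • v) - x0‖ ^ 2) (2 * inner ℝ (x - x0) v) (2 * ‖v‖ ^ 2) := by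
  have h : (fun s : ℝ => ‖(x + s • v) - x0‖ ^ 2) =
      fun s : ℝ => ‖x - x0‖ ^ 2 + (s * (2 * inner ℝ (x - x0) v) + s * s * ‖v‖ ^ 2) := by
    funext s
    have : (x + s • v) - x0 = (x - x0) + s • v := by abel
    rw [this, norm_add_sq_real, inner_smul_right, norm_smul, mul_pow]
    simp only [Real.norm_eq_abs, sq_abs]
    ring
  rw [h]
  have hid : Jet (fun s : ℝ => s) 1 0 := by simpa using Jet.line (0:ℝ) (1:ℝ)
  have := (Jet.const (‖x - x0‖ ^ 2)).add ((hid.mul (Jet.const (2 * inner ℝ (x - x0) v))).add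
    ((hid.mul hid).mul (Jet.const (‖v‖ ^ 2))))
  convert this using 1 <;> ring

theorem jet_Gp {x y e x0 : Euc d} (hxy : x ≠ y) (he : x - y = ‖x - y‖ • e) (hen : ‖e‖ = 1)
    (K κ : ℝ) (v : Euc d) :
    Jet (fun s : ℝ => Gp K κ x0 (x + s • v) (y + s • rfle e v))
      (inner ℝ ((2 * K * (κ - 2 * κ ^ 2 * ‖x - y‖)) • e + (10 * κ ^ 2) • (x - x0)) v)
      (-8 * K * κ ^ 2 * (inner ℝ e v) ^ 2 + 10 * κ ^ 2 * ‖v‖ ^ 2) := by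
  have h1 := jet_norm hxy he hen v
  have h2 := jet_normsq x x0 v
  have := (((h1.const_mul κ).sub ((h1.mul h1).const_mul (κ ^ 2))).const_mul K).add
    (h2.const_mul (5 * κ ^ 2))
  refine (show Jet _ _ _ from ?_)
  convert this using 1
  · funext s; simp only [Gp]; ring
  · simp only [inner_add_left, inner_smul_left, zero_smul, add_zero]
    simp; ring
  · simp; ring

theorem jet_mp {φ : Euc d → ℝ} {x y e : Euc d} (hx : ContDiffAt ℝ 2 φ x)
    (hy : ContDiffAt ℝ 2 φ y) (N : ℝ) (v : Euc d) :
    Jet (fun s : ℝ => mp φ N (x + s • v) (y + s • rfle e v))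
      (-N * (fderiv ℝ φ x v + fderiv ℝ φ y (rfle e v)))
      (-N * (fderiv ℝ (fderiv ℝ φ) x v v + fderiv ℝ (fderiv ℝ φ) y (rfle e v) (rfle e v))) := by
  have := (Jet.const (1:ℝ)).sub
    (((Jet.of_contDiffAt hx v).add (Jet.of_contDiffAt hy (rfle e v))).const_mul N)
  convert this using 1 <;> first | rfl | ring

theorem second_sum {φ : Euc d → ℝ} {x y e x0 : Euc d} (hx : ContDiffAt ℝ 2 φ x)
    (hy : ContDiffAt ℝ 2 φ y) (hen : ‖e‖ = 1) (K κ N M0 L0 : ℝ)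
    (hκ : 0 < κ) (hK : 0 ≤ K) (hN : 0 ≤ N) 
    (hM0x : ‖fderiv ℝ φ x‖ ≤ M0) (hM0y : ‖fderiv ℝ φ y‖ ≤ M0)
    (hL0x : |lap φ x| ≤ L0) (hL0y : |lap φ y| ≤ L0)
    (hr : κ * ‖x - y‖ ≤ 1 / 4) (hx0 : κ * ‖x - x0‖ ≤ 1)
    (hm1 : mp φ N x y ≤ 1) (hm2 : 1 / 2 ≤ mp φ N x y) :
    ∑ i, ((-N * (fderiv ℝ (fderiv ℝ φ) x (bv i) (bv i) +
          fderiv ℝ (fderiv ℝ φ) y (rfle e (bv i)) (rfle e (bv i)))) * Gp K κ x0 x y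
      + 2 * ((-N * (fderiv ℝ φ x (bv i) + fderiv ℝ φ y (rfle e (bv i)))) *
        (inner ℝ ((2 * K * (κ - 2 * κ ^ 2 * ‖x - y‖)) • e + (10 * κ ^ 2) • (x - x0)) (bv i)))
      + mp φ N x y * (-8 * K * κ ^ 2 * (inner ℝ e (bv i)) ^ 2 + 10 * κ ^ 2 * ‖bv i‖ ^ 2))
    ≤ 2 * N * (K + 5) * L0 + 8 * N * M0 * (2 * K + 10) * κ + 10 * d * κ ^ 2 - 4 * K * κ ^ 2 := by
  set Z : Euc d := (2 * K * (κ - 2 * κ ^ 2 * ‖x - y‖)) • e + (10 * κ ^ 2) • (x - x0) with hZ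
  set G := Gp K κ x0 x y with hG
  set m := mp φ N x y with hm
  have hr0 : 0 ≤ κ * ‖x - y‖ := by positivity
  have hM0 : 0 ≤ M0 := (norm_nonneg _).trans hM0x
  have hL0 : 0 ≤ L0 := (abs_nonneg _).trans hL0x
  have hZn : ‖Z‖ ≤ (2 * K + 10) * κ := by
    refine (norm_add_le _ _).trans ?_
    rw [norm_smul, norm_smul, hen, mul_one, Real.norm_eq_abs, Real.norm_eq_abs,
      abs_of_nonneg (show 0 ≤ 10 * κ ^ 2 by positivity)]
    have h1 : 0 ≤ κ - 2 * κ ^ 2 * ‖x - y‖ := by nlinarith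
    rw [abs_of_nonneg (by positivity)]
    have h2 : κ - 2 * κ ^ 2 * ‖x - y‖ ≤ κ := by nlinarith
    have h3 : 2 * K * (κ - 2 * κ ^ 2 * ‖x - y‖) ≤ 2 * K * κ := by gcongr
    nlinarith
  have hG0 : 0 ≤ G := by
    have : 0 ≤ κ * ‖x - y‖ - κ ^ 2 * ‖x - y‖ ^ 2 := by nlinarith
    rw [hG, Gp]; positivity
  have hG1 : G ≤ K + 5 := by
    have h1 : κ * ‖x - y‖ - κ ^ 2 * ‖x - y‖ ^ 2 ≤ 1 := by nlinarith
    have h2 : κ ^ 2 * ‖x - x0‖ ^ 2 ≤ 1 := by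
      rw [← mul_pow]; exact pow_le_one₀ (by positivity) hx0
    rw [hG, Gp]; nlinarith
  -- the three sums
  have s1 : ∑ i, (fderiv ℝ (fderiv ℝ φ) x (bv i) (bv i) +
          fderiv ℝ (fderiv ℝ φ) y (rfle e (bv i)) (rfle e (bv i))) = lap φ x + lap φ y := by
    rw [Finset.sum_add_distrib, sum_refl _ e hen, lap_eq hx, lap_eq hy]
  have hib : ∀ (w : Euc d) i, inner ℝ w (bv i) = w i := by
    intro w i; simp [bv, EuclideanSpace.inner_single_right]
  have lin : ∀ (ℓ : Euc d →L[ℝ] ℝ) (w : Euc d), ∑ i, ℓ (bv i) * w i = ℓ w := by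
    intro ℓ w
    conv_rhs => rw [← sum_bv w, map_sum]
    simp [mul_comm]
  have s2 : ∑ i, (fderiv ℝ φ x (bv i) + fderiv ℝ φ y (rfle e (bv i))) * inner ℝ Z (bv i)
      = fderiv ℝ φ x Z + (fderiv ℝ φ y Z - 2 * inner ℝ e Z * fderiv ℝ φ y e) := by
    have hez : inner ℝ e Z = ∑ i, e i * Z i := by
      simp [PiLp.inner_apply, mul_comm]
    rw [hez, ← lin _ Z, ← lin (fderiv ℝ φ y) Z, Finset.mul_sum, Finset.sum_mul,
      ← Finset.sum_sub_distrib, ← Finset.sum_add_distrib]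
    refine Finset.sum_congr rfl fun i _ => ?_
    simp only [rfle, hib, map_sub, map_smul, smul_eq_mul]
    ring
  have s2b : -(4 * M0 * ((2 * K + 10) * κ)) ≤
      fderiv ℝ φ x Z + (fderiv ℝ φ y Z - 2 * inner ℝ e Z * fderiv ℝ φ y e) := by
    have a1 : |fderiv ℝ φ x Z| ≤ M0 * ((2 * K + 10) * κ) :=
      ((fderiv ℝ φ x).le_opNorm Z).trans (by gcongr)
    have a2 : |fderiv ℝ φ y Z| ≤ M0 * ((2 * K + 10) * κ) :=
      ((fderiv ℝ φ y).le_opNorm Z).trans (by gcongr)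
    have a3 : |fderiv ℝ φ y e| ≤ M0 :=
      ((fderiv ℝ φ y).le_opNorm e).trans (by rw [hen, mul_one]; exact hM0y)
    have a4 : |inner ℝ e Z| ≤ (2 * K + 10) * κ :=
      (abs_real_inner_le_norm e Z).trans (by rw [hen, one_mul]; exact hZn)
    have a5 : |inner ℝ e Z * fderiv ℝ φ y e| ≤ ((2 * K + 10) * κ) * M0 := by
      rw [abs_mul]; gcongr
    have := abs_le.1 a1
    have := abs_le.1 a2
    have := abs_le.1 a5
    linarith
  have s3 : ∑ i : Fin d, (-8 * K * κ ^ 2 * (inner ℝ e (bv i)) ^ 2 + 10 * κ ^ 2 * ‖bv i‖ ^ 2)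
      = -8 * K * κ ^ 2 + 10 * d * κ ^ 2 := by
    have h3 : ∑ i, (e i) ^ 2 = 1 := by
      have := EuclideanSpace.real_norm_sq_eq e
      rw [hen] at this
      linarith
    simp only [hib, Finset.sum_add_distrib, ← Finset.mul_sum, h3]
    simp [bv]; ring
  have tot : ∀ (p q w : Fin d → ℝ), ∑ i, ((-N * p i) * G + 2 * ((-N * q i) * inner ℝ Z (bv i)) + m * w i)
      = -N * G * ∑ i, p i - 2 * N * (∑ i, q i * inner ℝ Z (bv i)) + m * ∑ i, w i := by
    intro p q w
    simp only [Finset.mul_sum, ← Finset.sum_sub_distrib, ← Finset.sum_add_distrib]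
    refine Finset.sum_congr rfl fun i _ => ?_
    ring
  rw [tot, s1, s2, s3]
  have b1 : -N * G * (lap φ x + lap φ y) ≤ 2 * N * (K + 5) * L0 := by
    have h1 := abs_le.1 hL0x
    have h2 := abs_le.1 hL0y
    have h3 : N * G * (-(lap φ x + lap φ y)) ≤ N * G * (2 * L0) := by
      apply mul_le_mul_of_nonneg_left _ (by positivity)
      linarith
    have h4 : N * G * (2 * L0) ≤ N * (K + 5) * (2 * L0) := by gcongr
    linarith
  have b2 : - 2 * N * (fderiv ℝ φ x Z + (fderiv ℝ φ y Z - 2 * inner ℝ e Z * fderiv ℝ φ y e)) ≤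
      2 * N * (4 * M0 * ((2 * K + 10) * κ)) := by
    have := mul_le_mul_of_nonneg_left s2b (show 0 ≤ 2 * N by positivity)
    linarith
  have b3 : m * (-8 * K * κ ^ 2 + 10 * d * κ ^ 2) ≤ -4 * K * κ ^ 2 + 10 * d * κ ^ 2 := by
    have h1 : 0 ≤ K * κ ^ 2 := by positivity
    have h2 : 0 ≤ d * κ ^ 2 := by positivity
    nlinarith
  linarith

end coupling

section drift
variable {d : ℕ}

theorem inner_grad (φ : Euc d → ℝ) (x v : Euc d) :
    inner ℝ (gradient φ x) v = fderiv ℝ φ x v := by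
  simp [gradient]

theorem norm_grad (φ : Euc d → ℝ) (x : Euc d) : ‖gradient φ x‖ = ‖fderiv ℝ φ x‖ := by
  simp [gradient]

theorem fderiv_grad (φ : Euc d → ℝ) (x : Euc d) :
    fderiv ℝ φ x (gradient φ x) = ‖fderiv ℝ φ x‖ ^ 2 := by
  rw [← inner_grad, real_inner_self_eq_norm_sq, norm_grad]

theorem hasDerivAt_norm_line {x y : Euc d} (hxy : x ≠ y) (v1 v2 : Euc d) :
    HasDerivAt (fun s : ℝ => ‖(x + s • v1) - (y + s • v2)‖)
      (inner ℝ (x - y) (v1 - v2) / ‖x - y‖) 0 := by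
  have hr : 0 < ‖x - y‖ := norm_pos_iff.2 (sub_ne_zero.2 hxy)
  have h := (jet_normsq (x - y) 0 (v1 - v2)).hasDerivAt
  have h2 := h.sqrt (by simp [sub_ne_zero.2 hxy])
  have e : (fun s : ℝ => ‖(x + s • v1) - (y + s • v2)‖) =
      fun s : ℝ => √(‖x - y + s • (v1 - v2) - 0‖ ^ 2) := by
    funext s
    rw [Real.sqrt_sq (norm_nonneg _)]
    congr 1
    rw [smul_sub]; abel
  rw [e]
  refine h2.congr_deriv ?_
  simp only [sub_zero, zero_smul, add_zero, Real.sqrt_sq hr.le]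
  field_simp

set_option maxHeartbeats 1000000 in
theorem drift_bound {φ : Euc d → ℝ} {x y x0 : Euc d} (hxy : x ≠ y) (hx : ContDiffAt ℝ 2 φ x)
    (hy : ContDiffAt ℝ 2 φ y) (K κ N H : ℝ)
    (hκ : 0 < κ) (hK : 0 ≤ K) (hN : 0 ≤ N) (hH : 0 ≤ H)
    (ha : 0 < φ x) (hb : 0 < φ y) (h0 : 0 < φ x0)
    (hT1 : |φ y - φ x - fderiv ℝ φ x (y - x)| ≤ H * ‖y - x‖ ^ 2)
    (hT2 : |φ x - φ y - fderiv ℝ φ y (x - y)| ≤ H * ‖x - y‖ ^ 2)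
    (hT3 : |φ x0 - φ x - fderiv ℝ φ x (x0 - x)| ≤ H * ‖x0 - x‖ ^ 2)
    (hNx : 2 * H ≤ N * ‖fderiv ℝ φ x‖ ^ 2) (hNy : 2 * H ≤ N * ‖fderiv ℝ φ y‖ ^ 2)
    (hr : κ * ‖x - y‖ ≤ 1 / 4) 
    (hm1 : mp φ N x y ≤ 1) (hm2 : 1 / 2 ≤ mp φ N x y) :
    ∃ D, HasDerivAt (fun s : ℝ =>
        mp φ N (x + s • ((2 / φ x) • gradient φ x)) (y + s • ((2 / φ y) • gradient φ y)) *
        Gp K κ x0 (x + s • ((2 / φ x) • gradient φ x)) (y + s • ((2 / φ y) • gradient φ y))) D 0 ∧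
      D ≤ 20 * κ ^ 2 := by
  set v1 := (2 / φ x) • gradient φ x with hv1
  set v2 := (2 / φ y) • gradient φ y with hv2
  have d1 : HasDerivAt (fun s : ℝ => mp φ N (x + s • v1) (y + s • v2))
      (-(N * (fderiv ℝ φ x v1 + fderiv ℝ φ y v2))) 0 := by
    have := (((Jet.of_contDiffAt hx v1).hasDerivAt.add
      (Jet.of_contDiffAt hy v2).hasDerivAt).const_mul N).const_sub 1
    exact this
  have d2 := hasDerivAt_norm_line hxy v1 v2
  have d3 := (jet_normsq x x0 v1).hasDerivAt
  have d4 : HasDerivAt (fun s : ℝ => Gp K κ x0 (x + s • v1) (y + s • v2)) _ 0 :=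
    (((d2.const_mul κ).sub ((d2.pow 2).const_mul (κ ^ 2))).const_mul K).add
      (d3.const_mul (5 * κ ^ 2))
  refine ⟨_, d1.mul d4, ?_⟩
  have hr0 : 0 < ‖x - y‖ := norm_pos_iff.2 (sub_ne_zero.2 hxy)
  simp only [zero_smul, add_zero]
  set r := ‖x - y‖ with hrdef
  set a := φ x
  set b := φ y
  set G := Gp K κ x0 x y with hG
  set m := mp φ N x y
  set δ := inner ℝ (x - y) (v1 - v2) with hδ
  set q := 1 / a + 1 / b with hq
  have hq0 : 0 < q := by positivity
  have ψ1 : 3 / 4 * (κ * r) ≤ κ * r - κ ^ 2 * r ^ 2 := by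
    have : 0 ≤ κ * r := by positivity
    nlinarith
  have hψ0 : 0 ≤ κ * r - κ ^ 2 * r ^ 2 := le_trans (by positivity) ψ1
  have hGe : G = K * (κ * r - κ ^ 2 * r ^ 2) + 5 * κ ^ 2 * ‖x - x0‖ ^ 2 := rfl
  have hG0 : 0 ≤ G := by rw [hGe]; positivity
  have hyx : ‖y - x‖ = r := norm_sub_rev _ _
  have hx0x : ‖x0 - x‖ = ‖x - x0‖ := norm_sub_rev _ _
  rw [hyx] at hT1
  rw [hx0x] at hT3
  have l1 : fderiv ℝ φ x (y - x) = - fderiv ℝ φ x (x - y) := by rw [← map_neg, neg_sub]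
  have l3 : fderiv ℝ φ x (x0 - x) = - fderiv ℝ φ x (x - x0) := by rw [← map_neg, neg_sub]
  have hδ1 : δ = 2 / a * fderiv ℝ φ x (x - y) - 2 / b * fderiv ℝ φ y (x - y) := by
    rw [hδ, inner_sub_right, hv1, hv2, inner_smul_right, inner_smul_right, real_inner_comm,
      inner_grad, real_inner_comm, inner_grad]
  have hδ2 : δ ≤ 2 * H * r ^ 2 * q := by
    have u1 : fderiv ℝ φ x (x - y) ≤ a - b + H * r ^ 2 := by
      have := abs_le.1 hT1; linarith
    have u2 : a - b - H * r ^ 2 ≤ fderiv ℝ φ y (x - y) := by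
      have := abs_le.1 hT2; linarith
    have u3 : 2 / a * fderiv ℝ φ x (x - y) ≤ 2 / a * (a - b + H * r ^ 2) := by gcongr
    have u4 : 2 / b * (a - b - H * r ^ 2) ≤ 2 / b * fderiv ℝ φ y (x - y) := by gcongr
    have u5 : 2 / a * (a - b + H * r ^ 2) - 2 / b * (a - b - H * r ^ 2)
        = 2 * H * r ^ 2 * q - 2 * (a - b) ^ 2 / (a * b) := by
      rw [hq]; field_simp; ring
    have u6 : 0 ≤ 2 * (a - b) ^ 2 / (a * b) := by positivity
    linarith
  have hδ3 : δ / r ≤ 2 * H * r * q := by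
    rw [div_le_iff₀ hr0]; linarith
  have hk : 0 ≤ κ - 2 * κ ^ 2 * r := by
    have e1 : κ - 2 * κ ^ 2 * r = κ * (1 - 2 * (κ * r)) := by ring
    rw [e1]; exact mul_nonneg hκ.le (by linarith)
  have hk2 : κ - 2 * κ ^ 2 * r ≤ κ := by
    have e1 := mul_pos (pow_pos hκ 2) hr0
    linarith
  have t1 : K * (κ - 2 * κ ^ 2 * r) * (δ / r) ≤ 4 * H * q * (K * (κ * r - κ ^ 2 * r ^ 2)) := by
    calc K * (κ - 2 * κ ^ 2 * r) * (δ / r) ≤ K * (κ - 2 * κ ^ 2 * r) * (2 * H * r * q) := by gcongr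
      _ ≤ K * κ * (2 * H * r * q) := by gcongr
      _ = (2 * H * q * K) * (κ * r) := by ring
      _ ≤ (2 * H * q * K) * (2 * (κ * r - κ ^ 2 * r ^ 2)) := by
          apply mul_le_mul_of_nonneg_left _ (by positivity)
          have : 0 ≤ κ * r := by positivity
          linarith
      _ = _ := by ring
  have t2 : 5 * κ ^ 2 * (2 * inner ℝ (x - x0) v1) ≤
      20 * κ ^ 2 + 4 * H * q * (5 * κ ^ 2 * ‖x - x0‖ ^ 2) := by
    have u0 : inner ℝ (x - x0) v1 = 2 / a * fderiv ℝ φ x (x - x0) := by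
      rw [hv1, inner_smul_right, real_inner_comm, inner_grad]
    have u1 : fderiv ℝ φ x (x - x0) ≤ a + H * ‖x - x0‖ ^ 2 := by
      have := abs_le.1 hT3; linarith
    have u2 : 2 / a * fderiv ℝ φ x (x - x0) ≤ 2 / a * (a + H * ‖x - x0‖ ^ 2) := by gcongr
    have u3 : 2 / a * (a + H * ‖x - x0‖ ^ 2) = 2 + 2 * H * ‖x - x0‖ ^ 2 * (1 / a) := by
      field_simp
    have u4 : 2 * H * ‖x - x0‖ ^ 2 * (1 / a) ≤ 2 * H * ‖x - x0‖ ^ 2 * q := by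
      gcongr
      have : 0 < 1 / b := by positivity
      linarith
    have u5 : inner ℝ (x - x0) v1 ≤ 2 + 2 * H * ‖x - x0‖ ^ 2 * q := by
      rw [u0]; linarith
    have := mul_le_mul_of_nonneg_left u5 (show 0 ≤ 10 * κ ^ 2 by positivity)
    linarith
  have t3 : 4 * H * q ≤ N * (fderiv ℝ φ x v1 + fderiv ℝ φ y v2) := by
    rw [hv1, hv2, map_smul, map_smul, fderiv_grad, fderiv_grad, smul_eq_mul, smul_eq_mul]
    have u1 := mul_le_mul_of_nonneg_left hNx (show 0 ≤ 2 / a by positivity)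
    have u2 := mul_le_mul_of_nonneg_left hNy (show 0 ≤ 2 / b by positivity)
    have u3 : 4 * H * q = 2 / a * (2 * H) + 2 / b * (2 * H) := by rw [hq]; ring
    rw [u3]; linarith
  have t4 := mul_le_mul_of_nonneg_right t3 hG0
  have t5 : K * (κ * (δ / r) - κ ^ 2 * (2 * r * (δ / r))) +
      5 * κ ^ 2 * (2 * inner ℝ (x - x0) v1) ≤ 20 * κ ^ 2 + 4 * H * q * G := by
    rw [hGe]
    have : K * (κ * (δ / r) - κ ^ 2 * (2 * r * (δ / r))) = K * (κ - 2 * κ ^ 2 * r) * (δ / r) := by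
      ring
    rw [this]; linarith
  have t6 := mul_le_mul_of_nonneg_left t5 (show 0 ≤ m by linarith)
  have t7 : m * (20 * κ ^ 2 + 4 * H * q * G) ≤ 1 * (20 * κ ^ 2 + 4 * H * q * G) := by
    gcongr
  simp only [Nat.cast_ofNat, Nat.add_one_sub_one, pow_one]
  linarith

end drift

section doubling
variable {d : ℕ}

theorem deriv_nonneg_of_left_max {g : ℝ → ℝ} {g' t a : ℝ} (hg : HasDerivAt g g' t) (hat : a < t)
    (hm : ∀ s ∈ Set.Icc a t, g s ≤ g t) : 0 ≤ g' := by
  by_contra hneg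
  push Not at hneg
  have h1 := hg.tendsto_slope
  have h2 : ∀ᶠ s in 𝓝[≠] t, slope g t s < 0 := h1.eventually (gt_mem_nhds hneg)
  have h3 : ∀ᶠ s in 𝓝[<] t, slope g t s < 0 := h2.filter_mono (nhdsWithin_mono _ (fun s hs => ne_of_lt hs))
  have h4 : ∀ᶠ s in 𝓝[<] t, s ∈ Set.Ioo a t := Ioo_mem_nhdsLT hat
  obtain ⟨s, hs, hs2⟩ := (h3.and h4).exists
  have := hm s ⟨hs2.1.le, hs2.2.le⟩
  rw [slope_def_field, div_neg_iff] at hs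
  rcases hs with hs | hs <;> linarith [hs.1, hs.2, hs2.2]

set_option maxHeartbeats 1000000 in
theorem doubling_point {φ : Euc d → ℝ} {x y x0 : Euc d} {f1 f2 : Euc d → ℝ} (hxy : x ≠ y)
    (hx : ContDiffAt ℝ 2 φ x)
    (hy : ContDiffAt ℝ 2 φ y) (h1 : ContDiffAt ℝ 2 f1 x) (h2 : ContDiffAt ℝ 2 f2 y)
    (K κ N H M0 L0 M1 : ℝ)
    (hκ : 0 < κ) (hK : 0 ≤ K) (hN : 0 ≤ N) (hH : 0 ≤ H) (hM1 : 0 < M1)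
    (ha : 0 < φ x) (hb : 0 < φ y) (h0 : 0 < φ x0)
    (hT1 : |φ y - φ x - fderiv ℝ φ x (y - x)| ≤ H * ‖y - x‖ ^ 2)
    (hT2 : |φ x - φ y - fderiv ℝ φ y (x - y)| ≤ H * ‖x - y‖ ^ 2)
    (hT3 : |φ x0 - φ x - fderiv ℝ φ x (x0 - x)| ≤ H * ‖x0 - x‖ ^ 2)
    (hNx : 2 * H ≤ N * ‖fderiv ℝ φ x‖ ^ 2) (hNy : 2 * H ≤ N * ‖fderiv ℝ φ y‖ ^ 2)
    (hM0x : ‖fderiv ℝ φ x‖ ≤ M0) (hM0y : ‖fderiv ℝ φ y‖ ≤ M0)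
    (hL0x : |lap φ x| ≤ L0) (hL0y : |lap φ y| ≤ L0)
    (hr : κ * ‖x - y‖ ≤ 1 / 4) (hx0 : κ * ‖x - x0‖ ≤ 1)
    (hm1 : mp φ N x y ≤ 1) (hm2 : 1 / 2 ≤ mp φ N x y)
    (hm : ∀ᶠ z : Euc d × Euc d in 𝓝 (x, y),
      f1 z.1 - f2 z.2 - M1 * (mp φ N z.1 z.2 * Gp K κ x0 z.1 z.2) ≤
        f1 x - f2 y - M1 * (mp φ N x y * Gp K κ x0 x y)) :
    (lap f1 x - lap f2 y) + (2 / φ x * fderiv ℝ f1 x (gradient φ x) -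
       2 / φ y * fderiv ℝ f2 y (gradient φ y)) ≤
      M1 * (2 * N * (K + 5) * L0 + 8 * N * M0 * (2 * K + 10) * κ + 10 * d * κ ^ 2 - 4 * K * κ ^ 2
        + 20 * κ ^ 2) := by
  have hr0 : 0 < ‖x - y‖ := norm_pos_iff.2 (sub_ne_zero.2 hxy)
  set e : Euc d := (1 / ‖x - y‖) • (x - y) with he
  have he1 : x - y = ‖x - y‖ • e := by
    rw [he, smul_smul, mul_one_div_cancel hr0.ne', one_smul]
  have hen : ‖e‖ = 1 := by
    rw [he, norm_smul, Real.norm_of_nonneg (by positivity), one_div_mul_cancel hr0.ne']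
  have c1 := coupling_lap (P := fun a b => M1 * (mp φ N a b * Gp K κ x0 a b)) h1 h2 hm e hen _ _
    (fun i => ((jet_mp (e := e) hx hy N (bv i)).mul (jet_Gp (x0 := x0) hxy he1 hen K κ (bv i))).const_mul M1)
  have c2 := second_sum (x0 := x0) hx hy hen K κ N M0 L0 hκ hK hN hM0x hM0y hL0x hL0y hr hx0 hm1 hm2
  rw [← Finset.mul_sum] at c1
  simp only [zero_smul, add_zero] at c1
  have c3 := c1.trans (mul_le_mul_of_nonneg_left c2 hM1.le)
  obtain ⟨D, hD, hD2⟩ := drift_bound hxy hx hy K κ N H hκ hK hN hH ha hb h0 hT1 hT2 hT3 hNx hNy hr hm1 hm2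
  have c4 := coupling_grad (P := fun a b => M1 * (mp φ N a b * Gp K κ x0 a b)) h1 h2 hm _ _ _
    (hD.const_mul M1)
  rw [map_smul, map_smul, smul_eq_mul, smul_eq_mul] at c4
  rw [c4]
  have c5 := mul_le_mul_of_nonneg_left hD2 hM1.le
  linarith

set_option maxHeartbeats 2000000 in
theorem doubling {φ : Euc d → ℝ} {V Kc : Set (Euc d)} {x0 : Euc d} {w1 w2 : ℝ → Euc d → ℝ}
    (K κ N H M0 L0 M1 C0 t0 : ℝ)
    (hV : IsOpen V) (hKV : Kc ⊆ V) (hKc : IsCompact Kc) (hx0 : x0 ∈ V)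
    (hφ : ∀ x ∈ V, ContDiffAt ℝ 2 φ x) (hφ0 : ∀ x ∈ V, 0 < φ x)
    (hκ : 0 < κ) (hK : 32 ≤ K) (hN : 0 ≤ N) (hH : 0 ≤ H) (hM1 : 0 < M1)
    (hT : ∀ x ∈ V, ∀ y ∈ V, |φ y - φ x - fderiv ℝ φ x (y - x)| ≤ H * ‖y - x‖ ^ 2)
    (hNx : ∀ x ∈ V, 2 * H ≤ N * ‖fderiv ℝ φ x‖ ^ 2)
    (hNφ : ∀ x ∈ V, N * φ x ≤ 1 / 4)
    (hM0 : ∀ x ∈ V, ‖fderiv ℝ φ x‖ ≤ M0)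
    (hL0 : ∀ x ∈ V, |lap φ x| ≤ L0)
    (h1 : ∀ t ∈ Set.Ioc (t0 - 1 / (2 * κ ^ 2)) t0, ∀ x ∈ V, ContDiffAt ℝ 2 (w1 t) x)
    (h2 : ∀ t ∈ Set.Ioc (t0 - 1 / (2 * κ ^ 2)) t0, ∀ x ∈ V, ContDiffAt ℝ 2 (w2 t) x)
    (hd1 : ∀ t ∈ Set.Ioc (t0 - 1 / (2 * κ ^ 2)) t0, ∀ x ∈ V, HasDerivAt (fun s => w1 s x)
      (lap (w1 t) x + 2 / φ x * fderiv ℝ (w1 t) x (gradient φ x) + lap φ x / φ x * w1 t x) t)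
    (hd2 : ∀ t ∈ Set.Ioc (t0 - 1 / (2 * κ ^ 2)) t0, ∀ x ∈ V, HasDerivAt (fun s => w2 s x)
      (lap (w2 t) x + 2 / φ x * fderiv ℝ (w2 t) x (gradient φ x) + lap φ x / φ x * w2 t x) t)
    (hosc : ∀ t ∈ Set.Icc (t0 - 1 / (2 * κ ^ 2)) t0, ∀ x ∈ V, ∀ y ∈ V,
      ‖x - x0‖ ≤ 1 / κ → ‖x - y‖ ≤ 1 / (4 * κ) → w1 t x - w2 t y ≤ 2 * M1)
    (hc : ∀ t ∈ Set.Icc (t0 - 1 / (2 * κ ^ 2)) t0, ∀ x ∈ V, ∀ y ∈ V,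
      ‖x - x0‖ ≤ 1 / κ → ‖x - y‖ ≤ 1 / (4 * κ) → 0 < w1 t x - w2 t y →
      lap φ x / φ x * w1 t x - lap φ y / φ y * w2 t y ≤ 2 * C0 * M1)
    (hout : ∀ t ∈ Set.Icc (t0 - 1 / (2 * κ ^ 2)) t0, ∀ x ∈ V, ∀ y ∈ V,
      ‖x - x0‖ ≤ 1 / κ → ‖x - y‖ ≤ 1 / (4 * κ) → (x ∉ Kc ∨ y ∉ Kc) → w1 t x - w2 t y ≤ 0)
    (hdiag : ∀ t ∈ Set.Icc (t0 - 1 / (2 * κ ^ 2)) t0, ∀ x ∈ V, w1 t x ≤ w2 t x)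
    (hc1 : ContinuousOn (fun q : ℝ × Euc d => w1 q.1 q.2) (Set.Icc (t0 - 1 / (2 * κ ^ 2)) t0 ×ˢ Kc))
    (hc2 : ContinuousOn (fun q : ℝ × Euc d => w2 q.1 q.2) (Set.Icc (t0 - 1 / (2 * κ ^ 2)) t0 ×ˢ Kc))
    (hneg : 2 * N * (K + 5) * L0 + 8 * N * M0 * (2 * K + 10) * κ + (10 * d + 25) * κ ^ 2 + 2 * C0
      < 4 * K * κ ^ 2) :
    ∀ y ∈ V, ‖x0 - y‖ ≤ 1 / (4 * κ) → w1 t0 x0 - w2 t0 y ≤ M1 * K * κ * ‖x0 - y‖ := by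
  intro y0 hy0 hxy0
  set a0 := t0 - 1 / (2 * κ ^ 2) with ha0
  have ha0t : a0 < t0 := by
    have : 0 < 1 / (2 * κ ^ 2) := by positivity
    linarith
  have ht0 : t0 ∈ Set.Icc a0 t0 := ⟨ha0t.le, le_rfl⟩
  by_contra hcon
  push Not at hcon
  have hpos0 : 0 ≤ M1 * K * κ * ‖x0 - y0‖ := by positivity
  have hx0K : x0 ∈ Kc ∧ y0 ∈ Kc := by
    by_contra h
    rw [not_and_or] at h
    have := hout t0 ht0 x0 hx0 y0 hy0 (by simp; positivity) hxy0 h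
    linarith
  -- facts on mp, Gp
  have hmp : ∀ x ∈ V, ∀ y ∈ V, mp φ N x y ≤ 1 ∧ 1 / 2 ≤ mp φ N x y := by
    intro x hx y hy
    have p1 := mul_nonneg hN (hφ0 x hx).le
    have p2 := mul_nonneg hN (hφ0 y hy).le
    have p3 := hNφ x hx
    have p4 := hNφ y hy
    constructor <;> simp only [mp] <;> linarith
  have hψ : ∀ x y : Euc d, ‖x - y‖ ≤ 1 / (4 * κ) →
      κ * ‖x - y‖ ≤ 1 / 4 ∧ 3 / 4 * (κ * ‖x - y‖) ≤ κ * ‖x - y‖ - κ ^ 2 * ‖x - y‖ ^ 2 := by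
    intro x y h
    have q1 : κ * ‖x - y‖ ≤ 1 / 4 := by
      calc κ * ‖x - y‖ ≤ κ * (1 / (4 * κ)) := by gcongr
        _ = 1 / 4 := by field_simp
    refine ⟨q1, ?_⟩
    have q0 : 0 ≤ κ * ‖x - y‖ := by positivity
    nlinarith
  have hGp : ∀ x y : Euc d, ‖x - y‖ ≤ 1 / (4 * κ) → K * (3 / 4 * (κ * ‖x - y‖)) + 5 * κ ^ 2 * ‖x - x0‖ ^ 2
      ≤ Gp K κ x0 x y := by
    intro x y h
    have := mul_le_mul_of_nonneg_left (hψ x y h).2 (show 0 ≤ K by linarith)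
    simp only [Gp]
    linarith
  have hGp0 : ∀ x y : Euc d, ‖x - y‖ ≤ 1 / (4 * κ) → 0 ≤ Gp K κ x0 x y := by
    intro x y h
    refine le_trans ?_ (hGp x y h)
    positivity
  let Φ : ℝ × Euc d × Euc d → ℝ := fun q => w1 q.1 q.2.1 - w2 q.1 q.2.2 -
    M1 * (mp φ N q.2.1 q.2.2 * Gp K κ x0 q.2.1 q.2.2) - M1 * (5 * κ ^ 2 * (t0 - q.1))
  let Q : Set (ℝ × Euc d × Euc d) := (Set.Icc a0 t0 ×ˢ Kc ×ˢ Kc) ∩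
    {q | ‖q.2.1 - x0‖ ≤ 1 / κ ∧ ‖q.2.1 - q.2.2‖ ≤ 1 / (4 * κ)}
  have hQc : IsCompact Q := by
    refine (isCompact_Icc.prod (hKc.prod hKc)).inter_right ?_
    exact (isClosed_le (f := fun q : ℝ × Euc d × Euc d => ‖q.2.1 - x0‖) (g := fun _ => 1 / κ)
      (by fun_prop) (by fun_prop)).inter
      (isClosed_le (f := fun q : ℝ × Euc d × Euc d => ‖q.2.1 - q.2.2‖) (g := fun _ => 1 / (4 * κ))
        (by fun_prop) (by fun_prop))
  have hφc : ContinuousOn φ Kc := fun x hx => (hφ x (hKV hx)).continuousAt.continuousWithinAt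
  have hΦc : ContinuousOn Φ Q := by
    have k1 : ContinuousOn (fun q : ℝ × Euc d × Euc d => w1 q.1 q.2.1) Q :=
      hc1.comp (f := fun q : ℝ × Euc d × Euc d => (q.1, q.2.1)) (by fun_prop)
        (fun q hq => ⟨hq.1.1, hq.1.2.1⟩)
    have k2 : ContinuousOn (fun q : ℝ × Euc d × Euc d => w2 q.1 q.2.2) Q :=
      hc2.comp (f := fun q : ℝ × Euc d × Euc d => (q.1, q.2.2)) (by fun_prop)
        (fun q hq => ⟨hq.1.1, hq.1.2.2⟩)
    have k3 : ContinuousOn (fun q : ℝ × Euc d × Euc d => φ q.2.1) Q :=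
      hφc.comp (f := fun q : ℝ × Euc d × Euc d => q.2.1) (by fun_prop) (fun q hq => hq.1.2.1)
    have k4 : ContinuousOn (fun q : ℝ × Euc d × Euc d => φ q.2.2) Q :=
      hφc.comp (f := fun q : ℝ × Euc d × Euc d => q.2.2) (by fun_prop) (fun q hq => hq.1.2.2)
    have k5 : ContinuousOn (fun q : ℝ × Euc d × Euc d => mp φ N q.2.1 q.2.2) Q := by
      simp only [mp]
      exact continuousOn_const.sub (continuousOn_const.mul (k3.add k4))
    have k6 : Continuous (fun q : ℝ × Euc d × Euc d => Gp K κ x0 q.2.1 q.2.2) := by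
      simp only [Gp]; fun_prop
    exact ((k1.sub k2).sub (continuousOn_const.mul (k5.mul k6.continuousOn))).sub
      (by fun_prop)
  have hQ0 : (t0, x0, y0) ∈ Q := ⟨⟨ht0, hx0K.1, hx0K.2⟩, by simp; positivity, hxy0⟩
  obtain ⟨⟨t, x, y⟩, hq, hmax⟩ := hQc.exists_isMaxOn ⟨_, hQ0⟩ hΦc
  have hΦ0 : 0 < Φ (t0, x0, y0) := by
    have e1 := (hmp x0 hx0 y0 hy0)
    have e2 : mp φ N x0 y0 * Gp K κ x0 x0 y0 ≤ K * κ * ‖x0 - y0‖ := by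
      calc mp φ N x0 y0 * Gp K κ x0 x0 y0 ≤ 1 * Gp K κ x0 x0 y0 := by
            exact mul_le_mul_of_nonneg_right e1.1 (hGp0 _ _ hxy0)
        _ = K * (κ * ‖x0 - y0‖) - K * (κ ^ 2 * ‖x0 - y0‖ ^ 2) := by simp [Gp]; ring
        _ ≤ K * κ * ‖x0 - y0‖ := by
          have : 0 ≤ K * (κ ^ 2 * ‖x0 - y0‖ ^ 2) := by positivity
          linarith
    have e3 := mul_le_mul_of_nonneg_left e2 hM1.le
    simp only [Φ]
    linarith
  have hΦp : 0 < Φ (t, x, y) := lt_of_lt_of_le hΦ0 (hmax hQ0)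
  obtain ⟨⟨htI, hxK, hyK⟩, hxx0, hxy⟩ := hq
  simp only at htI hxK hyK hxx0 hxy
  have hxV := hKV hxK
  have hyV := hKV hyK
  have hm12 := hmp x hxV y hyV
  have hGG := hGp x y hxy
  have hG0 := hGp0 x y hxy
  have hosc' := hosc t htI x hxV y hyV hxx0 hxy
  have hmG : 1 / 2 * Gp K κ x0 x y ≤ mp φ N x y * Gp K κ x0 x y :=
    mul_le_mul_of_nonneg_right hm12.2 hG0
  have hΦe : Φ (t, x, y) = w1 t x - w2 t y - M1 * (mp φ N x y * Gp K κ x0 x y) -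
    M1 * (5 * κ ^ 2 * (t0 - t)) := rfl
  rw [hΦe] at hΦp
  have htime0 : 0 ≤ 5 * κ ^ 2 * (t0 - t) := mul_nonneg (by positivity) (by linarith [htI.2])
  have hlt : mp φ N x y * Gp K κ x0 x y + 5 * κ ^ 2 * (t0 - t) < 2 := by
    have : M1 * (mp φ N x y * Gp K κ x0 x y + 5 * κ ^ 2 * (t0 - t)) < M1 * 2 := by linarith
    exact lt_of_mul_lt_mul_left this hM1.le
  have hKr : 0 ≤ K * (3 / 4 * (κ * ‖x - y‖)) := by positivity
  have hKx : 0 ≤ 5 * κ ^ 2 * ‖x - x0‖ ^ 2 := by positivity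
  have hta : a0 < t := by
    rcases htI.1.lt_or_eq with h | h
    · exact h
    · exfalso
      have : 5 * κ ^ 2 * (t0 - t) = 5 / 2 := by
        rw [← h, ha0]; field_simp; ring
      linarith
  have hxs : ‖x - x0‖ < 1 / κ := by
    rcases hxx0.lt_or_eq with h | h
    · exact h
    · exfalso
      have : 5 * κ ^ 2 * ‖x - x0‖ ^ 2 = 5 := by rw [h]; field_simp
      linarith
  have hxys : ‖x - y‖ < 1 / (4 * κ) := by
    rcases hxy.lt_or_eq with h | h
    · exact h
    · exfalso
      have : κ * ‖x - y‖ = 1 / 4 := by rw [h]; field_simp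
      rw [this] at hGG
      linarith
  have hdpos : 0 < w1 t x - w2 t y := by
    have : 0 ≤ M1 * (mp φ N x y * Gp K κ x0 x y) := by
      apply mul_nonneg hM1.le; linarith
    have := mul_nonneg hM1.le htime0
    linarith
  have hne : x ≠ y := by
    rintro rfl
    have := hdiag t htI x hxV
    linarith
  have htIoc : t ∈ Set.Ioc a0 t0 := ⟨hta, htI.2⟩
  -- space maximum
  have hlm : ∀ᶠ z : Euc d × Euc d in 𝓝 (x, y),
      w1 t z.1 - w2 t z.2 - M1 * (mp φ N z.1 z.2 * Gp K κ x0 z.1 z.2) ≤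
        w1 t x - w2 t y - M1 * (mp φ N x y * Gp K κ x0 x y) := by
    have o1 : ∀ᶠ z : Euc d × Euc d in 𝓝 (x, y), z.1 ∈ V :=
      (continuous_fst.tendsto (x, y)).eventually (hV.mem_nhds hxV)
    have o2 : ∀ᶠ z : Euc d × Euc d in 𝓝 (x, y), z.2 ∈ V :=
      (continuous_snd.tendsto (x, y)).eventually (hV.mem_nhds hyV)
    have o3 : ∀ᶠ z : Euc d × Euc d in 𝓝 (x, y), ‖z.1 - x0‖ < 1 / κ :=
      (isOpen_lt (f := fun z : Euc d × Euc d => ‖z.1 - x0‖) (by fun_prop) (by fun_prop)).mem_nhds hxs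
    have o4 : ∀ᶠ z : Euc d × Euc d in 𝓝 (x, y), ‖z.1 - z.2‖ < 1 / (4 * κ) :=
      (isOpen_lt (f := fun z : Euc d × Euc d => ‖z.1 - z.2‖) (by fun_prop) (by fun_prop)).mem_nhds hxys
    filter_upwards [o1, o2, o3, o4] with z p1 p2 p3 p4
    by_cases hz : z.1 ∈ Kc ∧ z.2 ∈ Kc
    · have := hmax (show (t, z.1, z.2) ∈ Q from ⟨⟨htI, hz.1, hz.2⟩, p3.le, p4.le⟩)
      simp only [Φ, Set.mem_ofPred_eq] at this
      linarith
    · rw [not_and_or] at hz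
      have q1 := hout t htI z.1 p1 z.2 p2 p3.le p4.le hz
      have q2 := mul_nonneg hM1.le (mul_nonneg (show 0 ≤ mp φ N z.1 z.2 by
        linarith [(hmp z.1 p1 z.2 p2).2]) (hGp0 z.1 z.2 p4.le))
      have := mul_nonneg hM1.le htime0
      linarith
  have hpt := doubling_point hne (hφ x hxV) (hφ y hyV) (h1 t htIoc x hxV) (h2 t htIoc y hyV)
    K κ N H M0 L0 M1 hκ (by linarith) hN hH hM1 (hφ0 x hxV) (hφ0 y hyV) (hφ0 x0 hx0)
    (hT x hxV y hyV) (hT y hyV x hxV) (hT x hxV x0 hx0) (hNx x hxV) (hNx y hyV)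
    (hM0 x hxV) (hM0 y hyV) (hL0 x hxV) (hL0 y hyV) (hψ x y hxy).1
    (by calc κ * ‖x - x0‖ ≤ κ * (1 / κ) := by gcongr
          _ = 1 := by field_simp)
    hm12.1 hm12.2 hlm
  -- time
  have hder : HasDerivAt (fun s => Φ (s, x, y)) _ t :=
    (((hd1 t htIoc x hxV).sub (hd2 t htIoc y hyV)).sub_const (M1 * (mp φ N x y * Gp K κ x0 x y))).sub
      ((((hasDerivAt_id t).const_sub t0).const_mul (5 * κ ^ 2)).const_mul M1)
  have htn := deriv_nonneg_of_left_max hder hta (fun s hs => hmax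
    (show (s, x, y) ∈ Q from ⟨⟨⟨hs.1, hs.2.trans htI.2⟩, hxK, hyK⟩, hxx0, hxy⟩))
  have hcc := hc t htI x hxV y hyV hxx0 hxy hdpos
  have hfin := mul_lt_mul_of_pos_left hneg hM1
  linarith

end doubling

section interior
variable {d : ℕ}

/-- Local classical solution of the heat equation. -/
structure HeatOn (u : ℝ → Euc d → ℝ) (V : Set (Euc d)) (a b : ℝ) : Prop where
  smooth : ∀ t ∈ Set.Ioc a b, ∀ x ∈ V, ContDiffAt ℝ 2 (u t) x
  eqn : ∀ t ∈ Set.Ioc a b, ∀ x ∈ V, HasDerivAt (fun s => u s x) (lap (u t) x) t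
  cont : ContinuousOn (fun q : ℝ × Euc d => u q.1 q.2) (Set.Icc a b ×ˢ V)

theorem HeatOn.mono {u : ℝ → Euc d → ℝ} {V W : Set (Euc d)} {a b a' b' : ℝ} (h : HeatOn u V a b)
    (hW : W ⊆ V) (ha : a ≤ a') (hb : b' ≤ b) : HeatOn u W a' b' :=
  ⟨fun t ht x hx => h.smooth t ⟨ha.trans_lt ht.1, ht.2.trans hb⟩ x (hW hx),
   fun t ht x hx => h.eqn t ⟨ha.trans_lt ht.1, ht.2.trans hb⟩ x (hW hx),
   h.cont.mono (Set.prod_mono (Set.Icc_subset_Icc ha hb) hW)⟩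

theorem lap_of_jets {f : Euc d → ℝ} {x : Euc d} (hf : ContDiffAt ℝ 2 f x) {A S : Fin d → ℝ}
    (h : ∀ i, Jet (fun s : ℝ => f (x + s • bv i)) (A i) (S i)) : lap f x = ∑ i, S i := by
  rw [lap_eq hf]
  exact Finset.sum_congr rfl fun i _ => ((Jet.of_contDiffAt hf (bv i)).unique (h i)).2

theorem lap_sub {f g : Euc d → ℝ} {x : Euc d} (hf : ContDiffAt ℝ 2 f x) (hg : ContDiffAt ℝ 2 g x) :
    lap (fun y => f y - g y) x = lap f x - lap g x := by
  rw [lap_of_jets (hf.sub hg)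
    (fun i => (Jet.of_contDiffAt hf (bv i)).sub (Jet.of_contDiffAt hg (bv i))), lap_eq hf, lap_eq hg,
    Finset.sum_sub_distrib]

theorem lap_translate (f : Euc d → ℝ) (h x : Euc d) :
    lap (fun y => f (y + h)) x = lap f (x + h) := by
  have e1 : ∀ (i : Fin d) (g : Euc d → ℝ), pd i (fun y => g (y + h)) = fun y => pd i g (y + h) := by
    intro i g
    funext y
    simp only [pd]
    rw [fderiv_comp_add_right]
  simp only [lap, e1]

theorem contDiffAt_translate {f : Euc d → ℝ} {h x : Euc d} {n : WithTop ℕ∞}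
    (hf : ContDiffAt ℝ n f (x + h)) :
    ContDiffAt ℝ n (fun y => f (y + h)) x :=
  ContDiffAt.comp x hf (contDiffAt_id.add contDiffAt_const)

theorem HeatOn.diff {u : ℝ → Euc d → ℝ} {V W : Set (Euc d)} {a b : ℝ} {h : Euc d}
    (hu : HeatOn u V a b) (hW : W ⊆ V) (hWh : ∀ x ∈ W, x + h ∈ V) :
    HeatOn (fun t x => u t (x + h) - u t x) W a b := by
  refine ⟨fun t ht x hx => ?_, fun t ht x hx => ?_, ?_⟩
  · exact (contDiffAt_translate (hu.smooth t ht _ (hWh x hx))).sub (hu.smooth t ht x (hW hx))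
  · have h1 := hu.smooth t ht _ (hWh x hx)
    have h2 := hu.smooth t ht x (hW hx)
    have := (hu.eqn t ht _ (hWh x hx)).sub (hu.eqn t ht x (hW hx))
    rw [lap_sub (f := fun y => u t (y + h)) (contDiffAt_translate h1) h2, lap_translate]
    exact this
  · have k1 : ContinuousOn (fun q : ℝ × Euc d => u q.1 (q.2 + h)) (Set.Icc a b ×ˢ W) :=
      hu.cont.comp (f := fun q : ℝ × Euc d => (q.1, q.2 + h)) (by fun_prop)
        (fun q hq => ⟨hq.1, hWh _ hq.2⟩)
    exact k1.sub (hu.cont.mono (Set.prod_mono le_rfl hW))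

theorem norm_fderiv_le_of_oneside {f : Euc d → ℝ} {x0 : Euc d} {C : ℝ} (hC : 0 ≤ C)
    (hf : DifferentiableAt ℝ f x0) (h : ∀ᶠ y in 𝓝 x0, f x0 - f y ≤ C * ‖x0 - y‖) :
    ‖fderiv ℝ f x0‖ ≤ C := by
  refine le_of_forall_pos_le_add fun c hc => ?_
  have h1 := (hasFDerivAt_iff_isLittleO_nhds_zero.1 hf.hasFDerivAt).bound hc
  have h2 : ∀ᶠ z in 𝓝 (0 : Euc d), f x0 - f (x0 + z) ≤ C * ‖z‖ := by
    have ht : Tendsto (fun z : Euc d => x0 + z) (𝓝 0) (𝓝 x0) := by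
      have : ContinuousAt (fun z : Euc d => x0 + z) 0 := by fun_prop
      simpa using this.tendsto
    filter_upwards [ht.eventually h] with z hz
    simpa using hz
  have h3 : ∀ᶠ z in 𝓝 (0 : Euc d), - (C + c) * ‖z‖ ≤ fderiv ℝ f x0 z := by
    filter_upwards [h1, h2] with z p q
    rw [Real.norm_eq_abs] at p
    have := (abs_le.1 p).2
    linarith
  have h4 : ∀ᶠ z in 𝓝 (0 : Euc d), - (C + c) * ‖z‖ ≤ fderiv ℝ f x0 (-z) := by
    have ht : Tendsto (fun z : Euc d => -z) (𝓝 0) (𝓝 0) := by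
      have : ContinuousAt (fun z : Euc d => -z) 0 := by fun_prop
      simpa using this.tendsto
    filter_upwards [ht.eventually h3] with z hz
    simpa using hz
  refine ContinuousLinearMap.opNorm_le_of_nhds_zero (by positivity) ?_
  filter_upwards [h3, h4] with z p q
  rw [map_neg] at q
  rw [Real.norm_eq_abs, abs_le]
  constructor <;> linarith

theorem interior_grad {u : ℝ → Euc d → ℝ} {x0 : Euc d} {t0 σ M1 : ℝ} (hσ : 0 < σ) (hM1 : 0 < M1)
    (hu : HeatOn u (Metric.ball x0 (2 * σ)) (t0 - σ ^ 2 / 2) t0)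
    (hosc : ∀ t ∈ Set.Icc (t0 - σ ^ 2 / 2) t0, ∀ x ∈ Metric.ball x0 (2 * σ),
      ∀ y ∈ Metric.ball x0 (2 * σ), u t x - u t y ≤ 2 * M1) :
    ‖fderiv ℝ (u t0) x0‖ ≤ (32 + 10 * d) * M1 / σ := by
  have hκ : t0 - 1 / (2 * (1 / σ) ^ 2) = t0 - σ ^ 2 / 2 := by field_simp
  have hx0 : x0 ∈ Metric.ball x0 (2 * σ) := Metric.mem_ball_self (by positivity)
  have ht0 : t0 ∈ Set.Ioc (t0 - σ ^ 2 / 2) t0 := ⟨by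
    have : 0 < σ ^ 2 / 2 := by positivity
    linarith, le_rfl⟩
  have hKV : Metric.closedBall x0 (5 * σ / 4) ⊆ Metric.ball x0 (2 * σ) :=
    Metric.closedBall_subset_ball (by linarith)
  have hlap : ∀ x : Euc d, lap (fun _ => (1:ℝ)) x = 0 := by
    intro x
    have e : ∀ i : Fin d, pd i (fun _ : Euc d => (1:ℝ)) = fun _ => 0 := by
      intro i; funext y; simp [pd]
    simp only [lap, e]
    simp [pd]
  have hgr : ∀ x : Euc d, gradient (fun _ : Euc d => (1:ℝ)) x = 0 := by
    intro x; simp [gradient]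
  have key := doubling (φ := fun _ => (1:ℝ)) (V := Metric.ball x0 (2 * σ))
    (Kc := Metric.closedBall x0 (5 * σ / 4)) (x0 := x0) (w1 := u) (w2 := u) (32 + 10 * d) (1 / σ) 0 0 0 0 M1 0 t0
    Metric.isOpen_ball hKV (isCompact_closedBall _ _) hx0
    (fun x _ => contDiffAt_const) (fun x _ => one_pos) (by positivity)
    (by have : (0:ℝ) ≤ d := by positivity
        linarith) le_rfl le_rfl hM1 (by simp) (by simp) (by simp) (by simp) (by simp [hlap])
    (by rw [hκ]; exact hu.smooth) (by rw [hκ]; exact hu.smooth)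
    (by rw [hκ]; simpa [hlap, hgr] using hu.eqn) (by rw [hκ]; simpa [hlap, hgr] using hu.eqn)
    (by rw [hκ]; intro t ht x hx y hy _ _; exact hosc t ht x hx y hy)
    (by simp [hlap])
    (by
      intro t _ x _ y _ h1 h2 h3
      exfalso
      have e1 : 1 / (1 / σ) = σ := by simp
      have e2 : 1 / (4 * (1 / σ)) = σ / 4 := by field_simp
      rw [e1] at h1; rw [e2] at h2
      have : ‖y - x0‖ ≤ ‖x - x0‖ + ‖x - y‖ := by
        have : y - x0 = (x - x0) - (x - y) := by abel
        rw [this]; exact norm_sub_le _ _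
      rcases h3 with h | h
      · exact h (by rw [mem_closedBall_iff_norm]; linarith)
      · exact h (by rw [mem_closedBall_iff_norm]; linarith))
    (fun t _ x _ => le_rfl)
    (by rw [hκ]; exact hu.cont.mono (Set.prod_mono le_rfl hKV))
    (by rw [hκ]; exact hu.cont.mono (Set.prod_mono le_rfl hKV))
    (by
      have h1 : 0 < (1 / σ) ^ 2 := by positivity
      have h2 : (0:ℝ) ≤ d := by positivity
      have h3 := mul_nonneg h2 h1.le
      nlinarith)
  refine norm_fderiv_le_of_oneside (by positivity)
    ((hu.smooth t0 ht0 x0 hx0).differentiableAt (by norm_num)) ?_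
  have hb : Metric.ball x0 (1 / (4 * (1 / σ))) ∈ 𝓝 x0 := Metric.ball_mem_nhds _ (by positivity)
  filter_upwards [hb, Metric.ball_mem_nhds x0 (show 0 < 2 * σ by positivity)] with y hy hy2
  have := key y hy2 (by rw [← dist_eq_norm, dist_comm]; exact (Metric.mem_ball.1 hy).le)
  refine this.trans (le_of_eq ?_)
  ring

theorem interior_hess {u : ℝ → Euc d → ℝ} {x0 : Euc d} {t0 δ A : ℝ} (hδ : 0 < δ) (hA : 0 < A)
    (hu : HeatOn u (Metric.ball x0 (3 * δ)) (t0 - δ ^ 2 / 2) t0)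
    (hosc : ∀ t ∈ Set.Ioc (t0 - δ ^ 2 / 2) t0, ∀ x ∈ Metric.ball x0 (3 * δ),
      ∀ y ∈ Metric.ball x0 (3 * δ), ‖fderiv ℝ (u t) x - fderiv ℝ (u t) y‖ ≤ 2 * A) :
    ‖fderiv ℝ (fderiv ℝ (u t0)) x0‖ ≤ (32 + 10 * d) * A / δ := by
  have ht0 : t0 ∈ Set.Ioc (t0 - δ ^ 2 / 2) t0 := ⟨by
    have : 0 < δ ^ 2 / 2 := by positivity
    linarith, le_rfl⟩
  refine norm_fderiv_le_of_lip' ℝ (by positivity) ?_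
  filter_upwards [Metric.ball_mem_nhds x0 hδ] with y hy
  rcases eq_or_ne y x0 with rfl | hne
  · simp
  set h := y - x0 with hh
  have hh0 : 0 < ‖h‖ := norm_pos_iff.2 (sub_ne_zero.2 hne)
  have hhδ : ‖h‖ < δ := by rw [hh, ← dist_eq_norm]; exact hy
  have hin : ∀ x ∈ Metric.ball x0 (2 * δ), ∀ θ ∈ Set.Icc (0:ℝ) 1, x + θ • h ∈ Metric.ball x0 (3 * δ) := by
    intro x hx θ hθ
    rw [mem_ball_iff_norm] at hx ⊢
    have : x + θ • h - x0 = (x - x0) + θ • h := by abel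
    rw [this]
    refine (norm_add_le _ _).trans_lt ?_
    rw [norm_smul, Real.norm_of_nonneg hθ.1]
    have : θ * ‖h‖ ≤ 1 * ‖h‖ := mul_le_mul_of_nonneg_right hθ.2 hh0.le
    linarith
  have hsub : Metric.ball x0 (2 * δ) ⊆ Metric.ball x0 (3 * δ) := Metric.ball_subset_ball (by linarith)
  have hin1 : ∀ x ∈ Metric.ball x0 (2 * δ), x + h ∈ Metric.ball x0 (3 * δ) := by
    intro x hx
    simpa using hin x hx 1 (by simp)
  have hv := hu.diff (h := h) hsub hin1
  have hoscIoc : ∀ t ∈ Set.Ioc (t0 - δ ^ 2 / 2) t0, ∀ x ∈ Metric.ball x0 (2 * δ),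
      ∀ z ∈ Metric.ball x0 (2 * δ), (u t (x + h) - u t x) - (u t (z + h) - u t z) ≤ 2 * (A * ‖h‖) := by
    intro t ht x hx z hz
    have hd : ∀ w ∈ Metric.ball x0 (2 * δ), ∀ θ ∈ Set.Icc (0:ℝ) 1,
        HasDerivAt (fun θ : ℝ => u t (w + θ • h)) (fderiv ℝ (u t) (w + θ • h) h) θ := by
      intro w hw θ hθ
      have e1 := ((hu.smooth t ht _ (hin w hw θ hθ)).differentiableAt (by norm_num)).hasFDerivAt
      have e2 : HasDerivAt (fun θ : ℝ => w + θ • h) h θ := by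
        simpa using ((hasDerivAt_id θ).smul_const h).const_add w
      exact e1.comp_hasDerivAt θ e2
    have := norm_image_sub_le_of_norm_deriv_le_segment_01'
      (f := fun θ : ℝ => u t (x + θ • h) - u t (z + θ • h)) (C := 2 * A * ‖h‖)
      (fun θ hθ => ((hd x hx θ hθ).sub (hd z hz θ hθ)).hasDerivWithinAt)
      (fun θ hθ => by
        have hθ' : θ ∈ Set.Icc (0:ℝ) 1 := ⟨hθ.1, hθ.2.le⟩
        rw [← sub_apply]
        refine (ContinuousLinearMap.le_opNorm _ _).trans ?_
        exact mul_le_mul_of_nonneg_right (hosc t ht _ (hin x hx θ hθ') _ (hin z hz θ hθ')) hh0.le)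
    simp only [one_smul, zero_smul, add_zero] at this
    have := (abs_le.1 ((Real.norm_eq_abs _) ▸ this)).2
    linarith
  have key := interior_grad hδ (mul_pos hA hh0) hv (by
    intro t ht x hx z hz
    rcases ht.1.lt_or_eq with h' | h'
    · exact hoscIoc t ⟨h', ht.2⟩ x hx z hz
    · -- closure at the initial time
      have hc : ∀ w ∈ Metric.ball x0 (2 * δ), ContinuousWithinAt (fun s => u s (w + h) - u s w)
          (Set.Icc (t0 - δ ^ 2 / 2) t0) t := by
        intro w hw
        have := (hv.cont (t, w) ⟨ht, hw⟩)
        exact ContinuousWithinAt.comp (f := fun s : ℝ => (s, w))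
          (g := fun q : ℝ × Euc d => u q.1 (q.2 + h) - u q.1 q.2) this (by fun_prop)
          (fun s hs => ⟨hs, hw⟩)
      have hc2 := ((hc x hx).sub (hc z hz)).mono (Set.Ioc_subset_Icc_self)
      have hcl : t ∈ closure (Set.Ioc (t0 - δ ^ 2 / 2) t0) := by
        rw [closure_Ioc (by have := ht0.1; exact this.ne)]
        exact ht
      haveI : (𝓝[Set.Ioc (t0 - δ ^ 2 / 2) t0] t).NeBot := mem_closure_iff_nhdsWithin_neBot.1 hcl
      refine le_of_tendsto hc2.tendsto ?_
      filter_upwards [self_mem_nhdsWithin] with s hs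
      exact hoscIoc s hs x hx z hz)
  have hy3 : y ∈ Metric.ball x0 (3 * δ) := Metric.ball_subset_ball (by linarith) hy
  have hx3 : x0 ∈ Metric.ball x0 (3 * δ) := Metric.mem_ball_self (by positivity)
  have hxh : x0 + h = y := by rw [hh]; abel
  have e : fderiv ℝ (fun x => u t0 (x + h) - u t0 x) x0 = fderiv ℝ (u t0) y - fderiv ℝ (u t0) x0 := by
    have d1 : DifferentiableAt ℝ (fun x => u t0 (x + h)) x0 :=
      (contDiffAt_translate (hxh ▸ hu.smooth t0 ht0 y hy3)).differentiableAt (n := 2) (by norm_num)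
    have d2 := (hu.smooth t0 ht0 x0 hx3).differentiableAt (n := 2) (by norm_num)
    rw [fderiv_fun_sub d1 d2, fderiv_comp_add_right, hxh]
  rw [e] at key
  refine key.trans (le_of_eq ?_)
  ring

end interior

section hsol
variable {d : ℕ}

/-- Dirichlet heat solution with a bound on its initial data. -/
structure HSol (Ω : Set (Euc d)) (u : ℝ → Euc d → ℝ) (M : ℝ) : Prop where
  cont : ContinuousOn (fun q : ℝ × Euc d => u q.1 q.2) (Set.Ici 0 ×ˢ closure Ω)
  smooth : ∀ t, 0 < t → ∀ x ∈ Ω, ContDiffAt ℝ 2 (u t) x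
  eqn : ∀ t, 0 < t → ∀ x ∈ Ω, HasDerivAt (fun s => u s x) (lap (u t) x) t
  bdry : ∀ t, 0 ≤ t → ∀ x ∈ frontier Ω, u t x = 0
  init : ∀ x, |u 0 x| ≤ M

theorem lap_neg {f : Euc d → ℝ} {x : Euc d} (hf : ContDiffAt ℝ 2 f x) :
    lap (fun y => - f y) x = - lap f x := by
  rw [lap_of_jets hf.neg (fun i => (Jet.of_contDiffAt hf (bv i)).neg), lap_eq hf,
    Finset.sum_neg_distrib]

theorem HSol.neg {Ω : Set (Euc d)} {u : ℝ → Euc d → ℝ} {M : ℝ} (h : HSol Ω u M) :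
    HSol Ω (fun t x => - u t x) M := by
  refine ⟨h.cont.neg, fun t ht x hx => (h.smooth t ht x hx).neg, fun t ht x hx => ?_, ?_, ?_⟩
  · rw [lap_neg (h.smooth t ht x hx)]
    exact (h.eqn t ht x hx).neg
  · intro t ht x hx; simp [h.bdry t ht x hx]
  · intro x; simpa using h.init x

theorem HSol.heatOn {Ω V : Set (Euc d)} {u : ℝ → Euc d → ℝ} {M a b : ℝ} (h : HSol Ω u M)
    (hV : V ⊆ Ω) (ha : 0 ≤ a) : HeatOn u V a b :=
  ⟨fun t ht x hx => h.smooth t (ha.trans_lt ht.1) x (hV hx),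
   fun t ht x hx => h.eqn t (ha.trans_lt ht.1) x (hV hx),
   h.cont.mono (Set.prod_mono (fun t ht => ha.trans ht.1) (hV.trans subset_closure))⟩

theorem HSol.le {Ω : Set (Euc d)} (hΩ : IsOpen Ω) (hb : Bornology.IsBounded Ω)
    {u : ℝ → Euc d → ℝ} {M : ℝ} (hM : 0 ≤ M) (h : HSol Ω u M) {t0 : ℝ} (ht0 : 0 ≤ t0) {x0 : Euc d}
    (hx0 : x0 ∈ closure Ω) : u t0 x0 ≤ M := by
  have hfin : ∀ ε > 0, u t0 x0 - M - ε * t0 ≤ 0 := by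
    intro ε hε
    let Φ : ℝ × Euc d → ℝ := fun q => u q.1 q.2 - M - ε * q.1
    have hQ : IsCompact (Set.Icc 0 t0 ×ˢ closure Ω) :=
      isCompact_Icc.prod (Metric.isCompact_of_isClosed_isBounded isClosed_closure hb.closure)
    have hΦ : ContinuousOn Φ (Set.Icc 0 t0 ×ˢ closure Ω) := by
      have := h.cont.mono (Set.prod_mono (fun (s : ℝ) (hs : s ∈ Set.Icc 0 t0) => hs.1 : Set.Icc 0 t0 ⊆ Set.Ici 0) (le_refl (closure Ω)))
      exact (this.sub continuousOn_const).sub (by fun_prop)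
    have h0 : (t0, x0) ∈ Set.Icc 0 t0 ×ˢ closure Ω := ⟨⟨ht0, le_rfl⟩, hx0⟩
    obtain ⟨⟨t, x⟩, ⟨ht, hx⟩, hmax⟩ := hQ.exists_isMaxOn ⟨_, h0⟩ hΦ
    simp only at ht hx
    refine le_trans (hmax h0) ?_
    by_contra hpos
    push Not at hpos
    have hpos' : 0 < u t x - M - ε * t := hpos
    have het : 0 ≤ ε * t := mul_nonneg hε.le ht.1
    have ht' : 0 < t := by
      rcases ht.1.lt_or_eq with h' | h'
      · exact h'
      · exfalso
        have := le_of_abs_le (h.init x)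
        rw [← h'] at hpos'
        linarith
    have hxΩ : x ∈ Ω := by
      by_contra hn
      have hf : x ∈ frontier Ω := ⟨hx, by rwa [hΩ.interior_eq]⟩
      have := h.bdry t ht.1 x hf
      linarith
    have hder : HasDerivAt (fun s => Φ (s, x)) _ t :=
      ((h.eqn t ht' x hxΩ).sub_const M).sub ((hasDerivAt_id t).const_mul ε)
    have htn := deriv_nonneg_of_left_max hder ht' (fun s hs => hmax
      (show (s, x) ∈ _ from ⟨⟨hs.1, hs.2.trans ht.2⟩, hx⟩))
    have hlap : lap (u t) x ≤ 0 := by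
      refine lap_nonpos_of_max (h.smooth t ht' x hxΩ) ?_
      filter_upwards [hΩ.mem_nhds hxΩ] with z hz
      have := hmax (show (t, z) ∈ _ from ⟨ht, subset_closure hz⟩)
      simp only [Φ, Set.mem_ofPred_eq] at this
      linarith
    linarith
  have : Tendsto (fun ε : ℝ => u t0 x0 - M - ε * t0) (𝓝[>] 0) (𝓝 (u t0 x0 - M - 0 * t0)) := by
    apply Tendsto.mono_left _ nhdsWithin_le_nhds
    apply Continuous.tendsto
    fun_prop
  have h2 := le_of_tendsto this (by filter_upwards [self_mem_nhdsWithin] with ε hε using hfin ε hε)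
  linarith

theorem HSol.abs_le {Ω : Set (Euc d)} (hΩ : IsOpen Ω) (hb : Bornology.IsBounded Ω)
    {u : ℝ → Euc d → ℝ} {M : ℝ} (hM : 0 ≤ M) (h : HSol Ω u M) {t0 : ℝ} (ht0 : 0 ≤ t0) {x0 : Euc d}
    (hx0 : x0 ∈ closure Ω) : |u t0 x0| ≤ M := by
  have h1 := h.le hΩ hb hM ht0 hx0
  have h2 := h.neg.le hΩ hb hM ht0 hx0
  rw [_root_.abs_le]; constructor <;> linarith

theorem HSol.interior1 {Ω : Set (Euc d)} (hΩ : IsOpen Ω) (hb : Bornology.IsBounded Ω)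
    {u : ℝ → Euc d → ℝ} {M : ℝ} (hM : 0 < M) (h : HSol Ω u M) {t0 δ : ℝ} (hδ : 0 < δ) {x0 : Euc d}
    (hB : Metric.ball x0 (2 * δ) ⊆ Ω) (ht : δ ^ 2 / 2 ≤ t0) :
    ‖fderiv ℝ (u t0) x0‖ ≤ (32 + 10 * d) * M / δ := by
  refine interior_grad hδ hM (h.heatOn hB (by linarith)) ?_
  intro t ht' x hx y hy
  have hs : 0 ≤ t := by linarith [ht'.1]
  have h1 := h.abs_le hΩ hb hM.le hs (subset_closure (hB hx))
  have h2 := h.abs_le hΩ hb hM.le hs (subset_closure (hB hy))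
  linarith [(_root_.abs_le.1 h1).2, (_root_.abs_le.1 h2).1]

theorem HSol.interior2 {Ω : Set (Euc d)} (hΩ : IsOpen Ω) (hb : Bornology.IsBounded Ω)
    {u : ℝ → Euc d → ℝ} {M : ℝ} (hM : 0 < M) (h : HSol Ω u M) {t0 δ : ℝ} (hδ : 0 < δ) {x0 : Euc d}
    (hB : Metric.ball x0 (5 * δ) ⊆ Ω) (ht : δ ^ 2 ≤ t0) :
    ‖fderiv ℝ (fderiv ℝ (u t0)) x0‖ ≤ (32 + 10 * d) ^ 2 * M / δ ^ 2 := by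
  have := interior_hess (u := u) (x0 := x0) (t0 := t0) (A := (32 + 10 * d) * M / δ) hδ (by positivity)
    (h.heatOn ((Metric.ball_subset_ball (by linarith)).trans hB) (by nlinarith [sq_nonneg δ])) ?_
  · refine this.trans (le_of_eq ?_)
    field_simp
  · intro t ht' x hx y hy
    have hp : ∀ z ∈ Metric.ball x0 (3 * δ), ‖fderiv ℝ (u t) z‖ ≤ (32 + 10 * d) * M / δ := by
      intro z hz
      refine h.interior1 hΩ hb hM hδ ?_ (by linarith [ht'.1])
      refine (Metric.ball_subset_ball' ?_).trans hB
      have := Metric.mem_ball.1 hz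
      linarith
    refine (norm_sub_le _ _).trans ?_
    have h1 := hp x hx
    have h2 := hp y hy
    linarith

end hsol

section chart
variable {d : ℕ}

/-- Boundary chart function. -/
structure Chart (Ω : Set (Euc d)) (p : Euc d) (R : ℝ) (φ : Euc d → ℝ) (μ M0 : ℝ) : Prop where
  hR : 0 < R
  hμ : 0 < μ
  hM0 : 0 < M0
  smooth : ∀ y ∈ Metric.ball p R, ContDiffAt ℝ 2 φ y
  grad_lb : ∀ y ∈ Metric.ball p R, μ ≤ ‖fderiv ℝ φ y‖
  grad_ub : ∀ y ∈ Metric.ball p R, ‖fderiv ℝ φ y‖ ≤ M0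
  hess : ∀ y ∈ Metric.ball p R, ‖fderiv ℝ (fderiv ℝ φ) y‖ ≤ M0
  lap_le : ∀ y ∈ Metric.ball p R, |lap φ y| ≤ M0 * |φ y|
  pos : ∀ y ∈ Metric.ball p R, (0 < φ y ↔ y ∈ Ω)
  zero : ∀ y ∈ Metric.ball p R, y ∈ frontier Ω → φ y = 0
  small : ∀ y ∈ Metric.ball p R, 2 * M0 / μ ^ 2 * φ y ≤ 1 / 4

variable {Ω : Set (Euc d)} {p : Euc d} {R μ M0 : ℝ} {φ : Euc d → ℝ}

theorem Chart.lip (h : Chart Ω p R φ μ M0) {x y : Euc d} (hx : x ∈ Metric.ball p R)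
    (hy : y ∈ Metric.ball p R) : |φ y - φ x| ≤ M0 * ‖y - x‖ := by
  have := (convex_ball p R).norm_image_sub_le_of_norm_fderiv_le (𝕜 := ℝ)
    (fun z hz => (h.smooth z hz).differentiableAt (by norm_num)) (fun z hz => h.grad_ub z hz) hx hy
  simpa using this

theorem Chart.lipD (h : Chart Ω p R φ μ M0) {x y : Euc d} (hx : x ∈ Metric.ball p R)
    (hy : y ∈ Metric.ball p R) : ‖fderiv ℝ φ y - fderiv ℝ φ x‖ ≤ M0 * ‖y - x‖ := by
  exact (convex_ball p R).norm_image_sub_le_of_norm_fderiv_le (𝕜 := ℝ)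
    (fun z hz => ((h.smooth z hz).fderiv_right (m := 1) (by norm_num)).differentiableAt (by simp))
    (fun z hz => h.hess z hz) hx hy

theorem Chart.taylor (h : Chart Ω p R φ μ M0) {x y : Euc d} (hx : x ∈ Metric.ball p R)
    (hy : y ∈ Metric.ball p R) : |φ y - φ x - fderiv ℝ φ x (y - x)| ≤ M0 * ‖y - x‖ ^ 2 := by
  have hc : Convex ℝ (Metric.ball p R ∩ Metric.closedBall x ‖y - x‖) :=
    (convex_ball p R).inter (convex_closedBall x _)
  have := hc.norm_image_sub_le_of_norm_fderiv_le' (𝕜 := ℝ) (f := φ) (φ := fderiv ℝ φ x)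
    (C := M0 * ‖y - x‖) (x := x) (y := y)
    (fun z hz => (h.smooth z hz.1).differentiableAt (by norm_num))
    (fun z hz => (h.lipD hx hz.1).trans (by
      have := mem_closedBall_iff_norm.1 hz.2
      have := h.hM0
      gcongr))
    ⟨hx, Metric.mem_closedBall_self (norm_nonneg _)⟩ ⟨hy, by rw [mem_closedBall_iff_norm]⟩
  rw [Real.norm_eq_abs] at this
  refine this.trans (le_of_eq ?_)
  ring

theorem lap_le_of_max {f P : Euc d → ℝ} {x : Euc d} (hf : ContDiffAt ℝ 2 f x) {A S : Fin d → ℝ}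
    (hm : ∀ᶠ z in 𝓝 x, f z - P z ≤ f x - P x)
    (h : ∀ i, Jet (fun s : ℝ => P (x + s • bv i)) (A i) (S i)) : lap f x ≤ ∑ i, S i := by
  rw [lap_eq hf]
  refine Finset.sum_le_sum fun i _ => ?_
  have hj := ((Jet.of_contDiffAt hf (bv i)).sub (h i)).isLocalMax (by
    have hc : ContinuousAt (fun s : ℝ => x + s • bv i) 0 := by fun_prop
    have ht : Tendsto (fun s : ℝ => x + s • bv i) (𝓝 0) (𝓝 x) := by simpa using hc.tendsto
    filter_upwards [ht.eventually hm] with s hs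
    simpa using hs)
  linarith [hj.2]

theorem sum_fderiv_mul (f g : Euc d → ℝ) (x : Euc d) :
    ∑ i, fderiv ℝ f x (bv i) * fderiv ℝ g x (bv i) = fderiv ℝ g x (gradient f x) := by
  have e : ∀ i, (gradient f x) i = fderiv ℝ f x (bv i) := by
    intro i
    rw [← inner_grad, bv, EuclideanSpace.inner_single_right]
    simp
  conv_rhs => rw [← sum_bv (gradient f x)]
  rw [map_sum]
  refine Finset.sum_congr rfl fun i _ => ?_
  rw [map_smul, smul_eq_mul, e]

theorem norm_bv (i : Fin d) : ‖(bv i : Euc d)‖ = 1 := by simp [bv]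

theorem lap_quot {f g : Euc d → ℝ} {x : Euc d} (hf : ContDiffAt ℝ 2 f x) (hg : ContDiffAt ℝ 2 g x)
    (hx : g x ≠ 0) :
    lap f x / g x = lap (fun y => f y / g y) x +
      2 / g x * fderiv ℝ (fun y => f y / g y) x (gradient g x) + lap g x / g x * (f x / g x) := by
  have hw : ContDiffAt ℝ 2 (fun y => f y / g y) x := hf.div hg hx
  have hne : ∀ᶠ y in 𝓝 x, g y ≠ 0 := hg.continuousAt.eventually_ne hx
  have hj : ∀ i, Jet (fun s : ℝ => f (x + s • bv i)) _ _ := fun i =>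
    ((Jet.of_contDiffAt hg (bv i)).mul (Jet.of_contDiffAt hw (bv i))).congr (by
      have hc : ContinuousAt (fun s : ℝ => x + s • bv i) 0 := by fun_prop
      have ht : Tendsto (fun s : ℝ => x + s • bv i) (𝓝 0) (𝓝 x) := by simpa using hc.tendsto
      filter_upwards [ht.eventually hne] with s hs
      field_simp)
  have h1 := lap_of_jets hf hj
  simp only [zero_smul, add_zero] at h1
  rw [Finset.sum_add_distrib, Finset.sum_add_distrib, ← Finset.sum_mul, ← Finset.mul_sum,
    ← Finset.mul_sum, sum_fderiv_mul, ← lap_eq hg, ← lap_eq hw] at h1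
  rw [h1]
  field_simp
  ring

theorem Chart.nonneg (h : Chart Ω p R φ μ M0) (hΩ : IsOpen Ω) {x : Euc d} (hx : x ∈ Metric.ball p R)
    (hxc : x ∈ closure Ω) : 0 ≤ φ x := by
  by_cases hxo : x ∈ Ω
  · exact ((h.pos x hx).2 hxo).le
  · exact (h.zero x hx ⟨hxc, by rwa [hΩ.interior_eq]⟩).ge

set_option maxHeartbeats 1000000 in
theorem Chart.barrier_up (h : Chart Ω p R φ μ M0) (hΩ : IsOpen Ω) (hb : Bornology.IsBounded Ω)
    {A M t0 σ : ℝ} (hA : 2 ≤ A) (hA2 : 2 * d + 1 < A * (μ ^ 2 / 2)) (hM : 0 < M)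
    {u : ℝ → Euc d → ℝ} (hu : HSol Ω u M) (hσ : 0 < σ) (hσt : σ ^ 2 = t0) 
    (hσ1 : d * M0 * σ ≤ μ ^ 2 / 2) {x0 : Euc d} (hx0 : x0 ∈ Ω)
    (hB : Metric.closedBall x0 σ ⊆ Metric.ball p R) :
    u t0 x0 ≤ A * M * φ x0 / σ := by
  have hx0B : x0 ∈ Metric.ball p R := hB (Metric.mem_closedBall_self hσ.le)
  have ht0 : 0 < t0 := by rw [← hσt]; positivity
  rcases le_or_gt σ (φ x0) with hbig | hsm
  · have h1 := hu.le hΩ hb hM.le ht0.le (subset_closure hx0)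
    refine h1.trans ?_
    rw [le_div_iff₀ hσ]
    have : M * σ ≤ M * φ x0 := by gcongr
    have h2 : 0 ≤ M * φ x0 := mul_nonneg hM.le (by linarith)
    nlinarith
  let P : ℝ → Euc d → ℝ := fun t x =>
    M * (A * (1 / σ * φ x - 1 / (2 * σ ^ 2) * (φ x * φ x)) + 1 / σ ^ 2 * ‖x - x0‖ ^ 2)
  let Φ : ℝ × Euc d → ℝ := fun q => u q.1 q.2 - P q.1 q.2 - M / σ ^ 2 * (t0 - q.1)
  let X : Set (Euc d) := closure Ω ∩ Metric.closedBall x0 σ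
  let Q : Set (ℝ × Euc d) := Set.Icc 0 t0 ×ˢ (X ∩ φ ⁻¹' (Set.Iic σ))
  have hφc : ContinuousOn φ X := fun x hx =>
    (h.smooth x (hB hx.2)).continuousAt.continuousWithinAt
  have hXc : IsCompact X := (isCompact_closedBall x0 σ).inter_left isClosed_closure
  have hQ : IsCompact Q := isCompact_Icc.prod (hXc.of_isClosed_subset
    (hφc.preimage_isClosed_of_isClosed hXc.isClosed isClosed_Iic) Set.inter_subset_left)
  have hΦ : ContinuousOn Φ Q := by
    have k1 : ContinuousOn (fun q : ℝ × Euc d => u q.1 q.2) Q :=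
      hu.cont.mono (fun q hq => ⟨hq.1.1, hq.2.1.1⟩)
    have k2 : ContinuousOn (fun q : ℝ × Euc d => φ q.2) Q :=
      hφc.comp (f := fun q : ℝ × Euc d => q.2) (by fun_prop) (fun q hq => hq.2.1)
    exact (k1.sub (continuousOn_const.mul ((continuousOn_const.mul ((continuousOn_const.mul k2).sub
      (continuousOn_const.mul (k2.mul k2)))).add (by fun_prop)))).sub (by fun_prop)
  have h0 : (t0, x0) ∈ Q :=
    ⟨⟨ht0.le, le_rfl⟩, ⟨subset_closure hx0, Metric.mem_closedBall_self hσ.le⟩, hsm.le⟩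
  obtain ⟨⟨t, x⟩, ⟨ht, ⟨hxc, hxB⟩, hxσ⟩, hmax⟩ := hQ.exists_isMaxOn ⟨_, h0⟩ hΦ
  simp only [Set.mem_preimage, Set.mem_Iic] at ht hxc hxB hxσ
  have hψ : ∀ s : ℝ, 0 ≤ s → s ≤ σ → s / (2 * σ) ≤ 1 / σ * s - 1 / (2 * σ ^ 2) * (s * s) := by
    intro s hs hs2
    have : 1 / σ * s - 1 / (2 * σ ^ 2) * (s * s) - s / (2 * σ) = s * (σ - s) / (2 * σ ^ 2) := by
      field_simp; ring
    have : 0 ≤ s * (σ - s) / (2 * σ ^ 2) :=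
      div_nonneg (mul_nonneg hs (by linarith)) (by positivity)
    linarith
  have hΦ0 : Φ (t, x) ≤ 0 := by
    by_contra hpos
    push Not at hpos
    have hφx0 : 0 ≤ φ x := h.nonneg hΩ (hB hxB) hxc
    have hψx := hψ _ hφx0 hxσ
    have hψ0 : 0 ≤ 1 / σ * φ x - 1 / (2 * σ ^ 2) * (φ x * φ x) := le_trans (by positivity) hψx
    have huM := hu.le hΩ hb hM.le ht.1 hxc
    have hΦe : Φ (t, x) = u t x - M * (A * (1 / σ * φ x - 1 / (2 * σ ^ 2) * (φ x * φ x)) +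
      1 / σ ^ 2 * ‖x - x0‖ ^ 2) - M / σ ^ 2 * (t0 - t) := rfl
    rw [hΦe] at hpos
    have n1 : 0 ≤ M * (A * (1 / σ * φ x - 1 / (2 * σ ^ 2) * (φ x * φ x))) := by positivity
    have n2 : 0 ≤ M * (1 / σ ^ 2 * ‖x - x0‖ ^ 2) := by positivity
    have n3 : 0 ≤ M / σ ^ 2 * (t0 - t) := mul_nonneg (by positivity) (by linarith [ht.2])
    rw [mul_add] at hpos
    have ht' : 0 < t := by
      rcases ht.1.lt_or_eq with h' | h'
      · exact h'
      · exfalso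
        have : M / σ ^ 2 * (t0 - t) = M := by rw [← h', ← hσt]; field_simp; ring
        linarith
    have hxΩ : x ∈ Ω := by
      by_contra hn
      have := hu.bdry t ht.1 x ⟨hxc, by rwa [hΩ.interior_eq]⟩
      linarith
    have hxs : ‖x - x0‖ < σ := by
      rcases (mem_closedBall_iff_norm.1 hxB).lt_or_eq with h' | h'
      · exact h'
      · exfalso
        have : M * (1 / σ ^ 2 * ‖x - x0‖ ^ 2) = M := by rw [h']; field_simp
        linarith
    have hφs : φ x < σ := by
      rcases hxσ.lt_or_eq with h' | h'
      · exact h'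
      · exfalso
        have e1 : φ x / (2 * σ) = 1 / 2 := by rw [h']; field_simp
        rw [e1] at hψx
        have : 1 ≤ A * (1 / σ * φ x - 1 / (2 * σ ^ 2) * (φ x * φ x)) := by nlinarith
        have := mul_le_mul_of_nonneg_left this hM.le
        linarith
    have hxb := hB hxB
    have hsx := h.smooth x hxb
    have hlm : ∀ᶠ z in 𝓝 x, u t z - P t z ≤ u t x - P t x := by
      have o1 : ∀ᶠ z in 𝓝 x, ‖z - x0‖ < σ :=
        (isOpen_lt (f := fun z : Euc d => ‖z - x0‖) (by fun_prop) (by fun_prop)).mem_nhds hxs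
      have o2 : ∀ᶠ z in 𝓝 x, φ z < σ := hsx.continuousAt.eventually (gt_mem_nhds hφs)
      filter_upwards [o1, o2, hΩ.mem_nhds hxΩ] with z p1 p2 p3
      have := hmax (show (t, z) ∈ Q from
        ⟨ht, ⟨subset_closure p3, mem_closedBall_iff_norm.2 p1.le⟩, p2.le⟩)
      simp only [Φ, Set.mem_ofPred_eq] at this
      linarith
    have hlap := lap_le_of_max (hu.smooth t ht' x hxΩ) hlm (fun i =>
      (((((Jet.of_contDiffAt hsx (bv i)).const_mul (1 / σ)).sub
        (((Jet.of_contDiffAt hsx (bv i)).mul (Jet.of_contDiffAt hsx (bv i))).const_mul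
          (1 / (2 * σ ^ 2)))).const_mul A).add
        ((jet_normsq x x0 (bv i)).const_mul (1 / σ ^ 2))).const_mul M)
    simp only [zero_smul, add_zero, norm_bv] at hlap
    rw [← Finset.mul_sum, Finset.sum_add_distrib, ← Finset.mul_sum, Finset.sum_sub_distrib,
      ← Finset.mul_sum, ← Finset.mul_sum, Finset.sum_add_distrib, Finset.sum_add_distrib,
      ← Finset.sum_mul, ← Finset.mul_sum, ← Finset.mul_sum, sum_fderiv_mul, ← lap_eq hsx,
      fderiv_grad] at hlap
    simp only [Finset.sum_const, Finset.card_univ, Fintype.card_fin, nsmul_eq_mul] at hlap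
    have hder : HasDerivAt (fun s => Φ (s, x)) _ t :=
      ((hu.eqn t ht' x hxΩ).sub_const (P t x)).sub
        (((hasDerivAt_id t).const_sub t0).const_mul (M / σ ^ 2))
    have htn := deriv_nonneg_of_left_max hder ht' (fun s hs => hmax
      (show (s, x) ∈ Q from ⟨⟨hs.1, hs.2.trans ht.2⟩, ⟨hxc, hxB⟩, hxσ⟩))
    have hL : lap φ x ≤ d * M0 := (le_of_abs_le ((abs_lap_le hsx).trans
      (mul_le_mul_of_nonneg_left (h.hess x hxb) (by positivity))))
    have hg : μ ^ 2 ≤ ‖fderiv ℝ φ x‖ ^ 2 := pow_le_pow_left₀ h.hμ.le (h.grad_lb x hxb) 2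
    -- combine
    set L := lap φ x
    set g := ‖fderiv ℝ φ x‖ ^ 2
    have c1 : 0 ≤ lap (u t) x + M / σ ^ 2 := by linarith
    have c2 : 0 ≤ M * (A * (1 / σ * L - 1 / (2 * σ ^ 2) * (L * φ x + 2 * g + φ x * L)) +
        1 / σ ^ 2 * (d * (2 * 1 ^ 2))) + M / σ ^ 2 := by linarith
    have c3 : M * (A * (1 / σ * L - 1 / (2 * σ ^ 2) * (L * φ x + 2 * g + φ x * L)) +
        1 / σ ^ 2 * (d * (2 * 1 ^ 2))) + M / σ ^ 2 =
        M / σ ^ 2 * (A * (L * (σ - φ x) - g) + 2 * d + 1) := by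
      field_simp; ring
    rw [c3] at c2
    have c4 : 0 ≤ A * (L * (σ - φ x) - g) + 2 * d + 1 := by
      by_contra hn
      push Not at hn
      have := mul_neg_of_pos_of_neg (show 0 < M / σ ^ 2 by positivity) hn
      linarith
    have c5 : L * (σ - φ x) ≤ d * M0 * σ := by
      have hM00 := h.hM0
      calc L * (σ - φ x) ≤ d * M0 * (σ - φ x) :=
            mul_le_mul_of_nonneg_right hL (by linarith)
        _ ≤ d * M0 * σ := by
            apply mul_le_mul_of_nonneg_left (by linarith) (by positivity)
    have c6 : A * (L * (σ - φ x) - g) ≤ A * (- (μ ^ 2 / 2)) :=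
      mul_le_mul_of_nonneg_left (by linarith) (by linarith)
    linarith
  have hfin := (hmax h0).trans hΦ0
  have hfin' : u t0 x0 - M * (A * (1 / σ * φ x0 - 1 / (2 * σ ^ 2) * (φ x0 * φ x0)) +
      1 / σ ^ 2 * ‖x0 - x0‖ ^ 2) - M / σ ^ 2 * (t0 - t0) ≤ 0 := hfin
  simp only [sub_self, norm_zero, mul_zero, sub_zero] at hfin'
  have e1 : 0 ≤ M * A * (1 / (2 * σ ^ 2) * (φ x0 * φ x0)) := by
    have := mul_self_nonneg (φ x0)
    positivity
  have e2 : A * M * φ x0 / σ = M * A * (1 / σ * φ x0) := by ring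
  rw [e2]
  norm_num at hfin' e1 ⊢
  linarith

theorem Chart.barrier (h : Chart Ω p R φ μ M0) (hΩ : IsOpen Ω) (hb : Bornology.IsBounded Ω)
    {A M t0 σ : ℝ} (hA : 2 ≤ A) (hA2 : 2 * d + 1 < A * (μ ^ 2 / 2)) (hM : 0 < M)
    {u : ℝ → Euc d → ℝ} (hu : HSol Ω u M) (hσ : 0 < σ) (hσt : σ ^ 2 = t0) 
    (hσ1 : d * M0 * σ ≤ μ ^ 2 / 2) {x0 : Euc d} (hx0 : x0 ∈ Ω)
    (hB : Metric.closedBall x0 σ ⊆ Metric.ball p R) :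
    |u t0 x0| ≤ A * M * φ x0 / σ := by
  have h1 := h.barrier_up hΩ hb hA hA2 hM hu hσ hσt hσ1 hx0 hB
  have h2 := h.barrier_up hΩ hb hA hA2 hM hu.neg hσ hσt hσ1 hx0 hB
  rw [abs_le]; constructor <;> linarith

end chart

section quot
variable {d : ℕ} {Ω : Set (Euc d)} {p : Euc d} {R μ M0 : ℝ} {φ : Euc d → ℝ}

/-- Smallness condition on the length scale. -/
structure SmallScale (d : ℕ) (R μ M0 σ : ℝ) : Prop where
  pos : 0 < σ
  le_one : σ ≤ 1
  le_R : 8 * σ ≤ R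
  bar : d * M0 * σ ≤ μ ^ 2 / 2
  dbl : σ * (2 * (2 * M0 / μ ^ 2) * ((32 + 10 * d) + 5) * (d * M0) +
    8 * (2 * M0 / μ ^ 2) * M0 * (2 * (32 + 10 * d) + 10) + 6 * M0) ≤ 1

theorem SmallScale.mono {σ τ : ℝ} (h : SmallScale d R μ M0 σ) (hM0 : 0 < M0) (hτ : 0 < τ) (hτσ : τ ≤ σ) :
    SmallScale d R μ M0 τ := by
  refine ⟨hτ, hτσ.trans h.le_one, by linarith [h.le_R], ?_, ?_⟩
  · refine le_trans ?_ h.bar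
    gcongr
  · refine le_trans ?_ h.dbl
    gcongr

theorem SmallScale.exists (d : ℕ) {R μ M0 : ℝ} (hR : 0 < R) (hμ : 0 < μ) (hM0 : 0 < M0) :
    ∃ σ, SmallScale d R μ M0 σ := by
  set B := (2 * (2 * M0 / μ ^ 2) * ((32 + 10 * d) + 5) * (d * M0) +
    8 * (2 * M0 / μ ^ 2) * M0 * (2 * (32 + 10 * d) + 10) + 6 * M0) with hB
  have hB0 : 0 < B := by positivity
  have hC0 : 0 < d * M0 + 1 := by positivity
  refine ⟨min (min 1 (R / 8)) (min (μ ^ 2 / 2 / (d * M0 + 1)) (1 / B)), ?_, ?_, ?_, ?_, ?_⟩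
  · refine lt_min (lt_min one_pos (by positivity)) (lt_min (by positivity) (by positivity))
  · exact (min_le_left _ _).trans (min_le_left _ _)
  · have : min (min 1 (R / 8)) (min (μ ^ 2 / 2 / (d * M0 + 1)) (1 / B)) ≤ R / 8 :=
      (min_le_left _ _).trans (min_le_right _ _)
    linarith
  · set s := min (min 1 (R / 8)) (min (μ ^ 2 / 2 / (d * M0 + 1)) (1 / B))
    have : s ≤ μ ^ 2 / 2 / (d * M0 + 1) := (min_le_right _ _).trans (min_le_left _ _)
    calc d * M0 * s ≤ d * M0 * (μ ^ 2 / 2 / (d * M0 + 1)) := by gcongr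
      _ ≤ (d * M0 + 1) * (μ ^ 2 / 2 / (d * M0 + 1)) := by
          gcongr; linarith
      _ = _ := by field_simp
  · set s := min (min 1 (R / 8)) (min (μ ^ 2 / 2 / (d * M0 + 1)) (1 / B))
    have : s ≤ 1 / B := (min_le_right _ _).trans (min_le_right _ _)
    rw [← hB]
    calc s * B ≤ 1 / B * B := by gcongr
      _ = 1 := by field_simp

theorem Chart.bound (h : Chart Ω p R φ μ M0) (hΩ : IsOpen Ω) (hb : Bornology.IsBounded Ω)
    {A M t0 σ : ℝ} (hA : 2 ≤ A) (hA2 : 2 * d + 1 < A * (μ ^ 2 / 2)) (hM : 0 < M)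
    {u : ℝ → Euc d → ℝ} (hu : HSol Ω u M) (hσ : SmallScale d R μ M0 σ) (hσt : σ ^ 2 = t0)
    {t : ℝ} (ht : t ∈ Set.Icc (t0 - σ ^ 2 / 2) t0)
    {x : Euc d} (hx : x ∈ Ω ∩ Metric.ball p (R / 2)) : |u t x| ≤ 2 * A * M / σ * φ x := by
  have hs0 := hσ.pos
  have hsp : 0 < σ ^ 2 := by positivity
  have ht1 : σ ^ 2 / 2 ≤ t := by linarith [ht.1]
  have ht0 : 0 < t := by linarith
  have hsq : √t ^ 2 = t := Real.sq_sqrt ht0.le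
  have hst : 0 < √t := Real.sqrt_pos.2 ht0
  have hle : √t ≤ σ := by rw [Real.sqrt_le_left hs0.le]; linarith [ht.2]
  have hge : σ / 2 ≤ √t := by
    apply Real.le_sqrt_of_sq_le; nlinarith
  have hτ := hσ.mono h.hM0 hst hle
  have hxR : x ∈ Metric.ball p R := Metric.ball_subset_ball (by linarith [h.hR]) hx.2
  have hφ : 0 < φ x := (h.pos x hxR).2 hx.1
  have := h.barrier hΩ hb hA hA2 hM hu hst hsq hτ.bar hx.1 (by
    apply Metric.closedBall_subset_ball'
    have := Metric.mem_ball.1 hx.2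
    linarith [hτ.le_R, h.hR])
  refine this.trans ?_
  rw [div_le_iff₀ hst]
  calc A * M * φ x = (2 * A * M / σ * φ x) * (σ / 2) := by field_simp
    _ ≤ (2 * A * M / σ * φ x) * √t := by gcongr

set_option maxHeartbeats 2000000 in
theorem Chart.quot_lip (h : Chart Ω p R φ μ M0) (hΩ : IsOpen Ω) (hb : Bornology.IsBounded Ω)
    {A M t0 σ ε : ℝ} (hA : 2 ≤ A) (hA2 : 2 * d + 1 < A * (μ ^ 2 / 2)) (hM : 0 < M)
    {u : ℝ → Euc d → ℝ} (hu : HSol Ω u M) (hσ : SmallScale d R μ M0 σ) (hσt : σ ^ 2 = t0)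
    {x0 : Euc d} (hx0 : x0 ∈ Ω) (hx0p : x0 ∈ Metric.ball p (R / 4)) (hε : 0 < ε) :
    ∀ y ∈ Ω ∩ Metric.ball p (R / 2), ‖x0 - y‖ ≤ σ / 4 →
      (u t0 x0 - ε) / φ x0 - (u t0 y + ε) / φ y ≤
        (2 * A * M / σ) * (32 + 10 * d) * (1 / σ) * ‖x0 - y‖ := by
  have hs0 := hσ.pos
  have hκ : t0 - 1 / (2 * (1 / σ) ^ 2) = t0 - σ ^ 2 / 2 := by field_simp
  have e1 : 1 / (1 / σ) = σ := by simp
  have e2 : 1 / (4 * (1 / σ)) = σ / 4 := by field_simp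
  have hR := h.hR
  have hM00 := h.hM0
  have hμ := h.hμ
  set V := Ω ∩ Metric.ball p (R / 2) with hV
  set M1 := 2 * A * M / σ with hM1
  have hM10 : 0 < M1 := by positivity
  have hVR : V ⊆ Metric.ball p R := fun x hx => Metric.ball_subset_ball (by linarith) hx.2
  have hφ0 : ∀ x ∈ V, 0 < φ x := fun x hx => (h.pos x (hVR hx)).2 hx.1
  have hbd : ∀ t ∈ Set.Icc (t0 - σ ^ 2 / 2) t0, ∀ x ∈ V, |u t x| ≤ M1 * φ x :=
    fun t ht x hx => h.bound hΩ hb hA hA2 hM hu hσ hσt ht hx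
  have hbd1 : ∀ t ∈ Set.Icc (t0 - σ ^ 2 / 2) t0, ∀ x ∈ V, |u t x / φ x| ≤ M1 := by
    intro t ht x hx
    rw [abs_div, abs_of_pos (hφ0 x hx), div_le_iff₀ (hφ0 x hx)]
    exact hbd t ht x hx
  set η := ε / (2 * M1 + 1) with hη
  have hη0 : 0 < η := by positivity
  set Kc := Metric.closedBall x0 (5 * σ / 4) ∩ φ ⁻¹' (Set.Ici η) with hKc
  have hcbV : Metric.closedBall x0 (5 * σ / 4) ⊆ Metric.ball p (R / 2) := by
    apply Metric.closedBall_subset_ball'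
    have := Metric.mem_ball.1 hx0p
    linarith [hσ.le_R]
  have hcbR : Metric.closedBall x0 (5 * σ / 4) ⊆ Metric.ball p R :=
    hcbV.trans (Metric.ball_subset_ball (by linarith))
  have hKV : Kc ⊆ V := fun x hx => ⟨(h.pos x (hcbR hx.1)).1 (hη0.trans_le hx.2), hcbV hx.1⟩
  have hφc : ContinuousOn φ (Metric.closedBall x0 (5 * σ / 4)) := fun x hx =>
    (h.smooth x (hcbR hx)).continuousAt.continuousWithinAt
  have hKcc : IsCompact Kc := (isCompact_closedBall x0 (5 * σ / 4)).of_isClosed_subset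
    (hφc.preimage_isClosed_of_isClosed Metric.isClosed_closedBall isClosed_Ici) Set.inter_subset_left
  have hx0V : x0 ∈ V := ⟨hx0, hcbV (Metric.mem_closedBall_self (by positivity))⟩
  have hpost : ∀ t, t ∈ Set.Ioc (t0 - σ ^ 2 / 2) t0 → 0 < t := by
    intro t ht
    have : 0 < σ ^ 2 := by positivity
    linarith [ht.1]
  have hsm : ∀ c : ℝ, ∀ t ∈ Set.Ioc (t0 - σ ^ 2 / 2) t0, ∀ x ∈ V,
      ContDiffAt ℝ 2 (fun y => (u t y + c) / φ y) x := fun c t ht x hx =>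
    ((hu.smooth t (hpost t ht) x hx.1).add contDiffAt_const).div (h.smooth x (hVR hx)) (hφ0 x hx).ne'
  have hlapc : ∀ (c : ℝ) (f : Euc d → ℝ) (x : Euc d), lap (fun y => f y + c) x = lap f x := by
    intro c f x
    have : ∀ i : Fin d, pd i (fun y => f y + c) = pd i f := by
      intro i; funext y; simp [pd]
    simp [lap, this]
  have hder : ∀ c : ℝ, ∀ t ∈ Set.Ioc (t0 - σ ^ 2 / 2) t0, ∀ x ∈ V,
      HasDerivAt (fun s => (u s x + c) / φ x)
      (lap (fun y => (u t y + c) / φ y) x +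
        2 / φ x * fderiv ℝ (fun y => (u t y + c) / φ y) x (gradient φ x) +
        lap φ x / φ x * ((u t x + c) / φ x)) t := by
    intro c t ht x hx
    have q := lap_quot (f := fun y => u t y + c)
      ((hu.smooth t (hpost t ht) x hx.1).add contDiffAt_const) (h.smooth x (hVR hx)) (hφ0 x hx).ne'
    rw [hlapc] at q
    rw [← q]
    exact ((hu.eqn t (hpost t ht) x hx.1).add_const c).div_const _
  have hcont : ∀ c : ℝ, ContinuousOn (fun q : ℝ × Euc d => (u q.1 q.2 + c) / φ q.2)
      (Set.Icc (t0 - σ ^ 2 / 2) t0 ×ˢ Kc) := by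
    intro c
    have k1 : ContinuousOn (fun q : ℝ × Euc d => u q.1 q.2) (Set.Icc (t0 - σ ^ 2 / 2) t0 ×ˢ Kc) := by
      refine hu.cont.mono (fun q hq => ⟨?_, subset_closure (hKV hq.2).1⟩)
      have : 0 < σ ^ 2 := by positivity
      have := hq.1.1
      simp only [Set.mem_Ici]
      linarith
    have k2 : ContinuousOn (fun q : ℝ × Euc d => φ q.2) (Set.Icc (t0 - σ ^ 2 / 2) t0 ×ˢ Kc) :=
      hφc.comp (f := fun q : ℝ × Euc d => q.2) (by fun_prop) (fun q hq => hq.2.1)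
    exact (k1.add continuousOn_const).div k2 (fun q hq => (hφ0 _ (hKV hq.2)).ne')
  have hdiv : ∀ (t : ℝ) (x y : Euc d), (u t x + -ε) / φ x - (u t y + ε) / φ y =
      u t x / φ x - u t y / φ y - (ε / φ x + ε / φ y) := by
    intro t x y; ring
  have hepos : ∀ x ∈ V, 0 < ε / φ x := fun x hx => div_pos hε (hφ0 x hx)
  have hnb : ∀ x y : Euc d, ‖x - x0‖ ≤ σ → ‖x - y‖ ≤ σ / 4 →
      x ∈ Metric.closedBall x0 (5 * σ / 4) ∧ y ∈ Metric.closedBall x0 (5 * σ / 4) := by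
    intro x y h1 h2
    have : ‖y - x0‖ ≤ ‖x - x0‖ + ‖x - y‖ := by
      have : y - x0 = (x - x0) - (x - y) := by abel
      rw [this]; exact norm_sub_le _ _
    constructor <;> rw [mem_closedBall_iff_norm] <;> linarith
  have key := doubling (φ := φ) (V := V) (Kc := Kc) (x0 := x0)
    (w1 := fun t y => (u t y + -ε) / φ y) (w2 := fun t y => (u t y + ε) / φ y)
    (32 + 10 * d) (1 / σ) (2 * M0 / μ ^ 2) M0 M0 (d * M0) M1 (3 * M0) t0
    (hΩ.inter Metric.isOpen_ball) hKV hKcc hx0V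
    (fun x hx => h.smooth x (hVR hx)) hφ0 (by positivity)
    (by have : (0:ℝ) ≤ d := by positivity
        linarith) (by positivity) hM00.le hM10
    (fun x hx y hy => h.taylor (hVR hx) (hVR hy))
    (fun x hx => by
      have := pow_le_pow_left₀ hμ.le (h.grad_lb x (hVR hx)) 2
      calc 2 * M0 = 2 * M0 / μ ^ 2 * μ ^ 2 := by field_simp
        _ ≤ _ := by gcongr)
    (fun x hx => h.small x (hVR hx))
    (fun x hx => h.grad_ub x (hVR hx))
    (fun x hx => (abs_lap_le (h.smooth x (hVR hx))).trans
      (mul_le_mul_of_nonneg_left (h.hess x (hVR hx)) (by positivity)))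
    (by rw [hκ]; exact hsm _) (by rw [hκ]; exact hsm _)
    (by rw [hκ]; exact hder _) (by rw [hκ]; exact hder _)
    (by
      rw [hκ]; intro t ht x hx y hy _ _
      rw [hdiv]
      have a1 := abs_le.1 (hbd1 t ht x hx)
      have a2 := abs_le.1 (hbd1 t ht y hy)
      linarith [hepos x hx, hepos y hy, a1.2, a2.1])
    (by
      rw [hκ]; intro t ht x hx y hy _ _ hpos
      rw [hdiv] at hpos
      have a1 := hbd1 t ht x hx
      have a2 := hbd1 t ht y hy
      have a1' := abs_le.1 a1
      have a2' := abs_le.1 a2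
      have b1 := hepos x hx
      have b2 := hepos y hy
      have c1 : ∀ z ∈ V, |lap φ z / φ z| ≤ M0 := by
        intro z hz
        rw [abs_div, abs_of_pos (hφ0 z hz), div_le_iff₀ (hφ0 z hz)]
        have := h.lap_le z (hVR hz)
        rwa [abs_of_pos (hφ0 z hz)] at this
      have d1 : |(u t x + -ε) / φ x| ≤ 3 * M1 := by
        have : (u t x + -ε) / φ x = u t x / φ x - ε / φ x := by ring
        rw [this, abs_le]; constructor <;> linarith [a1'.1, a1'.2, a2'.1, a2'.2]
      have d2 : |(u t y + ε) / φ y| ≤ 3 * M1 := by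
        have : (u t y + ε) / φ y = u t y / φ y + ε / φ y := by ring
        rw [this, abs_le]; constructor <;> linarith [a1'.1, a1'.2, a2'.1, a2'.2]
      have f1 : |lap φ x / φ x * ((u t x + -ε) / φ x)| ≤ M0 * (3 * M1) := by
        rw [abs_mul]; exact mul_le_mul (c1 x hx) d1 (abs_nonneg _) hM00.le
      have f2 : |lap φ y / φ y * ((u t y + ε) / φ y)| ≤ M0 * (3 * M1) := by
        rw [abs_mul]; exact mul_le_mul (c1 y hy) d2 (abs_nonneg _) hM00.le
      linarith [(abs_le.1 f1).2, (abs_le.1 f2).1])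
    (by
      rw [hκ, e1, e2]; intro t ht x hx y hy hh1 hh2 hor
      rw [hdiv]
      have a1 := abs_le.1 (hbd1 t ht x hx)
      have a2 := abs_le.1 (hbd1 t ht y hy)
      have hin := hnb x y hh1 hh2
      have big : ∀ z ∈ V, z ∈ Metric.closedBall x0 (5 * σ / 4) → z ∉ Kc → 2 * M1 ≤ ε / φ z := by
        intro z hz hz2 hz3
        have : φ z < η := by
          by_contra hn
          push Not at hn
          exact hz3 ⟨hz2, hn⟩
        have hlt : φ z * (2 * M1 + 1) < ε := by
          rw [hη, lt_div_iff₀ (by positivity)] at this; exact this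
        rw [le_div_iff₀ (hφ0 z hz)]
        linarith [hφ0 z hz]
      rcases hor with hor | hor
      · have := big x hx hin.1 hor
        linarith [hepos y hy, a1.2, a2.1]
      · have := big y hy hin.2 hor
        linarith [hepos x hx, a1.2, a2.1])
    (by
      rw [hκ]; intro t ht x hx
      have := hφ0 x hx
      gcongr
      linarith)
    (by rw [hκ]; exact hcont _) (by rw [hκ]; exact hcont _)
    (by
      have hq := hσ.dbl
      have hd0 : (0:ℝ) ≤ d := by positivity
      set N := 2 * M0 / μ ^ 2
      have hN0 : 0 < N := by positivity
      have h3 : σ * σ ≤ σ * 1 := by gcongr; exact hσ.le_one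
      have g1 : 0 ≤ 2 * N * ((32 + 10 * d) + 5) * (d * M0) + 6 * M0 := by positivity
      have g2 := mul_le_mul_of_nonneg_left h3 g1
      have : (2 * N * (32 + 10 * d + 5) * (d * M0) + 8 * N * M0 * (2 * (32 + 10 * d) + 10) * (1 / σ) +
          (10 * d + 25) * (1 / σ) ^ 2 + 2 * (3 * M0)) =
        ((2 * N * ((32 + 10 * d) + 5) * (d * M0) + 6 * M0) * (σ * σ) +
          8 * N * M0 * (2 * (32 + 10 * d) + 10) * σ + (10 * d + 25)) * (1 / σ) ^ 2 := by
        field_simp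
        ring
      rw [this]
      have hp : 0 < (1 / σ) ^ 2 := by positivity
      apply mul_lt_mul_of_pos_right _ hp
      nlinarith)
  intro y hy hxy
  have := key y hy (by rw [e2]; exact hxy)
  simpa only [← sub_eq_add_neg] using this

theorem Chart.quot_grad (h : Chart Ω p R φ μ M0) (hΩ : IsOpen Ω) (hb : Bornology.IsBounded Ω)
    {A M t0 σ : ℝ} (hA : 2 ≤ A) (hA2 : 2 * d + 1 < A * (μ ^ 2 / 2)) (hM : 0 < M)
    {u : ℝ → Euc d → ℝ} (hu : HSol Ω u M) (hσ : SmallScale d R μ M0 σ) (hσt : σ ^ 2 = t0)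
    {x0 : Euc d} (hx0 : x0 ∈ Ω) (hx0p : x0 ∈ Metric.ball p (R / 4)) :
    ‖fderiv ℝ (fun y => u t0 y / φ y) x0‖ ≤ (2 * A * M) * (32 + 10 * d) / t0 := by
  have hs0 := hσ.pos
  have ht0 : 0 < t0 := by rw [← hσt]; positivity
  have hR := h.hR
  have hx0R : x0 ∈ Metric.ball p R := Metric.ball_subset_ball (by linarith) hx0p
  have hx0R2 : x0 ∈ Metric.ball p (R / 2) := Metric.ball_subset_ball (by linarith) hx0p
  have hφ0 := (h.pos x0 hx0R).2 hx0
  refine norm_fderiv_le_of_oneside (by positivity) ?_ ?_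
  · exact ((hu.smooth t0 ht0 x0 hx0).div (h.smooth x0 hx0R) hφ0.ne').differentiableAt (by norm_num)
  · have hVn : Ω ∩ Metric.ball p (R / 2) ∈ 𝓝 x0 :=
      (hΩ.inter Metric.isOpen_ball).mem_nhds ⟨hx0, hx0R2⟩
    filter_upwards [hVn, Metric.ball_mem_nhds x0 (show 0 < σ / 4 by positivity)] with y hy hy2
    have hxy : ‖x0 - y‖ ≤ σ / 4 := by
      rw [← dist_eq_norm, dist_comm]; exact (Metric.mem_ball.1 hy2).le
    have hlim : Tendsto (fun ε : ℝ => (u t0 x0 - ε) / φ x0 - (u t0 y + ε) / φ y) (𝓝[>] 0)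
        (𝓝 ((u t0 x0 - 0) / φ x0 - (u t0 y + 0) / φ y)) := by
      apply Tendsto.mono_left _ nhdsWithin_le_nhds
      apply Continuous.tendsto (f := fun ε : ℝ => (u t0 x0 - ε) / φ x0 - (u t0 y + ε) / φ y)
      fun_prop
    have := le_of_tendsto hlim (by
      filter_upwards [self_mem_nhdsWithin] with ε hε
      exact h.quot_lip hΩ hb hA hA2 hM hu hσ hσt hx0 hx0p hε y hy hxy)
    simp only [sub_zero, add_zero] at this
    refine this.trans (le_of_eq ?_)
    rw [← hσt]
    field_simp

end quot

section bdry
variable {d : ℕ} {Ω : Set (Euc d)} {p : Euc d} {R μ M0 : ℝ} {φ : Euc d → ℝ}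

theorem Chart.fderiv_split (h : Chart Ω p R φ μ M0) (hΩ : IsOpen Ω) {M s : ℝ}
    {u : ℝ → Euc d → ℝ} (hu : HSol Ω u M) (hs : 0 < s) {y : Euc d} (hy : y ∈ Ω)
    (hyR : y ∈ Metric.ball p R) :
    fderiv ℝ (u s) y = (u s y / φ y) • fderiv ℝ φ y + φ y • fderiv ℝ (fun z => u s z / φ z) y := by
  have hφ := (h.pos y hyR).2 hy
  have hd : DifferentiableAt ℝ (fun z => u s z / φ z) y :=
    ((hu.smooth s hs y hy).div (h.smooth y hyR) hφ.ne').differentiableAt (by norm_num)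
  have hφd : DifferentiableAt ℝ φ y := (h.smooth y hyR).differentiableAt (by norm_num)
  have e : u s =ᶠ[𝓝 y] fun z => (u s z / φ z) * φ z := by
    filter_upwards [hΩ.mem_nhds hy, Metric.isOpen_ball.mem_nhds hyR] with z h1 h2
    have := (h.pos z h2).2 h1
    field_simp
  rw [e.fderiv_eq, fderiv_fun_mul hd hφd]

/-- first order bounds for the quotient -/
theorem Chart.quot_bounds (h : Chart Ω p R φ μ M0) (hΩ : IsOpen Ω) (hb : Bornology.IsBounded Ω)
    {A M t σ s : ℝ} (hA : 2 ≤ A) (hA2 : 2 * d + 1 < A * (μ ^ 2 / 2)) (hM : 0 < M)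
    {u : ℝ → Euc d → ℝ} (hu : HSol Ω u M) (hσ : SmallScale d R μ M0 σ) (hσt : σ ^ 2 = t)
    (hs : s ∈ Set.Icc (t / 2) t) {y : Euc d} (hy : y ∈ Ω) (hyp : y ∈ Metric.ball p (R / 4)) :
    |u s y / φ y| ≤ 4 * A * M / σ ∧
      ‖fderiv ℝ (fun z => u s z / φ z) y‖ ≤ 4 * A * M * (32 + 10 * d) / t := by
  have hs0 := hσ.pos
  have hR := h.hR
  have ht0 : 0 < t := by rw [← hσt]; positivity
  have hs1 : 0 < s := by linarith [hs.1]
  have hst : 0 < √s := Real.sqrt_pos.2 hs1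
  have hsq : √s ^ 2 = s := Real.sq_sqrt hs1.le
  have hle : √s ≤ σ := by rw [Real.sqrt_le_left hs0.le]; linarith [hs.2]
  have hge : σ / 2 ≤ √s := by
    apply Real.le_sqrt_of_sq_le; nlinarith [hs.1]
  have hτ := hσ.mono h.hM0 hst hle
  have hyR : y ∈ Metric.ball p R := Metric.ball_subset_ball (by linarith) hyp
  have hy2 : y ∈ Metric.ball p (R / 2) := Metric.ball_subset_ball (by linarith) hyp
  have hφ := (h.pos y hyR).2 hy
  constructor
  · have := h.bound hΩ hb hA hA2 hM hu hτ hsq (t := s) ⟨by nlinarith, le_rfl⟩ ⟨hy, hy2⟩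
    rw [abs_div, abs_of_pos hφ, div_le_iff₀ hφ]
    refine this.trans ?_
    gcongr ?_ * _
    rw [div_le_div_iff₀ hst hs0]
    have : 0 < A * M := by positivity
    nlinarith
  · have := h.quot_grad hΩ hb hA hA2 hM hu hτ hsq hy hyp
    refine this.trans ?_
    rw [div_le_div_iff₀ hs1 ht0]
    have : 0 < A * M * (32 + 10 * d) := by positivity
    nlinarith [hs.1]

set_option maxHeartbeats 1000000 in
theorem Chart.est (h : Chart Ω p R φ μ M0) (hΩ : IsOpen Ω) (hb : Bornology.IsBounded Ω) :
    ∃ C > 0, ∃ T > 0, ∀ u M, 0 < M → HSol Ω u M → ∀ t ∈ Set.Ioo (0:ℝ) T,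
      ∀ x ∈ Ω ∩ Metric.ball p (R / 16),
        √t * ‖fderiv ℝ (u t) x‖ ≤ C * M ∧ t * ‖fderiv ℝ (fderiv ℝ (u t)) x‖ ≤ C * M := by
  obtain ⟨σ0, hσ0⟩ := SmallScale.exists d h.hR h.hμ h.hM0
  have hμ := h.hμ
  have hM0 := h.hM0
  have hR := h.hR
  have hd0 : (0:ℝ) ≤ d := by positivity
  set A := 2 + (4 * d + 4) / μ ^ 2 with hAdef
  have hA : 2 ≤ A := by
    have : 0 ≤ (4 * (d:ℝ) + 4) / μ ^ 2 := by positivity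
    linarith
  have hA2 : 2 * d + 1 < A * (μ ^ 2 / 2) := by
    have e : (4 * (d:ℝ) + 4) / μ ^ 2 * (μ ^ 2 / 2) = 2 * d + 2 := by field_simp; ring
    have : 0 < μ ^ 2 := by positivity
    rw [hAdef, add_mul, e]; linarith
  set K : ℝ := 32 + 10 * d with hK
  have hK0 : 0 < K := by positivity
  set c := 1 / (16 * (M0 + 1)) with hc
  have hc0 : 0 < c := by positivity
  have hc1 : c ≤ 1 / 16 := by
    rw [hc]; apply one_div_le_one_div_of_le (by norm_num); linarith
  have hMc : M0 * c ≤ 1 / 16 := by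
    rw [hc, mul_one_div, div_le_div_iff₀ (by positivity) (by norm_num)]; linarith
  set B := 4 * A * K * M0 + 4 * A * M0 + 16 * A * K with hB
  have hA0 : 0 < A := by linarith
  have hB0 : 0 < B := by positivity
  refine ⟨K / c + K ^ 2 / c ^ 2 + B + K * B / c, by positivity, σ0 ^ 2, by have := hσ0.pos; positivity, ?_⟩
  intro u M hM hu t ht x hx
  set σ := √t with hσdef
  have hs0 : 0 < σ := Real.sqrt_pos.2 ht.1
  have hσt : σ ^ 2 = t := Real.sq_sqrt ht.1.le
  have hσ : SmallScale d R μ M0 σ := by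
    apply hσ0.mono hM0 hs0
    rw [hσdef, Real.sqrt_le_left hσ0.pos.le]; exact ht.2.le
  have hσR := hσ.le_R
  have hσ1 := hσ.le_one
  have ht0 := ht.1
  have hxR : x ∈ Metric.ball p R := Metric.ball_subset_ball (by linarith) hx.2
  have hℓ : 0 < φ x := (h.pos x hxR).2 hx.1
  set ℓ := φ x with hℓdef
  have hxp := Metric.mem_ball.1 hx.2
  have p1 : 0 < K / c := by positivity
  have p2 : 0 < K ^ 2 / c ^ 2 := by positivity
  have p3 : 0 < K * B / c := by positivity
  rcases le_or_gt σ ℓ with hcase | hcase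
  · set δ := c * σ with hδ
    have hδ0 : 0 < δ := by positivity
    have hδσ : δ ≤ σ / 16 := by rw [hδ]; nlinarith
    have hin : Metric.ball x (5 * δ) ⊆ Ω := by
      intro y hy
      have hy' := Metric.mem_ball.1 hy
      have hyR : y ∈ Metric.ball p R := by
        rw [Metric.mem_ball]; linarith [dist_triangle y x p]
      rw [← h.pos y hyR]
      have := (abs_le.1 (h.lip hxR hyR)).1
      rw [← dist_eq_norm] at this
      have h2 : M0 * dist y x ≤ M0 * (5 * δ) := by gcongr
      have h3 : M0 * (5 * δ) = 5 * (M0 * c) * σ := by rw [hδ]; ring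
      nlinarith
    have hδt : δ ^ 2 ≤ t := by rw [← hσt]; apply pow_le_pow_left₀ hδ0.le; linarith
    have i1 := hu.interior1 hΩ hb hM hδ0 ((Metric.ball_subset_ball (by linarith)).trans hin)
      (t0 := t) (by linarith)
    have i2 := hu.interior2 hΩ hb hM hδ0 hin hδt
    constructor
    · calc σ * ‖fderiv ℝ (u t) x‖ ≤ σ * (K * M / δ) := by gcongr
        _ = K / c * M := by rw [hδ]; field_simp
        _ ≤ _ := by gcongr; linarith
    · calc t * ‖fderiv ℝ (fderiv ℝ (u t)) x‖ ≤ t * (K ^ 2 * M / δ ^ 2) := by gcongr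
        _ = K ^ 2 / c ^ 2 * M := by rw [hδ, ← hσt]; field_simp
        _ ≤ _ := by gcongr; linarith
  · set δ := c * ℓ with hδ
    have hδ0 : 0 < δ := by positivity
    have hδℓ : δ ≤ ℓ / 16 := by rw [hδ]; nlinarith
    have hδt : δ ^ 2 ≤ t := by rw [← hσt]; apply pow_le_pow_left₀ hδ0.le; linarith
    have hin : ∀ y ∈ Metric.ball x (3 * δ), y ∈ Ω ∧ y ∈ Metric.ball p (R / 4) ∧
        y ∈ Metric.ball p R ∧ 0 < φ y ∧ φ y ≤ 2 * ℓ := by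
      intro y hy
      have hy' := Metric.mem_ball.1 hy
      have hy4 : y ∈ Metric.ball p (R / 4) := by
        rw [Metric.mem_ball]; linarith [dist_triangle y x p]
      have hyR : y ∈ Metric.ball p R := Metric.ball_subset_ball (by linarith) hy4
      have := abs_le.1 (h.lip hxR hyR)
      rw [← dist_eq_norm] at this
      have h2 : M0 * dist y x ≤ M0 * (3 * δ) := by gcongr
      have h3 : M0 * (3 * δ) = 3 * (M0 * c) * ℓ := by rw [hδ]; ring
      have h4 : 3 * (M0 * c) * ℓ ≤ 3 / 16 * ℓ := by nlinarith
      have h5 : 0 < φ y := by linarith [this.1]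
      exact ⟨(h.pos y hyR).1 h5, hy4, hyR, h5, by linarith [this.2]⟩
    have hq := fun s (hs : s ∈ Set.Icc (t / 2) t) y (hy : y ∈ Ω) hyp =>
      h.quot_bounds hΩ hb hA hA2 hM hu hσ hσt hs hy (y := y) hyp
    constructor
    · have q := hq t ⟨by linarith, le_rfl⟩ x hx.1 (Metric.ball_subset_ball (by linarith) hx.2)
      rw [h.fderiv_split hΩ hu ht0 hx.1 hxR]
      have n1 : ‖(u t x / φ x) • fderiv ℝ φ x + φ x • fderiv ℝ (fun z => u t z / φ z) x‖ ≤
          4 * A * M / σ * M0 + σ * (4 * A * M * K / t) := by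
        refine (norm_add_le _ _).trans ?_
        rw [norm_smul, norm_smul, Real.norm_eq_abs, Real.norm_eq_abs, abs_of_pos hℓ]
        exact add_le_add (mul_le_mul q.1 (h.grad_ub x hxR) (norm_nonneg _) (by positivity))
          (mul_le_mul hcase.le q.2 (norm_nonneg _) hs0.le)
      calc _ ≤ σ * (4 * A * M / σ * M0 + σ * (4 * A * M * K / t)) := by gcongr
        _ = (4 * A * M0 + 4 * A * K) * M := by rw [← hσt]; field_simp
        _ ≤ _ := by
          apply mul_le_mul_of_nonneg_right _ hM.le
          have : 0 < A * K := by positivity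
          have : 0 < A * K * M0 := by positivity
          have : 0 < A * M0 := by positivity
          rw [hB]; linarith
    · set A' := B * ℓ * M / t with hA'
      have hosc : ∀ s ∈ Set.Ioc (t - δ ^ 2 / 2) t, ∀ y ∈ Metric.ball x (3 * δ),
          ∀ z ∈ Metric.ball x (3 * δ), ‖fderiv ℝ (u s) y - fderiv ℝ (u s) z‖ ≤ 2 * A' := by
        intro s hs y hy z hz
        have hs' : s ∈ Set.Icc (t / 2) t := ⟨by linarith [hs.1], hs.2⟩
        have hspos : 0 < s := by linarith [hs'.1]
        obtain ⟨y1, y2, y3, y4, y5⟩ := hin y hy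
        obtain ⟨z1, z2, z3, z4, z5⟩ := hin z hz
        have qy := hq s hs' y y1 y2
        have qz := hq s hs' z z1 z2
        have hyz : ‖y - z‖ ≤ ℓ := by
          rw [← dist_eq_norm]
          have := Metric.mem_ball.1 hy
          have := Metric.mem_ball'.1 hz
          linarith [dist_triangle y x z]
        have hW : |u s y / φ y - u s z / φ z| ≤ 4 * A * M * K / t * ‖y - z‖ := by
          have := (convex_ball x (3 * δ)).norm_image_sub_le_of_norm_fderiv_le (𝕜 := ℝ)
            (f := fun y => u s y / φ y) (C := 4 * A * M * K / t) (x := z) (y := y)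
            (fun v hv => by
              obtain ⟨v1, v2, v3, v4, v5⟩ := hin v hv
              exact ((hu.smooth s hspos v v1).div (h.smooth v v3) v4.ne').differentiableAt (by norm_num))
            (fun v hv => by
              obtain ⟨v1, v2, v3, v4, v5⟩ := hin v hv
              exact (hq s hs' v v1 v2).2) hz hy
          simpa using this
        rw [h.fderiv_split hΩ hu hspos y1 y3, h.fderiv_split hΩ hu hspos z1 z3]
        set wy := u s y / φ y
        set wz := u s z / φ z
        set Dw := fderiv ℝ (fun z => u s z / φ z)
        have e : wy • fderiv ℝ φ y + φ y • Dw y - (wz • fderiv ℝ φ z + φ z • Dw z) =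
          ((wy - wz) • fderiv ℝ φ y + wz • (fderiv ℝ φ y - fderiv ℝ φ z)) + (φ y • Dw y - φ z • Dw z) := by
          rw [sub_smul, smul_sub]; abel
        rw [e]
        have b1 : ‖(wy - wz) • fderiv ℝ φ y‖ ≤ 4 * A * M * K / t * ℓ * M0 := by
          rw [norm_smul, Real.norm_eq_abs]
          have := h.grad_ub y y3
          have : |wy - wz| ≤ 4 * A * M * K / t * ℓ := hW.trans (by gcongr)
          gcongr
        have b2 : ‖wz • (fderiv ℝ φ y - fderiv ℝ φ z)‖ ≤ 4 * A * M / t * (M0 * ℓ) := by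
          rw [norm_smul, Real.norm_eq_abs]
          have l1 := h.lipD z3 y3
          have l2 : M0 * ‖y - z‖ ≤ M0 * ℓ := by gcongr
          have l3 : 4 * A * M / σ ≤ 4 * A * M / t := by
            gcongr
            rw [← hσt]; nlinarith
          have := qz.1.trans l3
          have := l1.trans l2
          gcongr
        have b3 : ∀ v, 0 < φ v → φ v ≤ 2 * ℓ → ‖Dw v‖ ≤ 4 * A * M * K / t →
            ‖φ v • Dw v‖ ≤ 2 * ℓ * (4 * A * M * K / t) := by
          intro v v1 v2 v3
          rw [norm_smul, Real.norm_eq_abs, abs_of_pos v1]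
          gcongr
        have b4 := b3 y y4 y5 qy.2
        have b5 := b3 z z4 z5 qz.2
        have n1 := norm_add_le ((wy - wz) • fderiv ℝ φ y + wz • (fderiv ℝ φ y - fderiv ℝ φ z)) (φ y • Dw y - φ z • Dw z)
        have n2 := norm_add_le ((wy - wz) • fderiv ℝ φ y) (wz • (fderiv ℝ φ y - fderiv ℝ φ z))
        have n3 := norm_sub_le (φ y • Dw y) (φ z • Dw z)
        have fin : 4 * A * M * K / t * ℓ * M0 + 4 * A * M / t * (M0 * ℓ) +
          2 * (2 * ℓ * (4 * A * M * K / t)) = A' := by rw [hA', hB]; ring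
        have : 0 < A' := by positivity
        linarith
      have := interior_hess hδ0 (show 0 < A' by positivity)
        (hu.heatOn (fun y hy => (hin y hy).1) (by linarith)) hosc
      calc t * ‖fderiv ℝ (fderiv ℝ (u t)) x‖ ≤ t * (K * A' / δ) := by gcongr
        _ = K * B / c * M := by rw [hδ, hA']; field_simp
        _ ≤ _ := by gcongr; linarith

end bdry

section construct
variable {d : ℕ}

/-- Quantitative `C³` regularity on a ball. -/
structure Reg3 (F : Euc d → ℝ) (p : Euc d) (r L : ℝ) : Prop where
  hL : 0 ≤ L
  smooth : ∀ y ∈ Metric.ball p r, ContDiffAt ℝ 3 F y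
  b1 : ∀ y ∈ Metric.ball p r, ‖fderiv ℝ F y‖ ≤ L
  b2 : ∀ y ∈ Metric.ball p r, ‖fderiv ℝ (fderiv ℝ F) y‖ ≤ L
  lip2 : ∀ x ∈ Metric.ball p r, ∀ y ∈ Metric.ball p r,
    ‖fderiv ℝ (fderiv ℝ F) y - fderiv ℝ (fderiv ℝ F) x‖ ≤ L * ‖y - x‖

theorem norm_le_nhds {E : Type*} [NormedAddCommGroup E] {f : Euc d → E} {p : Euc d}
    (hf : ContinuousAt f p) : ∀ᶠ y in 𝓝 p, ‖f y‖ ≤ ‖f p‖ + 1 :=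
  (hf.norm.eventually (gt_mem_nhds (show ‖f p‖ < ‖f p‖ + 1 by linarith))).mono fun _ h => h.le

theorem exists_ball_of_eventually {P : Euc d → Prop} {p : Euc d} (h : ∀ᶠ y in 𝓝 p, P y) :
    ∃ r > 0, ∀ y ∈ Metric.ball p r, P y := by
  obtain ⟨r, hr, h⟩ := Metric.eventually_nhds_iff_ball.1 h
  exact ⟨r, hr, h⟩

theorem Reg3.exists {F : Euc d → ℝ} {p : Euc d} (hF : ContDiffAt ℝ 3 F p) :
    ∃ r > 0, ∃ L, Reg3 F p r L := by
  have h1 : ContDiffAt ℝ 2 (fderiv ℝ F) p := hF.fderiv_right (by norm_num)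
  have h2 : ContDiffAt ℝ 1 (fderiv ℝ (fderiv ℝ F)) p := h1.fderiv_right (by norm_num)
  obtain ⟨K, W, hW, hK⟩ := h2.exists_lipschitzOnWith
  have e := ((hF.eventually (by simp)).and (norm_le_nhds h1.continuousAt)).and
    ((norm_le_nhds h2.continuousAt).and (show ∀ᶠ y in 𝓝 p, y ∈ W from hW))
  obtain ⟨r, hr, h⟩ := exists_ball_of_eventually e
  have n1 := norm_nonneg (fderiv ℝ F p)
  have n2 := norm_nonneg (fderiv ℝ (fderiv ℝ F) p)
  have n3 : (0:ℝ) ≤ K := K.2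
  refine ⟨r, hr, (‖fderiv ℝ F p‖ + 1) + (‖fderiv ℝ (fderiv ℝ F) p‖ + 1) + K,
    by positivity, ?_, ?_, ?_, ?_⟩
  · exact fun y hy => (h y hy).1.1
  · intro y hy
    have m1 := (h y hy).1.2
    linarith
  · intro y hy
    have m1 := (h y hy).2.1
    linarith
  · intro x hx y hy
    have := hK.dist_le_mul y (h y hy).2.2 x (h x hx).2.2
    rw [dist_eq_norm, dist_eq_norm] at this
    refine this.trans ?_
    gcongr
    linarith

variable {F : Euc d → ℝ} {p : Euc d} {r L : ℝ}

theorem Reg3.lip1 (h : Reg3 F p r L) {x y : Euc d} (hx : x ∈ Metric.ball p r)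
    (hy : y ∈ Metric.ball p r) : ‖fderiv ℝ F y - fderiv ℝ F x‖ ≤ L * ‖y - x‖ :=
  (convex_ball p r).norm_image_sub_le_of_norm_fderiv_le (𝕜 := ℝ)
    (fun z hz => ((h.smooth z hz).fderiv_right (m := 1) (by norm_num)).differentiableAt (by simp))
    (fun z hz => h.b2 z hz) hx hy

theorem Reg3.taylor (h : Reg3 F p r L) {x y : Euc d} (hx : x ∈ Metric.ball p r)
    (hy : y ∈ Metric.ball p r) : |F y - F x - fderiv ℝ F x (y - x)| ≤ L * ‖y - x‖ ^ 2 := by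
  have hc : Convex ℝ (Metric.ball p r ∩ Metric.closedBall x ‖y - x‖) :=
    (convex_ball p r).inter (convex_closedBall x _)
  have := hc.norm_image_sub_le_of_norm_fderiv_le' (𝕜 := ℝ) (f := F) (φ := fderiv ℝ F x)
    (C := L * ‖y - x‖) (x := x) (y := y)
    (fun z hz => (h.smooth z hz.1).differentiableAt (by norm_num))
    (fun z hz => (h.lip1 hx hz.1).trans (by
      have := mem_closedBall_iff_norm.1 hz.2
      have := h.hL
      gcongr))
    ⟨hx, Metric.mem_closedBall_self (norm_nonneg _)⟩ ⟨hy, by rw [mem_closedBall_iff_norm]⟩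
  rw [Real.norm_eq_abs] at this
  refine this.trans (le_of_eq ?_)
  ring

/-- Function shifted by its own value. -/
noncomputable def shiftF (F : Euc d → ℝ) (c : ℝ) (i : Fin d) (x : Euc d) : ℝ := F (x + (c * F x) • bv i)

/-- Second difference at the scale of the function itself. -/
noncomputable def bump (F : Euc d → ℝ) (i : Fin d) (x : Euc d) : ℝ :=
  shiftF F 1 i x + shiftF F (-1) i x - 2 * F x

theorem Reg3.shift_jet (h : Reg3 F p r L) {c : ℝ} (hc : |c| = 1) (i j : Fin d) {x : Euc d}
    (hx : x ∈ Metric.ball p r) (hy : x + (c * F x) • bv i ∈ Metric.ball p r) :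
    ∃ b' b'' : ℝ, Jet (fun s : ℝ => shiftF F c i (x + s • bv j)) b' b'' ∧
      |b' - fderiv ℝ F x (bv j + (c * fderiv ℝ F x (bv j)) • bv i)| ≤ L * (1 + L) * |F x| ∧
      |b'' - (fderiv ℝ (fderiv ℝ F) x (bv j + (c * fderiv ℝ F x (bv j)) • bv i)
          (bv j + (c * fderiv ℝ F x (bv j)) • bv i) +
        fderiv ℝ F x ((c * fderiv ℝ (fderiv ℝ F) x (bv j) (bv j)) • bv i))| ≤
        (L * (1 + L) ^ 2 + L * L) * |F x| := by
  have hL := h.hL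
  have hs2 : ∀ y ∈ Metric.ball p r, ContDiffAt ℝ 2 F y := fun y hy => (h.smooth y hy).of_le (by norm_num)
  set v := bv j + (c * fderiv ℝ F x (bv j)) • bv i with hv
  set w := (c * fderiv ℝ (fderiv ℝ F) x (bv j) (bv j)) • (bv i : Euc d) with hw
  set y := x + (c * F x) • bv i with hydef
  have hyx : ‖y - x‖ = |F x| := by
    simp [hydef, norm_smul, hc]
  have n1 : |fderiv ℝ F x (bv j)| ≤ L := by
    have := (fderiv ℝ F x).le_opNorm (bv j)
    rw [norm_bv, mul_one] at this
    exact this.trans (h.b1 x hx)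
  have n2 : |fderiv ℝ (fderiv ℝ F) x (bv j) (bv j)| ≤ L := by
    have := (fderiv ℝ (fderiv ℝ F) x).le_opNorm₂ (bv j) (bv j)
    rw [norm_bv, mul_one, mul_one] at this
    exact this.trans (h.b2 x hx)
  have nv : ‖v‖ ≤ 1 + L := by
    refine (norm_add_le _ _).trans ?_
    rw [norm_smul, norm_bv, norm_bv, Real.norm_eq_abs, abs_mul, hc]
    linarith
  have nw : ‖w‖ ≤ L := by
    rw [hw, norm_smul, norm_bv, Real.norm_eq_abs, abs_mul, hc]
    linarith
  have hγ : Jet (fun s : ℝ => (x + s • bv j) + (c * F (x + s • bv j)) • bv i) v w := by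
    have := (Jet.line x (bv j)).add (((Jet.of_contDiffAt (hs2 x hx) (bv j)).const_mul c).smul (bv i))
    simpa using this
  have hJ := Jet.comp (f := F) (γ := fun s : ℝ => (x + s • bv j) + (c * F (x + s • bv j)) • bv i)
    (by simpa using hs2 y hy) hγ
  have e0 : (x + (0:ℝ) • bv j) + (c * F (x + (0:ℝ) • bv j)) • bv i = y := by simp [hydef]
  simp only [e0] at hJ
  have l1 := h.lip1 hx hy
  have l2 := h.lip2 x hx y hy
  rw [hyx] at l1 l2
  have k1 : ∀ z : Euc d, ∀ m, ‖z‖ ≤ m → |fderiv ℝ F y z - fderiv ℝ F x z| ≤ L * |F x| * m := by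
    intro z m hz
    have := (fderiv ℝ F y - fderiv ℝ F x).le_opNorm z
    rw [sub_apply, Real.norm_eq_abs] at this
    refine this.trans ?_
    gcongr
  have k2 : |fderiv ℝ (fderiv ℝ F) y v v - fderiv ℝ (fderiv ℝ F) x v v| ≤ L * |F x| * (1 + L) * (1 + L) := by
    have := (fderiv ℝ (fderiv ℝ F) y - fderiv ℝ (fderiv ℝ F) x).le_opNorm₂ v v
    rw [sub_apply, sub_apply, Real.norm_eq_abs] at this
    refine this.trans ?_
    gcongr
  refine ⟨_, _, hJ, ?_, ?_⟩
  · refine (k1 v _ nv).trans (le_of_eq (by ring))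
  · have q := k1 w _ nw
    have := abs_add_le (fderiv ℝ (fderiv ℝ F) y v v - fderiv ℝ (fderiv ℝ F) x v v)
      (fderiv ℝ F y w - fderiv ℝ F x w)
    rw [show fderiv ℝ (fderiv ℝ F) y v v + fderiv ℝ F y w -
      (fderiv ℝ (fderiv ℝ F) x v v + fderiv ℝ F x w) =
      (fderiv ℝ (fderiv ℝ F) y v v - fderiv ℝ (fderiv ℝ F) x v v) +
      (fderiv ℝ F y w - fderiv ℝ F x w) by ring]
    linarith

theorem Reg3.bump_jet (h : Reg3 F p r L) (i j : Fin d) {x : Euc d}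
    (hx : x ∈ Metric.ball p r) (hy1 : x + ((1:ℝ) * F x) • bv i ∈ Metric.ball p r)
    (hy2 : x + ((-1:ℝ) * F x) • bv i ∈ Metric.ball p r) :
    ∃ b' b'' : ℝ, Jet (fun s : ℝ => bump F i (x + s • bv j)) b' b'' ∧
      |b'| ≤ 2 * (L * (1 + L) ^ 2 + L * L) * |F x| ∧
      |b'' - 2 * (fderiv ℝ F x (bv j)) ^ 2 * fderiv ℝ (fderiv ℝ F) x (bv i) (bv i)| ≤
        2 * (L * (1 + L) ^ 2 + L * L) * |F x| := by
  have hL := h.hL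
  obtain ⟨a', a'', J1, h1, h2⟩ := h.shift_jet (c := 1) (by simp) i j hx hy1
  obtain ⟨b', b'', J2, k1, k2⟩ := h.shift_jet (c := -1) (by simp) i j hx hy2
  have hs : ContDiffAt ℝ 2 F x := (h.smooth x hx).of_le (by norm_num)
  refine ⟨_, _, (J1.add J2).sub ((Jet.of_contDiffAt hs (bv j)).const_mul 2), ?_, ?_⟩
  · simp only [map_add, map_smul, smul_eq_mul] at h1 k1
    have : L * (1 + L) * |F x| ≤ (L * (1 + L) ^ 2 + L * L) * |F x| := by
      gcongr; nlinarith [mul_nonneg hL hL]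
    have h1' := abs_le.1 h1
    have k1' := abs_le.1 k1
    rw [abs_le]; constructor <;> linarith [h1'.1, h1'.2, k1'.1, k1'.2]
  · simp only [map_add, map_smul, smul_eq_mul, add_apply, smul_apply] at h2 k2
    have h1' := abs_le.1 h2
    have k1' := abs_le.1 k2
    rw [abs_le]; constructor <;> nlinarith [h1'.1, h1'.2, k1'.1, k1'.2]

theorem Reg3.bump_le (h : Reg3 F p r L) (i : Fin d) {x : Euc d}
    (hx : x ∈ Metric.ball p r) (hy1 : x + ((1:ℝ) * F x) • bv i ∈ Metric.ball p r)
    (hy2 : x + ((-1:ℝ) * F x) • bv i ∈ Metric.ball p r) :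
    |bump F i x| ≤ 2 * L * |F x| ^ 2 := by
  have t1 := h.taylor hx hy1
  have t2 := h.taylor hx hy2
  have e1 : ‖x + ((1:ℝ) * F x) • bv i - x‖ = |F x| := by simp [norm_smul]
  have e2 : ‖x + ((-1:ℝ) * F x) • bv i - x‖ = |F x| := by simp [norm_smul]
  rw [e1] at t1
  rw [e2] at t2
  simp only [add_sub_cancel_left, map_smul, smul_eq_mul] at t1 t2
  unfold bump shiftF
  have t1' := abs_le.1 t1
  have t2' := abs_le.1 t2
  rw [abs_le]; constructor <;> linarith [t1'.1, t1'.2, t2'.1, t2'.2]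

theorem bump_smooth {F : Euc d → ℝ} (i : Fin d) {x : Euc d} (hx : ContDiffAt ℝ 2 F x)
    (hy1 : ContDiffAt ℝ 2 F (x + ((1:ℝ) * F x) • bv i))
    (hy2 : ContDiffAt ℝ 2 F (x + ((-1:ℝ) * F x) • bv i)) : ContDiffAt ℝ 2 (bump F i) x := by
  have key : ∀ c : ℝ, ContDiffAt ℝ 2 F (x + (c * F x) • bv i) → ContDiffAt ℝ 2 (shiftF F c i) x := by
    intro c hc
    have : ContDiffAt ℝ 2 (fun x => x + (c * F x) • (bv i : Euc d)) x :=
      contDiffAt_id.add ((contDiffAt_const.mul hx).smul contDiffAt_const)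
    exact ContDiffAt.comp (f := fun x => x + (c * F x) • (bv i : Euc d)) (g := F) x hc this
  exact ((key 1 hy1).add (key (-1) hy2)).sub (contDiffAt_const.mul hx)

end construct

section construct2
variable {d : ℕ}

/-- Squared length of the gradient. -/
noncomputable def gradSq (F : Euc d → ℝ) (x : Euc d) : ℝ := ∑ j, (fderiv ℝ F x (bv j)) ^ 2

/-- Corrected defining function, whose Laplacian vanishes on the zero set. -/
noncomputable def chartF (F : Euc d → ℝ) (x : Euc d) : ℝ :=
  F x - 1 / 2 * ((gradSq F x)⁻¹ * ∑ i, bump F i x)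

variable {F : Euc d → ℝ} {p : Euc d} {r L L' : ℝ}

theorem chartF_smooth {x : Euc d} (hx : ContDiffAt ℝ 2 F x)
    (hN : ContDiffAt ℝ 2 (fun y => (gradSq F y)⁻¹) x)
    (hy1 : ∀ i, ContDiffAt ℝ 2 F (x + ((1:ℝ) * F x) • bv i))
    (hy2 : ∀ i, ContDiffAt ℝ 2 F (x + ((-1:ℝ) * F x) • bv i)) : ContDiffAt ℝ 2 (chartF F) x := by
  refine hx.sub (contDiffAt_const.mul (hN.mul ?_))
  exact ContDiffAt.sum fun i _ => bump_smooth i hx (hy1 i) (hy2 i)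

theorem abs_sum_le_card {f : Fin d → ℝ} {c : ℝ} (h : ∀ i, |f i| ≤ c) : |∑ i, f i| ≤ d * c := by
  refine (Finset.abs_sum_le_sum_abs _ _).trans ?_
  refine (Finset.sum_le_card_nsmul _ _ c fun i _ => h i).trans ?_
  simp

theorem Reg3.sum_bump_le (h : Reg3 F p r L) {x : Euc d}
    (hx : x ∈ Metric.ball p r) (hy1 : ∀ i, x + ((1:ℝ) * F x) • bv i ∈ Metric.ball p r)
    (hy2 : ∀ i, x + ((-1:ℝ) * F x) • bv i ∈ Metric.ball p r) :
    |∑ i, bump F i x| ≤ d * (2 * L * |F x| ^ 2) :=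
  abs_sum_le_card fun i => h.bump_le i hx (hy1 i) (hy2 i)

theorem Reg3.chartF_sub (h : Reg3 F p r L) {x : Euc d}
    (hx : x ∈ Metric.ball p r) (hy1 : ∀ i, x + ((1:ℝ) * F x) • bv i ∈ Metric.ball p r)
    (hy2 : ∀ i, x + ((-1:ℝ) * F x) • bv i ∈ Metric.ball p r)
    (hN0 : |(gradSq F x)⁻¹| ≤ L') : |chartF F x - F x| ≤ L' * d * L * |F x| * |F x| := by
  have := h.sum_bump_le hx hy1 hy2
  have hL := h.hL
  have e : chartF F x - F x = - (1 / 2 * ((gradSq F x)⁻¹ * ∑ i, bump F i x)) := by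
    rw [chartF]; ring
  rw [e, abs_neg, abs_mul, abs_mul]
  have h0 : 0 ≤ L' := (abs_nonneg _).trans hN0
  calc |(1:ℝ) / 2| * (|(gradSq F x)⁻¹| * |∑ i, bump F i x|) ≤ |(1:ℝ)/2| * (L' * (d * (2 * L * |F x| ^ 2))) := by
        gcongr
    _ = _ := by rw [abs_of_pos (by norm_num : (0:ℝ) < 1/2)]; ring

theorem Reg3.chartF_lap (h : Reg3 F p r L) {x : Euc d}
    (hx : x ∈ Metric.ball p r) (hy1 : ∀ i, x + ((1:ℝ) * F x) • bv i ∈ Metric.ball p r)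
    (hy2 : ∀ i, x + ((-1:ℝ) * F x) • bv i ∈ Metric.ball p r)
    (hN : ContDiffAt ℝ 2 (fun y => (gradSq F y)⁻¹) x) (hg : gradSq F x ≠ 0)
    (hN0 : |(gradSq F x)⁻¹| ≤ L') (hN1 : ‖fderiv ℝ (fun y => (gradSq F y)⁻¹) x‖ ≤ L')
    (hN2 : ‖fderiv ℝ (fderiv ℝ (fun y => (gradSq F y)⁻¹)) x‖ ≤ L') (hF1 : |F x| ≤ 1) :
    (F x = 0 → ∀ j, fderiv ℝ (chartF F) x (bv j) = fderiv ℝ F x (bv j)) ∧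
    |lap (chartF F) x| ≤ d * (d * L' * (L + 2 * (2 * (L * (1 + L) ^ 2 + L * L)))) * |F x| := by
  have hL := h.hL
  have hL' : 0 ≤ L' := (abs_nonneg _).trans hN0
  have hs2 : ∀ y ∈ Metric.ball p r, ContDiffAt ℝ 2 F y := fun y hy => (h.smooth y hy).of_le (by norm_num)
  have hφ := chartF_smooth (hs2 x hx) hN (fun i => hs2 _ (hy1 i)) (fun i => hs2 _ (hy2 i))
  set K0 := 2 * (L * (1 + L) ^ 2 + L * L) with hK0
  have hK00 : 0 ≤ K0 := by positivity
  choose b' b'' hJ hb1 hb2 using fun j i => h.bump_jet i j hx (hy1 i) (hy2 i)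
  set N := fun y => (gradSq F y)⁻¹ with hNdef
  have hB := h.sum_bump_le hx hy1 hy2
  set B := ∑ i, bump F i x with hBdef
  have hjet : ∀ j, Jet (fun s : ℝ => chartF F (x + s • bv j))
      (fderiv ℝ F x (bv j) - 1 / 2 * (fderiv ℝ N x (bv j) * B + N x * ∑ i, b' j i))
      (fderiv ℝ (fderiv ℝ F) x (bv j) (bv j) - 1 / 2 * (fderiv ℝ (fderiv ℝ N) x (bv j) (bv j) * B +
        2 * (fderiv ℝ N x (bv j) * ∑ i, b' j i) + N x * ∑ i, b'' j i)) := by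
    intro j
    have := (Jet.of_contDiffAt (hs2 x hx) (bv j)).sub
      (((Jet.of_contDiffAt hN (bv j)).mul (Jet.sum Finset.univ (fun i _ => hJ j i))).const_mul (1 / 2))
    simp only [zero_smul, add_zero] at this
    exact this
  constructor
  · intro hF0 j
    rw [((Jet.of_contDiffAt hφ (bv j)).unique (hjet j)).1]
    have z1 : B = 0 := by
      rw [hF0] at hB
      have : |B| ≤ 0 := by simpa using hB
      exact abs_nonpos_iff.1 this
    have z2 : ∀ i, b' j i = 0 := by
      intro i
      have := hb1 j i
      rw [hF0, abs_zero, mul_zero] at this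
      exact abs_nonpos_iff.1 this
    simp [z1, z2]
  · rw [lap_of_jets hφ hjet]
    set D := ∑ i, fderiv ℝ (fderiv ℝ F) x (bv i) (bv i) with hD
    have hsum0 : ∑ j, (fderiv ℝ (fderiv ℝ F) x (bv j) (bv j) - N x * (fderiv ℝ F x (bv j)) ^ 2 * D) = 0 := by
      rw [Finset.sum_sub_distrib, ← Finset.sum_mul, ← Finset.mul_sum, ← hD]
      have : N x * gradSq F x = 1 := inv_mul_cancel₀ hg
      unfold gradSq at this
      rw [this]; ring
    rw [← sub_zero (∑ j, _), ← hsum0, ← Finset.sum_sub_distrib, mul_assoc]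
    refine abs_sum_le_card fun j => ?_
    have a1 : |∑ i, b' j i| ≤ d * (K0 * |F x|) := abs_sum_le_card fun i => hb1 j i
    have a2 : |∑ i, b'' j i - 2 * (fderiv ℝ F x (bv j)) ^ 2 * D| ≤ d * (K0 * |F x|) := by
      rw [hD, Finset.mul_sum, ← Finset.sum_sub_distrib]
      exact abs_sum_le_card fun i => hb2 j i
    have a3 : |B| ≤ d * (2 * L * |F x|) := by
      refine hB.trans ?_
      gcongr
      nlinarith [abs_nonneg (F x)]
    have n1 : |fderiv ℝ N x (bv j)| ≤ L' := by
      have := (fderiv ℝ N x).le_opNorm (bv j)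
      rw [norm_bv, mul_one] at this
      exact this.trans hN1
    have n2 : |fderiv ℝ (fderiv ℝ N) x (bv j) (bv j)| ≤ L' := by
      have := (fderiv ℝ (fderiv ℝ N) x).le_opNorm₂ (bv j) (bv j)
      rw [norm_bv, mul_one, mul_one] at this
      exact this.trans hN2
    have m1 : |fderiv ℝ (fderiv ℝ N) x (bv j) (bv j) * B| ≤ L' * (d * (2 * L * |F x|)) := by
      rw [abs_mul]; exact mul_le_mul n2 a3 (abs_nonneg _) hL'
    have m2 : |fderiv ℝ N x (bv j) * ∑ i, b' j i| ≤ L' * (d * (K0 * |F x|)) := by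
      rw [abs_mul]; exact mul_le_mul n1 a1 (abs_nonneg _) hL'
    have m3 : |N x * (∑ i, b'' j i - 2 * (fderiv ℝ F x (bv j)) ^ 2 * D)| ≤ L' * (d * (K0 * |F x|)) := by
      rw [abs_mul]; exact mul_le_mul hN0 a2 (abs_nonneg _) hL'
    have pos : 0 ≤ L' * (d * (K0 * |F x|)) := by positivity
    have m1' := abs_le.1 m1
    have m2' := abs_le.1 m2
    have m3' := abs_le.1 m3
    rw [abs_le]
    constructor <;> linarith [m1'.1, m1'.2, m2'.1, m2'.2, m3'.1, m3'.2]

theorem gradSq_pos {x : Euc d} (h : fderiv ℝ F x ≠ 0) : 0 < gradSq F x := by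
  have h0 : 0 ≤ gradSq F x := Finset.sum_nonneg fun i _ => sq_nonneg _
  refine lt_of_le_of_ne h0 fun h1 => h ?_
  have h2 := (Finset.sum_eq_zero_iff_of_nonneg (fun i _ => sq_nonneg (fderiv ℝ F x (bv i)))).1 h1.symm
  ext v
  rw [← sum_bv v, map_sum]
  simp only [map_smul]
  simp [fun i => pow_eq_zero_iff (two_ne_zero) |>.1 (h2 i (Finset.mem_univ i))]

set_option maxHeartbeats 1000000 in
theorem exists_chart {Ω : Set (Euc d)} (h3 : HasCkBoundary Ω 3) (hp : p ∈ frontier Ω) :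
    ∃ R φ μ M0, Chart Ω p R φ μ M0 := by
  obtain ⟨U, ρ, hU, hpU, hρ, hρ', hin, hfr⟩ := h3 p hp
  set F : Euc d → ℝ := fun y => - ρ y with hFdef
  have hρ3 : ContDiffAt ℝ 3 ρ p := by
    have := hρ.contDiffAt (hU.mem_nhds hpU)
    exact_mod_cast this
  have hF : ContDiffAt ℝ 3 F p := hρ3.neg
  have hF2 : ContDiffAt ℝ 2 F p := hF.of_le (by norm_num)
  have hFp : F p = 0 := by
    have : p ∈ {y ∈ U | ρ y = 0} := by rw [← hfr]; exact ⟨hp, hpU⟩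
    simp [hFdef, this.2]
  have hDF : fderiv ℝ F p ≠ 0 := by
    have : fderiv ℝ F p = - fderiv ℝ ρ p := fderiv_fun_neg
    rw [this]; exact neg_ne_zero.2 (hρ' p hpU)
  have hFc : ContinuousAt F p := hF.continuousAt
  obtain ⟨r, hr, L, hreg⟩ := Reg3.exists hF
  have hL := hreg.hL
  have hg0 := gradSq_pos hDF
  have hgs : ContDiffAt ℝ 2 (gradSq F) p := by
    have h1 : ContDiffAt ℝ 2 (fderiv ℝ F) p := hF.fderiv_right (by norm_num)
    exact ContDiffAt.sum fun j _ => (h1.clm_apply contDiffAt_const).pow 2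
  set N := fun y => (gradSq F y)⁻¹ with hNdef
  have hN : ContDiffAt ℝ 2 N p := hgs.inv hg0.ne'
  have hN1 : ContDiffAt ℝ 1 (fderiv ℝ N) p := hN.fderiv_right (by norm_num)
  have hN2 : ContDiffAt ℝ 0 (fderiv ℝ (fderiv ℝ N)) p := hN1.fderiv_right (by norm_num)
  have hφ : ContDiffAt ℝ 2 (chartF F) p :=
    chartF_smooth hF2 hN (fun i => by simpa [hFp] using hF2) (fun i => by simpa [hFp] using hF2)
  have hφ1 : ContDiffAt ℝ 1 (fderiv ℝ (chartF F)) p := hφ.fderiv_right (by norm_num)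
  have hφ2 : ContDiffAt ℝ 0 (fderiv ℝ (fderiv ℝ (chartF F))) p := hφ1.fderiv_right (by norm_num)
  set L' := (‖N p‖ + 1) + (‖fderiv ℝ N p‖ + 1) + (‖fderiv ℝ (fderiv ℝ N) p‖ + 1) with hL'
  have q0 := norm_nonneg (N p)
  have q1 := norm_nonneg (fderiv ℝ N p)
  have q2 := norm_nonneg (fderiv ℝ (fderiv ℝ N) p)
  have hL'0 : 0 ≤ L' := by positivity
  set C' := d * (d * L' * (L + 2 * (2 * (L * (1 + L) ^ 2 + L * L)))) with hC'
  have hC'0 : 0 ≤ C' := by positivity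
  have hpr : p ∈ Metric.ball p r := Metric.mem_ball_self hr
  have hpl := hreg.chartF_lap (L' := L') hpr (fun i => by simpa [hFp] using hr)
    (fun i => by simpa [hFp] using hr) hN hg0.ne'
    (by change ‖N p‖ ≤ L'; linarith) (by change ‖fderiv ℝ N p‖ ≤ L'; linarith)
    (by change ‖fderiv ℝ (fderiv ℝ N) p‖ ≤ L'; linarith) (by simp [hFp])
  have hDφ : fderiv ℝ (chartF F) p = fderiv ℝ F p := by
    ext v
    rw [← sum_bv v, map_sum, map_sum]
    refine Finset.sum_congr rfl fun i _ => ?_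
    rw [map_smul, map_smul, hpl.1 hFp i]
  have hφp : chartF F p = 0 := by
    have := hreg.chartF_sub (L' := L') hpr (fun i => by simpa [hFp] using hr)
      (fun i => by simpa [hFp] using hr) (by change ‖N p‖ ≤ L'; linarith)
    rw [hFp] at this
    simpa using this
  have hn0 : 0 < ‖fderiv ℝ (chartF F) p‖ := by rw [hDφ]; exact norm_pos_iff.2 hDF
  set μ := ‖fderiv ℝ (chartF F) p‖ / 2 with hμ
  have hμ0 : 0 < μ := by positivity
  set M0 := (‖fderiv ℝ (chartF F) p‖ + 1) + (‖fderiv ℝ (fderiv ℝ (chartF F)) p‖ + 1) + 2 * C' with hM0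
  have q3 := norm_nonneg (fderiv ℝ (fderiv ℝ (chartF F)) p)
  have hM00 : 0 < M0 := by positivity
  have hsh : ∀ c : ℝ, ∀ i : Fin d, ∀ᶠ y in 𝓝 p, y + (c * F y) • bv i ∈ Metric.ball p r := by
    intro c i
    have hc : ContinuousAt (fun y : Euc d => y + (c * F y) • (bv i : Euc d)) p := by fun_prop
    apply hc.eventually_mem
    simpa [hFp] using Metric.ball_mem_nhds p hr
  have e1 : ∀ᶠ y in 𝓝 p, y ∈ Metric.ball p r := Metric.ball_mem_nhds p hr
  have e2 := eventually_all.2 (hsh 1)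
  have e3 := eventually_all.2 (hsh (-1))
  have e4 := norm_le_nhds hN.continuousAt
  have e5 := norm_le_nhds hN1.continuousAt
  have e6 := norm_le_nhds hN2.continuousAt
  have e7 : ∀ᶠ y in 𝓝 p, 0 < gradSq F y := hgs.continuousAt.eventually (lt_mem_nhds hg0)
  have e8 : ∀ᶠ y in 𝓝 p, |F y| < 1 := by
    have := hFc.abs.eventually (gt_mem_nhds (show |F p| < 1 by simp [hFp]))
    exact this
  have e9 : ∀ᶠ y in 𝓝 p, L' * d * L * |F y| < 1 / 2 := by
    have : ContinuousAt (fun y => L' * d * L * |F y|) p := continuousAt_const.mul hFc.abs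
    exact this.eventually (gt_mem_nhds (by simp [hFp]))
  have e10 : ∀ᶠ y in 𝓝 p, y ∈ U := hU.mem_nhds hpU
  have e11 := hφ.eventually (by simp)
  have e12 := norm_le_nhds hφ1.continuousAt
  have e13 := norm_le_nhds hφ2.continuousAt
  have e14 : ∀ᶠ y in 𝓝 p, μ < ‖fderiv ℝ (chartF F) y‖ :=
    hφ1.continuousAt.norm.eventually (lt_mem_nhds (by rw [hμ]; linarith))
  have e15 : ∀ᶠ y in 𝓝 p, 2 * M0 / μ ^ 2 * chartF F y < 1 / 4 := by
    have : ContinuousAt (fun y => 2 * M0 / μ ^ 2 * chartF F y) p :=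
      continuousAt_const.mul hφ.continuousAt
    exact this.eventually (gt_mem_nhds (by simp [hφp]))
  have e16 : ∀ᶠ y in 𝓝 p, ContDiffAt ℝ 2 N y := hN.eventually (by simp)
  obtain ⟨R, hR, hb⟩ := exists_ball_of_eventually
    ((((e1.and e2).and (e3.and e4)).and ((e5.and e6).and (e7.and e8))).and
    (((e9.and e10).and (e11.and e12)).and ((e13.and e14).and (e15.and e16))))
  have key : ∀ y ∈ Metric.ball p R, |chartF F y - F y| ≤ 1 / 2 * |F y| := by
    intro y hy
    obtain ⟨⟨⟨⟨b1, b2⟩, b3, b4⟩, ⟨b5, b6⟩, b7, b8⟩, ⟨⟨b9, b10⟩, b11, b12⟩, ⟨b13, b14⟩, b15, b16⟩ := hb y hy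
    refine (hreg.chartF_sub (L' := L') b1 b2 b3 (by change ‖N y‖ ≤ L'; linarith)).trans ?_
    gcongr
  refine ⟨R, chartF F, μ, M0, hR, hμ0, hM00, ?_, ?_, ?_, ?_, ?_, ?_, ?_, ?_⟩
  all_goals
    intro y hy
    have hk := key y hy
    obtain ⟨⟨⟨⟨b1, b2⟩, b3, b4⟩, ⟨b5, b6⟩, b7, b8⟩, ⟨⟨b9, b10⟩, b11, b12⟩, ⟨b13, b14⟩, b15, b16⟩ := hb y hy
  · exact b11
  · exact b14.le
  · linarith
  · linarith
  · have := (hreg.chartF_lap (L' := L') b1 b2 b3 b16 b7.ne' (by change ‖N y‖ ≤ L'; linarith)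
      (by change ‖fderiv ℝ N y‖ ≤ L'; linarith)
      (by change ‖fderiv ℝ (fderiv ℝ N) y‖ ≤ L'; linarith) b8.le).2
    have h2 : |F y| ≤ 2 * |chartF F y| := by
      have := abs_sub_abs_le_abs_sub (F y) (chartF F y)
      rw [abs_sub_comm] at this
      linarith
    calc |lap (chartF F) y| ≤ C' * |F y| := this
      _ ≤ C' * (2 * |chartF F y|) := by gcongr
      _ = (2 * C') * |chartF F y| := by ring
      _ ≤ M0 * |chartF F y| := by gcongr; linarith
  · have hΩy : y ∈ Ω ↔ 0 < F y := by
      have : y ∈ Ω ∩ U ↔ y ∈ {y ∈ U | ρ y < 0} := by rw [hin]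
      constructor
      · intro h
        have := (this.1 ⟨h, b10⟩).2
        simp only [hFdef]; linarith
      · intro h
        exact (this.2 ⟨b10, by simp only [hFdef] at h; linarith⟩).1
    rw [hΩy]
    have := abs_le.1 hk
    constructor
    · intro h
      by_contra hn
      push Not at hn
      rw [abs_of_nonpos hn] at this
      linarith [this.2]
    · intro h
      rw [abs_of_pos h] at this
      linarith [this.1]
  · intro hyf
    have : y ∈ {y ∈ U | ρ y = 0} := by rw [← hfr]; exact ⟨hyf, b10⟩
    have h0 : F y = 0 := by simp [hFdef, this.2]
    rw [h0] at hk
    simpa using hk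
  · exact b15.le

end construct2

section assembly
variable {d : ℕ} {Ω : Set (Euc d)}

/-- Uniform estimate on a set. -/
def EstOn (Ω S : Set (Euc d)) : Prop :=
  ∃ C > 0, ∃ T > 0, ∀ u M, 0 < M → HSol Ω u M → ∀ t ∈ Set.Ioo (0:ℝ) T, ∀ x ∈ Ω ∩ S,
    √t * ‖fderiv ℝ (u t) x‖ ≤ C * M ∧ t * ‖fderiv ℝ (fderiv ℝ (u t)) x‖ ≤ C * M

theorem EstOn.interior (hΩ : IsOpen Ω) (hb : Bornology.IsBounded Ω) {x0 : Euc d} (hx0 : x0 ∈ Ω) :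
    ∃ r > 0, EstOn Ω (Metric.ball x0 r) := by
  obtain ⟨r, hr, hball⟩ := Metric.isOpen_iff.1 hΩ x0 hx0
  refine ⟨r / 2, by positivity, (32 + 10 * d) + (32 + 10 * d) ^ 2, by positivity, (r / 10) ^ 2, by positivity, ?_⟩
  intro u M hM hu t ht x hx
  have hs : 0 < √t := Real.sqrt_pos.2 ht.1
  have hsq : √t ^ 2 = t := Real.sq_sqrt ht.1.le
  have hle : √t ≤ r / 10 := by
    rw [Real.sqrt_le_left (by positivity)]; exact ht.2.le
  have hin : Metric.ball x (5 * √t) ⊆ Ω := by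
    refine (Metric.ball_subset_ball' ?_).trans hball
    have := Metric.mem_ball.1 hx.2
    linarith
  have ht0 := ht.1
  have i1 := hu.interior1 hΩ hb hM hs ((Metric.ball_subset_ball (by linarith)).trans hin)
    (t0 := t) (by rw [hsq]; linarith)
  have i2 := hu.interior2 hΩ hb hM hs hin hsq.le
  have p1 : (0:ℝ) < 32 + 10 * d := by positivity
  constructor
  · calc √t * ‖fderiv ℝ (u t) x‖ ≤ √t * ((32 + 10 * d) * M / √t) := by gcongr
      _ = (32 + 10 * d) * M := by field_simp
      _ ≤ _ := mul_le_mul_of_nonneg_right (by linarith [pow_pos p1 2]) hM.le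
  · calc t * ‖fderiv ℝ (fderiv ℝ (u t)) x‖ ≤ t * ((32 + 10 * d) ^ 2 * M / √t ^ 2) := by gcongr
      _ = (32 + 10 * d) ^ 2 * M := by rw [hsq]; field_simp
      _ ≤ _ := by gcongr; linarith

theorem EstOn.closure (hΩ : IsOpen Ω) (hb : Bornology.IsBounded Ω) (h3 : HasCkBoundary Ω 3) :
    EstOn Ω (_root_.closure Ω) := by
  have hc : IsCompact (_root_.closure Ω) := hb.isCompact_closure
  refine hc.induction_on (p := EstOn Ω) ?_ ?_ ?_ ?_
  · exact ⟨1, one_pos, 1, one_pos, fun u M _ _ t _ x hx => absurd hx.2 (Set.notMem_empty x)⟩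
  · rintro s t hst ⟨C, hC, T, hT, h⟩
    exact ⟨C, hC, T, hT, fun u M hM hu t ht x hx => h u M hM hu t ht x ⟨hx.1, hst hx.2⟩⟩
  · rintro s t ⟨C, hC, T, hT, h⟩ ⟨C', hC', T', hT', h'⟩
    refine ⟨C + C', by positivity, min T T', lt_min hT hT', fun u M hM hu t ht x hx => ?_⟩
    have p1 : 0 < C * M := by positivity
    have p2 : 0 < C' * M := by positivity
    rcases hx.2 with hx2 | hx2
    · have := h u M hM hu t ⟨ht.1, ht.2.trans_le (min_le_left _ _)⟩ x ⟨hx.1, hx2⟩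
      constructor <;> linarith [this.1, this.2]
    · have := h' u M hM hu t ⟨ht.1, ht.2.trans_le (min_le_right _ _)⟩ x ⟨hx.1, hx2⟩
      constructor <;> linarith [this.1, this.2]
  · intro x hx
    by_cases hxΩ : x ∈ Ω
    · obtain ⟨r, hr, h⟩ := EstOn.interior hΩ hb hxΩ
      exact ⟨_, mem_nhdsWithin_of_mem_nhds (Metric.ball_mem_nhds x hr), h⟩
    · have hf : x ∈ frontier Ω := by rw [hΩ.frontier_eq]; exact ⟨hx, hxΩ⟩
      obtain ⟨R, φ, μ, M0, hch⟩ := exists_chart h3 hf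
      exact ⟨_, mem_nhdsWithin_of_mem_nhds (Metric.ball_mem_nhds x (show 0 < R / 16 by linarith [hch.hR])),
        hch.est hΩ hb⟩

theorem testFun_zero {u₀ : Euc d → ℝ} (h : IsTestFun Ω u₀) {x : Euc d} (hx : x ∉ Ω) : u₀ x = 0 :=
  image_eq_zero_of_notMem_tsupport fun h' => hx (h.2.2 h')

theorem testFun_norm {u₀ : Euc d → ℝ} (h : IsTestFun Ω u₀) :
    eLpNorm u₀ ⊤ (volume.restrict Ω) ≠ ⊤ :=
  (h.1.continuous.memLp_of_hasCompactSupport h.2.1).2.ne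

theorem testFun_le (hΩ : IsOpen Ω) {u₀ : Euc d → ℝ} (h : IsTestFun Ω u₀) (x : Euc d) :
    |u₀ x| ≤ (eLpNorm u₀ ⊤ (volume.restrict Ω)).toReal := by
  set m := (eLpNorm u₀ ⊤ (volume.restrict Ω)).toReal with hm
  by_cases hx : x ∈ Ω
  swap
  · rw [testFun_zero h hx, abs_zero]; exact ENNReal.toReal_nonneg
  by_contra hn
  push Not at hn
  have hO : IsOpen (Ω ∩ {y | m < |u₀ y|}) :=
    hΩ.inter (isOpen_lt continuous_const h.1.continuous.abs)
  have hpos := hO.measure_pos volume ⟨x, hx, hn⟩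
  have hae : ∀ᵐ y ∂(volume.restrict Ω), ¬ (m < |u₀ y|) := by
    have := ae_le_eLpNormEssSup (f := u₀) (μ := volume.restrict Ω)
    filter_upwards [this] with y hy
    rw [← eLpNorm_exponent_top] at hy
    have := ENNReal.toReal_mono (testFun_norm h) hy
    rw [not_lt]
    rw [toReal_enorm, Real.norm_eq_abs] at this
    exact this
  rw [ae_restrict_iff' hΩ.measurableSet, ae_iff] at hae
  have e : {y | ¬ (y ∈ Ω → ¬ (m < |u₀ y|))} = Ω ∩ {y | m < |u₀ y|} := by
    ext y; simp
  rw [e] at hae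
  exact hpos.ne' hae

theorem IsHeatSol.hsol (hΩ : IsOpen Ω) {u₀ : Euc d → ℝ} (h0 : IsTestFun Ω u₀)
    {u : ℝ → Euc d → ℝ} (h : IsHeatSol Ω u₀ u) {M : ℝ}
    (hM : (eLpNorm u₀ ⊤ (volume.restrict Ω)).toReal ≤ M) : HSol Ω u M := by
  obtain ⟨h1, h2, h3, h4, h5⟩ := h
  refine ⟨h1, ?_, h3, ?_, ?_⟩
  · intro t ht x hx
    exact ((h2 t ht).contDiffAt (hΩ.mem_nhds hx)).of_le (by
      change ((2:ℕ∞) : WithTop ℕ∞) ≤ ((⊤:ℕ∞) : WithTop ℕ∞)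
      exact WithTop.coe_le_coe.2 le_top)
  · intro t ht x hx
    rcases ht.eq_or_lt with ht | ht
    · rw [← ht, h5]
      apply testFun_zero h0
      rw [hΩ.frontier_eq] at hx
      exact hx.2
    · exact h4 t ht x hx
  · intro x
    rw [h5]
    exact (testFun_le hΩ h0 x).trans hM

theorem eLpNorm_top_bound (hΩ : IsOpen Ω) {u₀ f : Euc d → ℝ} (h0 : IsTestFun Ω u₀) {c : ℝ} (hc : 0 ≤ c)
    (hf : ∀ x ∈ Ω, |f x| ≤ c * (eLpNorm u₀ ⊤ (volume.restrict Ω)).toReal) :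
    eLpNorm f ⊤ (volume.restrict Ω) ≤ ENNReal.ofReal c * eLpNorm u₀ ⊤ (volume.restrict Ω) := by
  rw [eLpNorm_exponent_top]
  refine (eLpNormEssSup_le_of_ae_bound (C := c * (eLpNorm u₀ ⊤ (volume.restrict Ω)).toReal) ?_).trans ?_
  · rw [ae_restrict_iff' hΩ.measurableSet]
    exact Eventually.of_forall fun x hx => by rw [Real.norm_eq_abs]; exact hf x hx
  · rw [ENNReal.ofReal_mul hc, ENNReal.ofReal_toReal (testFun_norm h0)]

theorem norm_iter2 (f : Euc d → ℝ) (x : Euc d) :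
    ‖iteratedFDeriv ℝ 2 f x‖ = ‖fderiv ℝ (fderiv ℝ f) x‖ := by
  rw [← norm_iteratedFDeriv_fderiv, ← norm_iteratedFDeriv_fderiv, norm_iteratedFDeriv_zero]

theorem norm_iter1 (f : Euc d → ℝ) (x : Euc d) :
    ‖iteratedFDeriv ℝ 1 f x‖ = ‖fderiv ℝ f x‖ := by
  rw [← norm_iteratedFDeriv_fderiv, norm_iteratedFDeriv_zero]

theorem le_mul_of_forall_eps {a C m : ℝ} (hC : 0 < C) (h : ∀ ε > 0, a ≤ C * (m + ε)) : a ≤ C * m := by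
  refine le_of_forall_pos_le_add fun ε hε => ?_
  have := h (ε / C) (by positivity)
  rw [mul_add, mul_div_cancel₀ _ hC.ne'] at this
  exact this

end assembly

/-- `L^∞` estimate: on a bounded `C³` domain there are `C, T > 0`
such that every Dirichlet heat solution with initial data `u₀ ∈ C_c^∞(Ω)`
satisfies `sup_{0<t<T} ‖N[u](t)‖_{L^∞(Ω)} ≤ C‖u₀‖_{L^∞(Ω)}`; in particular
`‖u(t)‖_∞ ≤ C‖u₀‖_∞`, `‖∇u(t)‖_∞ ≤ C t^{-1/2}‖u₀‖_∞` and
`‖∇²u(t)‖_∞ ≤ C t^{-1}‖u₀‖_∞` for `0 < t < T`. -/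
theorem heat_Linfty_N_estimate
    (d : ℕ) (Ω : Set (Euc d))
    (hΩ : IsBoundedDomain Ω) (hΩ3 : HasCkBoundary Ω 3) :
    ∃ C : ℝ, 0 < C ∧ ∃ T : ℝ, 0 < T ∧
      ∀ u₀ : Euc d → ℝ, IsTestFun Ω u₀ →
      ∀ u : ℝ → Euc d → ℝ, IsHeatSol Ω u₀ u →
      ∀ t ∈ Set.Ioo (0:ℝ) T,
        eLpNorm (Nfun u t) ⊤ (volume.restrict Ω) ≤
          ENNReal.ofReal C * eLpNorm u₀ ⊤ (volume.restrict Ω) ∧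
        eLpNorm (u t) ⊤ (volume.restrict Ω) ≤
          ENNReal.ofReal C * eLpNorm u₀ ⊤ (volume.restrict Ω) ∧
        cDNorm Ω ⊤ 1 (u t) ≤
          ENNReal.ofReal (C * t ^ (-(1:ℝ)/2)) * eLpNorm u₀ ⊤ (volume.restrict Ω) ∧
        cDNorm Ω ⊤ 2 (u t) ≤
          ENNReal.ofReal (C * t⁻¹) * eLpNorm u₀ ⊤ (volume.restrict Ω) := by
  obtain ⟨hO, -, hb⟩ := hΩ
  obtain ⟨C, hC, T, hT, hE⟩ := EstOn.closure hO hb hΩ3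
  have hd0 : (0:ℝ) ≤ d := by positivity
  have hdC : 0 ≤ d * C := by positivity
  have hK : 0 < 1 + 2 * C + d * C := by positivity
  refine ⟨1 + 2 * C + d * C, hK, T, hT, ?_⟩
  intro u₀ h0 u hu t ht
  set m := (eLpNorm u₀ ⊤ (volume.restrict Ω)).toReal with hm
  have hm0 : 0 ≤ m := ENNReal.toReal_nonneg
  have ht0 := ht.1
  have hst : 0 < √t := Real.sqrt_pos.2 ht0
  have P1 : ∀ x ∈ Ω, |u t x| ≤ m := by
    intro x hx
    have := le_mul_of_forall_eps (a := |u t x|) (m := m) one_pos (fun ε hε => by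
      rw [one_mul]
      exact (hu.hsol hO h0 (M := m + ε) (by linarith)).abs_le hO hb (by linarith) ht0.le
        (subset_closure hx))
    linarith
  have P2 : ∀ x ∈ Ω, √t * ‖fderiv ℝ (u t) x‖ ≤ C * m := fun x hx =>
    le_mul_of_forall_eps hC fun ε hε => (hE u (m + ε) (by linarith)
      (hu.hsol hO h0 (by linarith)) t ht x ⟨hx, subset_closure hx⟩).1
  have P3 : ∀ x ∈ Ω, t * ‖fderiv ℝ (fderiv ℝ (u t)) x‖ ≤ C * m := fun x hx =>
    le_mul_of_forall_eps hC fun ε hε => (hE u (m + ε) (by linarith)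
      (hu.hsol hO h0 (by linarith)) t ht x ⟨hx, subset_closure hx⟩).2
  have P4 : ∀ x ∈ Ω, t * |deriv (fun s => u s x) t| ≤ d * C * m := by
    intro x hx
    have hs := hu.hsol hO h0 le_rfl
    rw [(hs.eqn t ht0 x hx).deriv]
    calc t * |lap (u t) x| ≤ t * (d * ‖fderiv ℝ (fderiv ℝ (u t)) x‖) := by
          gcongr; exact abs_lap_le (hs.smooth t ht0 x hx)
      _ = d * (t * ‖fderiv ℝ (fderiv ℝ (u t)) x‖) := by ring
      _ ≤ d * (C * m) := mul_le_mul_of_nonneg_left (P3 x hx) hd0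
      _ = _ := by ring
  have hCm : C * m ≤ (1 + 2 * C + d * C) * m := mul_le_mul_of_nonneg_right (by linarith) hm0
  refine ⟨?_, ?_, ?_, ?_⟩
  · refine eLpNorm_top_bound hO h0 hK.le fun x hx => ?_
    have hn : 0 ≤ Nfun u t x := by unfold Nfun; positivity
    rw [abs_of_nonneg hn]
    unfold Nfun
    rw [norm_iter2]
    have h1 := P1 x hx
    have h2 := P2 x hx
    have h3 := P3 x hx
    have h4 := P4 x hx
    linarith
  · refine eLpNorm_top_bound hO h0 hK.le fun x hx => ?_
    refine (P1 x hx).trans ?_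
    change m ≤ _ * m
    nlinarith
  · unfold cDNorm
    refine eLpNorm_top_bound hO h0 (by positivity) fun x hx => ?_
    rw [abs_of_nonneg (norm_nonneg _), norm_iter1]
    have e : t ^ (-(1:ℝ)/2) = (√t)⁻¹ := by
      rw [Real.sqrt_eq_rpow, ← Real.rpow_neg ht0.le]; norm_num
    rw [e]
    change _ ≤ (1 + 2 * C + d * C) * (√t)⁻¹ * m
    have : (1 + 2 * C + d * C) * (√t)⁻¹ * m = ((1 + 2 * C + d * C) * m) / √t := by ring
    rw [this, le_div_iff₀ hst, mul_comm]
    exact (P2 x hx).trans hCm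
  · unfold cDNorm
    refine eLpNorm_top_bound hO h0 (by positivity) fun x hx => ?_
    rw [abs_of_nonneg (norm_nonneg _), norm_iter2]
    change _ ≤ (1 + 2 * C + d * C) * t⁻¹ * m
    have : (1 + 2 * C + d * C) * t⁻¹ * m = ((1 + 2 * C + d * C) * m) / t := by ring
    rw [this, le_div_iff₀ ht0, mul_comm]
    exact (P3 x hx).trans hCm
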